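/- Let n, m ≥ 1 and consider ℝ^{2(n+m)} = ℝ^{n+m} ⊕ ℝ^{n+m} with the quadratic form Q(u,v) = q_{n,m}(u) − e_{n+m}(v), where q_{n,m}(u) = u₁² + ⋯ + u_n² − u_{n+1}² − ⋯ − u_{n+m}² is the standard form of signature (n,m) and e_{n+m}(v) = v₁² + ⋯ + v_{n+m}² is the standard positive definite form; thus Q has signature (n, n+2m) and SO(Q), the group of determinant-1 linear automorphisms of ℝ^{2(n+m)} preserving Q, is isomorphic to SO(n, n+2m). Let H ≤ SO(Q) be the block-diagonal subgroup of elements preserving both summands ℝ^{n+m} ⊕ 0 and 0 ⊕ ℝ^{n+m} and acting with determinant 1 on each; H is isomorphic to SO(n,m) × SO(n+m). Then there exists a non-cocompact lattice Λ in SO(Q) such that Λ ∩ H is a cocompact lattice in H (i.e. Λ ∩ H is discrete in H and H/(Λ ∩ H) is compact). -/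

import Mathlib

open Matrix MeasureTheory

set_option linter.unusedSectionVars false

/-- A lattice in a topological group `G` with respect to a (left Haar) measure `μ`:
a discrete subgroup admitting a Borel fundamental domain of finite measure. -/
def IsLattice {G : Type*} [Group G] [TopologicalSpace G] [MeasurableSpace G]
    (μ : Measure G) (Λ : Subgroup G) : Prop :=
  DiscreteTopology Λ ∧
    ∃ D : Set G, MeasurableSet D ∧ μ D < ⊤ ∧
      (∀ g : G, ∃ γ : Λ, ∃ d ∈ D, g = (γ : G) * d) ∧
      ∀ d₁ ∈ D, ∀ d₂ ∈ D, ∀ γ : Λ, d₁ = (γ : G) * d₂ → d₁ = d₂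

/-- The quadratic form `Q(u,v) = q_{n,m}(u) - e_{n+m}(v)` on `ℝ^{n+m} ⊕ ℝ^{n+m}`,
of signature `(n, n+2m)`. -/
def Qform (n m : ℕ) (x : Fin (n + m) ⊕ Fin (n + m) → ℝ) : ℝ :=
  (∑ i : Fin (n + m), (if (i : ℕ) < n then (1 : ℝ) else -1) * x (Sum.inl i) ^ 2)
    - ∑ i : Fin (n + m), x (Sum.inr i) ^ 2

/-- `SO(Q)`: the group of determinant-one linear automorphisms of
`ℝ^{n+m} ⊕ ℝ^{n+m}` preserving the quadratic form `Q`. -/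
def SOQgrp (n m : ℕ) : Subgroup (GL (Fin (n + m) ⊕ Fin (n + m)) ℝ) where
  carrier := {A | A.val.det = 1 ∧ ∀ x, Qform n m (A.val.mulVec x) = Qform n m x}
  one_mem' := by simp [Matrix.one_mulVec]
  mul_mem' := by
    rintro A B ⟨hAd, hAQ⟩ ⟨hBd, hBQ⟩
    refine ⟨by simp [Units.val_mul, hAd, hBd], fun x => ?_⟩
    show Qform n m ((A.val * B.val).mulVec x) = Qform n m x
    rw [← Matrix.mulVec_mulVec, hAQ, hBQ]
  inv_mem' := by
    rintro A ⟨hAd, hAQ⟩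
    have h1 : A.val * (A⁻¹).val = 1 := by
      rw [← Units.val_mul, mul_inv_cancel, Units.val_one]
    refine ⟨?_, fun x => ?_⟩
    · have h2 : A.val.det * (A⁻¹).val.det = 1 := by
        rw [← Matrix.det_mul, h1, Matrix.det_one]
      rwa [hAd, one_mul] at h2
    · have h2 := hAQ ((A⁻¹).val.mulVec x)
      rw [Matrix.mulVec_mulVec, h1, Matrix.one_mulVec] at h2
      exact h2.symm

section BlockLemmas

variable {l : Type*} [Fintype l] [DecidableEq l]

lemma toBlocks11_mul (M N : Matrix (l ⊕ l) (l ⊕ l) ℝ)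
    (hM : ∀ i j, M (Sum.inl i) (Sum.inr j) = 0) :
    (M * N).toBlocks₁₁ = M.toBlocks₁₁ * N.toBlocks₁₁ := by
  ext i j
  simp [Matrix.toBlocks₁₁, Matrix.mul_apply, Fintype.sum_sum_type, hM]

lemma toBlocks12_mul (M N : Matrix (l ⊕ l) (l ⊕ l) ℝ)
    (hM : ∀ i j, M (Sum.inl i) (Sum.inr j) = 0) :
    (M * N).toBlocks₁₂ = M.toBlocks₁₁ * N.toBlocks₁₂ := by
  ext i j
  simp [Matrix.toBlocks₁₁, Matrix.toBlocks₁₂, Matrix.mul_apply, Fintype.sum_sum_type, hM]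

lemma toBlocks21_mul (M N : Matrix (l ⊕ l) (l ⊕ l) ℝ)
    (hM : ∀ i j, M (Sum.inr i) (Sum.inl j) = 0) :
    (M * N).toBlocks₂₁ = M.toBlocks₂₂ * N.toBlocks₂₁ := by
  ext i j
  simp [Matrix.toBlocks₂₂, Matrix.toBlocks₂₁, Matrix.mul_apply, Fintype.sum_sum_type, hM]

lemma toBlocks22_mul (M N : Matrix (l ⊕ l) (l ⊕ l) ℝ)
    (hM : ∀ i j, M (Sum.inr i) (Sum.inl j) = 0) :
    (M * N).toBlocks₂₂ = M.toBlocks₂₂ * N.toBlocks₂₂ := by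
  ext i j
  simp [Matrix.toBlocks₂₂, Matrix.mul_apply, Fintype.sum_sum_type, hM]

end BlockLemmas

/-- The block-diagonal subgroup `H` of `SO(Q)`: elements preserving both summands
`ℝ^{n+m} ⊕ 0` and `0 ⊕ ℝ^{n+m}` and acting with determinant `1` on each.
It is isomorphic to `SO(n,m) × SO(n+m)`. -/
def blockDiagSubgroup (n m : ℕ) : Subgroup ↥(SOQgrp n m) where
  carrier := {A | (∀ i j, A.val.val (Sum.inl i) (Sum.inr j) = 0) ∧
    (∀ i j, A.val.val (Sum.inr i) (Sum.inl j) = 0) ∧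
    A.val.val.toBlocks₁₁.det = 1 ∧ A.val.val.toBlocks₂₂.det = 1}
  one_mem' := by
    refine ⟨fun i j => ?_, fun i j => ?_, ?_, ?_⟩
    · show (1 : Matrix _ _ ℝ) (Sum.inl i) (Sum.inr j) = 0
      simp [Matrix.one_apply]
    · show (1 : Matrix _ _ ℝ) (Sum.inr i) (Sum.inl j) = 0
      simp [Matrix.one_apply]
    · show (1 : Matrix _ _ ℝ).toBlocks₁₁.det = 1
      rw [← Matrix.fromBlocks_one, Matrix.toBlocks_fromBlocks₁₁, Matrix.det_one]
    · show (1 : Matrix _ _ ℝ).toBlocks₂₂.det = 1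
      rw [← Matrix.fromBlocks_one, Matrix.toBlocks_fromBlocks₂₂, Matrix.det_one]
  mul_mem' := by
    rintro A B ⟨hA12, hA21, hA11, hA22⟩ ⟨hB12, hB21, hB11, hB22⟩
    refine ⟨fun i j => ?_, fun i j => ?_, ?_, ?_⟩
    · show (A.val.val * B.val.val) (Sum.inl i) (Sum.inr j) = 0
      simp [Matrix.mul_apply, Fintype.sum_sum_type, hA12, hB12]
    · show (A.val.val * B.val.val) (Sum.inr i) (Sum.inl j) = 0
      simp [Matrix.mul_apply, Fintype.sum_sum_type, hA21, hB21]
    · show (A.val.val * B.val.val).toBlocks₁₁.det = 1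
      rw [toBlocks11_mul _ _ hA12, Matrix.det_mul, hA11, hB11, mul_one]
    · show (A.val.val * B.val.val).toBlocks₂₂.det = 1
      rw [toBlocks22_mul _ _ hA21, Matrix.det_mul, hA22, hB22, mul_one]
  inv_mem' := by
    rintro A ⟨hA12, hA21, hA11, hA22⟩
    have h1 : A.val.val * (A⁻¹).val.val = 1 := by
      show A.val.val * ((A.val)⁻¹).val = 1
      rw [← Units.val_mul, mul_inv_cancel, Units.val_one]
    have hP : IsUnit (A.val.val.toBlocks₁₁.det) := by rw [hA11]; exact isUnit_one
    have hQu : IsUnit (A.val.val.toBlocks₂₂.det) := by rw [hA22]; exact isUnit_one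
    -- blocks of the product
    have e11 : A.val.val.toBlocks₁₁ * (A⁻¹).val.val.toBlocks₁₁ = 1 := by
      rw [← toBlocks11_mul _ _ hA12, h1, ← Matrix.fromBlocks_one,
        Matrix.toBlocks_fromBlocks₁₁]
    have e12 : A.val.val.toBlocks₁₁ * (A⁻¹).val.val.toBlocks₁₂ = 0 := by
      rw [← toBlocks12_mul _ _ hA12, h1, ← Matrix.fromBlocks_one,
        Matrix.toBlocks_fromBlocks₁₂]
    have e21 : A.val.val.toBlocks₂₂ * (A⁻¹).val.val.toBlocks₂₁ = 0 := by
      rw [← toBlocks21_mul _ _ hA21, h1, ← Matrix.fromBlocks_one,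
        Matrix.toBlocks_fromBlocks₂₁]
    have e22 : A.val.val.toBlocks₂₂ * (A⁻¹).val.val.toBlocks₂₂ = 1 := by
      rw [← toBlocks22_mul _ _ hA21, h1, ← Matrix.fromBlocks_one,
        Matrix.toBlocks_fromBlocks₂₂]
    have z12 : (A⁻¹).val.val.toBlocks₁₂ = 0 := by
      calc (A⁻¹).val.val.toBlocks₁₂
          = (A.val.val.toBlocks₁₁)⁻¹ * (A.val.val.toBlocks₁₁ * (A⁻¹).val.val.toBlocks₁₂) := by
            rw [← Matrix.mul_assoc, Matrix.nonsing_inv_mul _ hP, Matrix.one_mul]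
        _ = 0 := by rw [e12, Matrix.mul_zero]
    have z21 : (A⁻¹).val.val.toBlocks₂₁ = 0 := by
      calc (A⁻¹).val.val.toBlocks₂₁
          = (A.val.val.toBlocks₂₂)⁻¹ * (A.val.val.toBlocks₂₂ * (A⁻¹).val.val.toBlocks₂₁) := by
            rw [← Matrix.mul_assoc, Matrix.nonsing_inv_mul _ hQu, Matrix.one_mul]
        _ = 0 := by rw [e21, Matrix.mul_zero]
    refine ⟨fun i j => ?_, fun i j => ?_, ?_, ?_⟩
    · have := congrFun (congrFun z12 i) j
      simpa [Matrix.toBlocks₁₂] using this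
    · have := congrFun (congrFun z21 i) j
      simpa [Matrix.toBlocks₂₁] using this
    · have hdet : A.val.val.toBlocks₁₁.det * (A⁻¹).val.val.toBlocks₁₁.det = 1 := by
        rw [← Matrix.det_mul, e11, Matrix.det_one]
      rwa [hA11, one_mul] at hdet
    · have hdet : A.val.val.toBlocks₂₂.det * (A⁻¹).val.val.toBlocks₂₂.det = 1 := by
        rw [← Matrix.det_mul, e22, Matrix.det_one]
      rwa [hA22, one_mul] at hdet

lemma one_add_sum_le_prod_one_add {ι : Type*} (s : Finset ι) {f : ι → ℝ}
    (hf : ∀ i ∈ s, 0 ≤ f i) : 1 + ∑ i ∈ s, f i ≤ ∏ i ∈ s, (1 + f i) := by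
  classical
  induction s using Finset.induction_on with
  | empty => simp
  | insert a s ha ih =>
    rw [Finset.sum_insert ha, Finset.prod_insert ha]
    have h1 := ih fun i hi => hf i (Finset.mem_insert_of_mem hi)
    have h2 := hf a (Finset.mem_insert_self a s)
    have h3 : 0 ≤ ∑ i ∈ s, f i := Finset.sum_nonneg fun i hi => hf i (Finset.mem_insert_of_mem hi)
    nlinarith

lemma one_add_det_ge {ι : Type*} [Fintype ι] [DecidableEq ι] {T : Matrix ι ι ℝ}
    (hT : T.PosSemidef) : 1 + T.trace ≤ (1 + T).det := by
  have h1 : (1 + T).det = ∏ i, (1 + hT.1.eigenvalues i) := by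
    have h := hT.1.charpoly_eq
    have h2 := congrArg (Polynomial.eval (-1)) h
    rw [Matrix.eval_charpoly, Polynomial.eval_prod] at h2
    have h3 : (Matrix.scalar ι (-1 : ℝ) - T) = -(1 + T) := by
      rw [map_neg, map_one]; abel
    rw [h3, Matrix.det_neg] at h2
    have h4 : ∀ i, Polynomial.eval (-1) (Polynomial.X - Polynomial.C (hT.1.eigenvalues i))
        = (-1) * (1 + hT.1.eigenvalues i) := by intro i; simp; ring
    simp only [RCLike.ofReal_real_eq_id, id_eq] at h2
    rw [Finset.prod_congr rfl (fun i _ => h4 i), Finset.prod_mul_distrib] at h2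
    simp only [Finset.prod_const, Finset.card_univ] at h2
    exact mul_left_cancel₀ (pow_ne_zero _ (by norm_num)) h2
  rw [h1, hT.1.trace_eq_sum_eigenvalues]
  exact one_add_sum_le_prod_one_add _ fun i _ => hT.eigenvalues_nonneg i

open scoped MatrixOrder in
lemma Matrix.PosDef.exists_eq_transpose_mul_self {ι : Type*} [Fintype ι] [DecidableEq ι]
    {S : Matrix ι ι ℝ} (hS : S.PosDef) : ∃ C : Matrix ι ι ℝ, IsUnit C.det ∧ S = Cᵀ * C := by
  obtain ⟨C, rfl⟩ := CStarAlgebra.nonneg_iff_eq_star_mul_self.mp hS.posSemidef.nonneg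
  have h : star C = Cᵀ := conjTranspose_eq_transpose_of_trivial C
  refine ⟨C, ?_, by rw [h]⟩
  have := hS.det_pos
  rw [det_mul] at this
  exact isUnit_iff_ne_zero.2 fun h => by simp [h] at this

/-- The determinant is monotone on positive (semi)definite matrices, strictly so. -/
lemma det_le_det_add {ι : Type*} [Fintype ι] [DecidableEq ι] {S T : Matrix ι ι ℝ}
    (hS : S.PosDef) (hT : T.PosSemidef) :
    S.det ≤ (S + T).det ∧ ((S + T).det ≤ S.det → T = 0) := by
  obtain ⟨C, hCd, rfl⟩ := hS.exists_eq_transpose_mul_self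
  set T' := C⁻¹ᵀ * T * C⁻¹ with hT'
  have hT'p : T'.PosSemidef := by
    have := hT.conjTranspose_mul_mul_same C⁻¹
    rwa [conjTranspose_eq_transpose_of_trivial] at this
  have hTe : T = Cᵀ * T' * C := by
    rw [hT']
    have : Cᵀ * C⁻¹ᵀ = 1 := by rw [← transpose_mul, nonsing_inv_mul _ hCd, transpose_one]
    calc T = (Cᵀ * C⁻¹ᵀ) * T * (C⁻¹ * C) := by rw [this, nonsing_inv_mul _ hCd]; simp
      _ = _ := by simp only [Matrix.mul_assoc]
  have hd : (Cᵀ * C + T).det = (Cᵀ * C).det * (1 + T').det := by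
    have : Cᵀ * C + T = Cᵀ * (1 + T') * C := by
      rw [hTe, Matrix.mul_add, Matrix.add_mul, Matrix.mul_one]
    rw [this]; simp only [det_mul]; ring
  have hpos : 0 < (Cᵀ * C).det := hS.det_pos
  have h1 := one_add_det_ge hT'p
  have h2 := hT'p.trace_nonneg
  rw [hd]
  refine ⟨by nlinarith, fun h => ?_⟩
  have : (1 + T').det ≤ 1 := by
    by_contra! h'; nlinarith
  have : T' = 0 := hT'p.trace_eq_zero_iff.1 (by linarith)
  rw [hTe, this]; simp

/-- The Gram determinant of the columns of `B`. -/
noncomputable def gramDet {ν ι : Type*} [Fintype ν] [Fintype ι] [DecidableEq ι]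
    (B : Matrix ν ι ℝ) : ℝ := (Bᵀ * B).det

section Gram

variable {ν ι α β γ : Type*} [Fintype ν] [Fintype ι] [DecidableEq ι]
  [Fintype α] [DecidableEq α] [Fintype β] [DecidableEq β] [Fintype γ] [DecidableEq γ]

lemma posSemidef_transpose_mul_self (B : Matrix ν ι ℝ) : (Bᵀ * B).PosSemidef := by
  have := posSemidef_conjTranspose_mul_self B
  rwa [conjTranspose_eq_transpose_of_trivial] at this

lemma gramDet_nonneg (B : Matrix ν ι ℝ) : 0 ≤ gramDet B :=
  (posSemidef_transpose_mul_self B).det_nonneg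

lemma posDef_of_gramDet_ne_zero {B : Matrix ν ι ℝ} (h : gramDet B ≠ 0) : (Bᵀ * B).PosDef :=
  (posSemidef_transpose_mul_self B).posDef_iff_det_ne_zero.2 h

lemma gramDet_mul (B : Matrix ν ι ℝ) (U : Matrix ι ι ℝ) :
    gramDet (B * U) = gramDet B * U.det ^ 2 := by
  have : (B * U)ᵀ * (B * U) = Uᵀ * (Bᵀ * B) * U := by
    simp only [transpose_mul, Matrix.mul_assoc]
  rw [gramDet, gramDet, this]
  simp only [det_mul, det_transpose]; ring

lemma gramDet_reindex (B : Matrix ν ι ℝ) (e : α ≃ ι) :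
    gramDet (B.submatrix id e) = gramDet B := by
  have : (B.submatrix id e)ᵀ * (B.submatrix id e) = (Bᵀ * B).submatrix e e := by
    ext i j; simp [Matrix.mul_apply]
  rw [gramDet, this, det_submatrix_equiv_self, gramDet]

lemma gramDet_pos_iff {B : Matrix ν ι ℝ} :
    0 < gramDet B ↔ ∀ x : ι → ℝ, B *ᵥ x = 0 → x = 0 := by
  constructor
  · intro h x hx
    have := (posDef_of_gramDet_ne_zero h.ne').isUnit
    refine mulVec_injective_iff_isUnit.2 this ?_
    simp [← mulVec_mulVec, hx]
  · intro h
    refine lt_of_le_of_ne (gramDet_nonneg B) (Ne.symm ?_)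
    rw [gramDet, ← isUnit_iff_ne_zero, ← isUnit_iff_isUnit_det, ← mulVec_injective_iff_isUnit]
    refine (injective_iff_map_eq_zero (Bᵀ * B).mulVecLin).2 fun x hx => h x ?_
    have h2 : x ⬝ᵥ ((Bᵀ * B) *ᵥ x) = 0 := by
      rw [mulVecLin_apply] at hx; rw [hx]; simp
    rw [← mulVec_mulVec, dotProduct_mulVec, vecMul_transpose] at h2
    exact dotProduct_self_eq_zero.1 h2

/-- The component of the columns of `Y` orthogonal to the columns of `X`. -/
noncomputable def orthPart (X : Matrix ν α ℝ) (Y : Matrix ν β ℝ) : Matrix ν β ℝ :=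
  Y - X * ((Xᵀ * X)⁻¹ * (Xᵀ * Y))

lemma gram_orthPart {X : Matrix ν α ℝ} (hX : gramDet X ≠ 0) (Y : Matrix ν β ℝ) :
    (orthPart X Y)ᵀ * orthPart X Y = Yᵀ * Y - Yᵀ * X * (Xᵀ * X)⁻¹ * (Xᵀ * Y) := by
  have hu : IsUnit (Xᵀ * X).det := isUnit_iff_ne_zero.2 hX
  have hs : ((Xᵀ * X)⁻¹)ᵀ = (Xᵀ * X)⁻¹ := by
    rw [transpose_nonsing_inv, transpose_mul, transpose_transpose]
  have h1 : Xᵀ * orthPart X Y = 0 := by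
    rw [orthPart, Matrix.mul_sub, ← Matrix.mul_assoc, ← Matrix.mul_assoc, mul_nonsing_inv _ hu,
      Matrix.one_mul, sub_self]
  have h2 : (orthPart X Y)ᵀ = Yᵀ - Yᵀ * X * (Xᵀ * X)⁻¹ * Xᵀ := by
    simp only [orthPart, transpose_sub, transpose_mul, hs, transpose_transpose, Matrix.mul_assoc]
  rw [h2, Matrix.sub_mul, Matrix.mul_assoc _ Xᵀ, h1, Matrix.mul_zero, sub_zero, orthPart,
    Matrix.mul_sub]
  simp only [Matrix.mul_assoc]

lemma gramDet_fromCols {X : Matrix ν α ℝ} (hX : gramDet X ≠ 0) (Y : Matrix ν β ℝ) :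
    gramDet (fromCols X Y) = gramDet X * gramDet (orthPart X Y) := by
  have hb : (fromCols X Y)ᵀ * fromCols X Y
      = fromBlocks (Xᵀ * X) (Xᵀ * Y) (Yᵀ * X) (Yᵀ * Y) := by
    rw [transpose_fromCols, fromRows_mul_fromCols]
  have hu : IsUnit (Xᵀ * X).det := isUnit_iff_ne_zero.2 hX
  let _ := invertibleOfIsUnitDet _ hu
  rw [gramDet, hb, det_fromBlocks₁₁, invOf_eq_nonsing_inv, gramDet, gramDet,
    gram_orthPart hX]

lemma gramDet_ne_zero_of_fromCols {X : Matrix ν α ℝ} {Y : Matrix ν β ℝ}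
    (h : gramDet (fromCols X Y) ≠ 0) : gramDet X ≠ 0 := by
  have h' := gramDet_pos_iff.1 (lt_of_le_of_ne (gramDet_nonneg _) h.symm)
  refine (gramDet_pos_iff.2 fun x hx => ?_).ne'
  have := h' (Sum.elim x 0) (by
    rw [fromCols_mulVec]; simpa using hx)
  ext i; simpa using congrFun this (Sum.inl i)

lemma gramDet_orthPart_le {X : Matrix ν α ℝ} (hX : gramDet X ≠ 0) (Y : Matrix ν β ℝ) :
    gramDet (orthPart X Y) ≤ gramDet Y := by
  by_cases h0 : gramDet (orthPart X Y) = 0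
  · rw [h0]; exact gramDet_nonneg _
  have hp := posDef_of_gramDet_ne_zero h0
  have hpi : ((Xᵀ * X)⁻¹).PosSemidef := (posSemidef_transpose_mul_self X).inv
  have h2 : ((Xᵀ * Y)ᵀ * (Xᵀ * X)⁻¹ * (Xᵀ * Y)).PosSemidef := by
    have := hpi.conjTranspose_mul_mul_same (Xᵀ * Y)
    rwa [conjTranspose_eq_transpose_of_trivial] at this
  have := (det_le_det_add hp h2).1
  rw [gram_orthPart hX] at this
  rw [gramDet, gramDet, gram_orthPart hX]
  convert this using 2
  simp [transpose_mul]

lemma orthPart_fromCols (X : Matrix ν α ℝ) (Y : Matrix ν β ℝ) (Z : Matrix ν γ ℝ) :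
    orthPart X (fromCols Y Z) = fromCols (orthPart X Y) (orthPart X Z) := by
  simp only [orthPart, mul_fromCols]
  ext i (j | j) <;> simp

/-- Submodularity of (squared) covolumes. -/
lemma gramDet_submodular (X : Matrix ν α ℝ) (Y : Matrix ν β ℝ) (Z : Matrix ν γ ℝ)
    (h : gramDet (fromCols X Y) ≠ 0) :
    gramDet (fromCols X (fromCols Y Z)) * gramDet X
      ≤ gramDet (fromCols X Y) * gramDet (fromCols X Z) := by
  have hX := gramDet_ne_zero_of_fromCols h
  have hX0 := gramDet_nonneg X
  rw [gramDet_fromCols hX] at h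
  have hY := right_ne_zero_of_mul h
  rw [gramDet_fromCols hX, gramDet_fromCols hX, gramDet_fromCols hX, orthPart_fromCols,
    gramDet_fromCols hY]
  have h1 := gramDet_orthPart_le hY (orthPart X Z)
  have h2 := gramDet_nonneg (orthPart X Y)
  calc _ = gramDet X * gramDet X * gramDet (orthPart X Y) *
        gramDet (orthPart (orthPart X Y) (orthPart X Z)) := by ring
    _ ≤ gramDet X * gramDet X * gramDet (orthPart X Y) * gramDet (orthPart X Z) := by gcongr
    _ = _ := by ring

/-- Log-convexity of the covolume along a one-parameter group, with its equality case. -/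
lemma one_le_det_mul_det [DecidableEq ν] {P : Matrix ν ν ℝ} (hP : P.PosDef) {O : Matrix ν ι ℝ}
    (hO : Oᵀ * O = 1) :
    1 ≤ (Oᵀ * P * O).det * (Oᵀ * P⁻¹ * O).det ∧
      ((Oᵀ * P * O).det * (Oᵀ * P⁻¹ * O).det ≤ 1 →
        P⁻¹ * O = O * (Oᵀ * P * O)⁻¹) := by
  have hinj : Function.Injective O.mulVec := by
    intro x y hxy
    have := congrArg (fun z => Oᵀ *ᵥ z) hxy
    simpa [mulVec_mulVec, hO] using this
  have hA : (Oᵀ * P * O).PosDef := by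
    have := hP.conjTranspose_mul_mul_same (B := O) hinj
    rwa [conjTranspose_eq_transpose_of_trivial] at this
  set A := Oᵀ * P * O with hAdef
  have hAu : IsUnit A.det := isUnit_iff_ne_zero.2 hA.det_pos.ne'
  have hPu : IsUnit P.det := isUnit_iff_ne_zero.2 hP.det_pos.ne'
  have hPs : Pᵀ = P := by
    have := hP.1.eq; rwa [conjTranspose_eq_transpose_of_trivial] at this
  have hAs : Aᵀ = A := by
    have := hA.1.eq; rwa [conjTranspose_eq_transpose_of_trivial] at this
  set Z := P⁻¹ * O - O * A⁻¹ with hZ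
  have hZT : Zᵀ = Oᵀ * P⁻¹ - A⁻¹ * Oᵀ := by
    rw [hZ, transpose_sub, transpose_mul, transpose_mul, transpose_nonsing_inv,
      transpose_nonsing_inv, hPs, hAs]
  have hPZ : P * Z = O - P * O * A⁻¹ := by
    rw [hZ, Matrix.mul_sub, ← Matrix.mul_assoc, mul_nonsing_inv _ hPu, Matrix.one_mul,
      Matrix.mul_assoc]
  have hZPZ : Zᵀ * P * Z = Oᵀ * P⁻¹ * O - A⁻¹ := by
    rw [Matrix.mul_assoc, hPZ, hZT, Matrix.sub_mul, Matrix.mul_sub, Matrix.mul_sub]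
    have e1 : Oᵀ * P⁻¹ * (P * O * A⁻¹) = A⁻¹ := by
      calc _ = Oᵀ * (P⁻¹ * P) * O * A⁻¹ := by simp only [Matrix.mul_assoc]
        _ = _ := by rw [nonsing_inv_mul _ hPu, Matrix.mul_one, hO, Matrix.one_mul]
    have e2 : A⁻¹ * Oᵀ * O = A⁻¹ := by rw [Matrix.mul_assoc, hO, Matrix.mul_one]
    have e3 : A⁻¹ * Oᵀ * (P * O * A⁻¹) = A⁻¹ := by
      calc _ = A⁻¹ * A * A⁻¹ := by rw [hAdef]; simp only [Matrix.mul_assoc]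
        _ = _ := by rw [nonsing_inv_mul _ hAu, Matrix.one_mul]
    rw [e1, e2, e3]; simp
  have hT : (Zᵀ * P * Z).PosSemidef := by
    have := hP.posSemidef.conjTranspose_mul_mul_same Z
    rwa [conjTranspose_eq_transpose_of_trivial] at this
  obtain ⟨h1, h2⟩ := det_le_det_add hA.inv hT
  rw [hZPZ, add_sub_cancel, det_nonsing_inv, Ring.inverse_eq_inv'] at h1 h2
  have hpos := hA.det_pos
  constructor
  · rw [inv_le_iff_one_le_mul₀ hpos] at h1
    rwa [mul_comm]
  · intro h
    have h3 := h2 (by rw [le_inv_comm₀ _ hpos]; · rw [← one_div, le_div_iff₀]; exact h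
                                                  exact lt_of_lt_of_le (inv_pos.2 hpos) h1
                      exact lt_of_lt_of_le (inv_pos.2 hpos) h1)
    rw [← hZPZ] at h3
    have hZ0 : Z = 0 := by
      ext i j
      by_contra hne
      have hz : Z.col j ≠ 0 := fun h => hne (congrFun h i)
      have := hP.dotProduct_mulVec_pos hz
      have h4 := congrFun (congrFun h3 j) j
      have : (Zᵀ * P * Z) j j = Z.col j ⬝ᵥ (P *ᵥ Z.col j) := by
        rw [Matrix.mul_assoc]
        simp [Matrix.mul_apply, dotProduct, mulVec, Matrix.col]
      simp_all
    exact sub_eq_zero.1 hZ0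

end Gram

section Boost

variable {ν : Type*} [Fintype ν] [DecidableEq ν]

/-- The symmetric matrix interchanging the coordinates `a` and `b` and killing the others. -/
def swapMat (a b : ν) : Matrix ν ν ℝ := single a b 1 + single b a 1

/-- The matrix acting as `!![c, s; s, c]` in the plane of the coordinates `a` and `b`. -/
def boost (a b : ν) (c s : ℝ) : Matrix ν ν ℝ :=
  1 + (c - 1) • (single a a 1 + single b b 1) + s • swapMat a b

lemma boost_mul {a b : ν} (h : a ≠ b) (c s c' s' : ℝ) :
    boost a b c s * boost a b c' s' = boost a b (c * c' + s * s') (c * s' + s * c') := by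
  simp only [boost, swapMat, Matrix.add_mul, Matrix.mul_add, Matrix.one_mul,
    Matrix.smul_mul, Matrix.mul_smul, single_mul_single_same, single_mul_single_of_ne _ _ _ _ h,
    single_mul_single_of_ne _ _ _ _ h.symm, mul_one, smul_add, add_zero, zero_add, smul_zero]
  module

@[simp] lemma boost_one_zero (a b : ν) : boost a b 1 0 = 1 := by simp [boost]

lemma boost_transpose (a b : ν) (c s : ℝ) : (boost a b c s)ᵀ = boost a b c s := by
  simp only [boost, swapMat, transpose_add, transpose_smul, transpose_single, transpose_one]
  module

lemma boost_mul_boost_neg {a b : ν} (h : a ≠ b) :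
    boost a b (5/4) (3/4) * boost a b (5/4) (-3/4) = 1 := by
  rw [boost_mul h]; norm_num

lemma boost_neg_mul_boost {a b : ν} (h : a ≠ b) :
    boost a b (5/4) (-3/4) * boost a b (5/4) (3/4) = 1 := by
  rw [boost_mul h]; norm_num

lemma swapMat_mulVec (a b : ν) (v : ν → ℝ) :
    swapMat a b *ᵥ v = Pi.single a (v b) + Pi.single b (v a) := by
  ext i
  simp only [swapMat, add_mulVec, single_mulVec, Pi.add_apply, Function.update_apply,
    Pi.zero_apply, one_mul, Pi.single_apply]

variable {ι : Type*} [Fintype ι] [DecidableEq ι]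

lemma one_le_gramDet_boost {a b : ν} (h : a ≠ b) {O : Matrix ν ι ℝ} (hO : Oᵀ * O = 1) :
    1 ≤ gramDet (boost a b (5/4) (3/4) * O) * gramDet (boost a b (5/4) (-3/4) * O) ∧
    (gramDet (boost a b (5/4) (3/4) * O) * gramDet (boost a b (5/4) (-3/4) * O) ≤ 1 →
      ∃ A : Matrix ι ι ℝ, swapMat a b * O = O * A) := by
  set g := boost a b (5/4) (3/4) with hg
  set g' := boost a b (5/4) (-3/4) with hg'
  have hgg : g * g' = 1 := boost_mul_boost_neg h
  have hgg' : g' * g = 1 := boost_neg_mul_boost h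
  have hgu : IsUnit g := ⟨⟨g, g', hgg, hgg'⟩, rfl⟩
  have hP : (g * g).PosDef := by
    have := (PosDef.one (n := ν) (R := ℝ)).conjTranspose_mul_mul_same (B := g)
      (mulVec_injective_iff_isUnit.2 hgu)
    rwa [conjTranspose_eq_transpose_of_trivial, Matrix.mul_one, hg, boost_transpose] at this
  have hPi : (g * g)⁻¹ = g' * g' := by
    apply inv_eq_right_inv
    rw [Matrix.mul_assoc, ← Matrix.mul_assoc g g', hgg, Matrix.one_mul, hgg]
  have e1 : gramDet (g * O) = (Oᵀ * (g * g) * O).det := by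
    rw [gramDet, transpose_mul, hg, boost_transpose]; simp only [Matrix.mul_assoc]
  have e2 : gramDet (g' * O) = (Oᵀ * (g * g)⁻¹ * O).det := by
    rw [gramDet, transpose_mul, hPi, hg', boost_transpose]; simp only [Matrix.mul_assoc]
  obtain ⟨h1, h2⟩ := one_le_det_mul_det hP hO
  rw [e1, e2]
  refine ⟨h1, fun h3 => ?_⟩
  have h4 := h2 h3
  have hne : (Oᵀ * (g * g) * O).det ≠ 0 := fun h0 => by rw [h0] at h1; norm_num at h1
  generalize Oᵀ * (g * g) * O = A at h4 hne
  have hPu : IsUnit (g * g).det := isUnit_iff_ne_zero.2 hP.det_pos.ne'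
  have h5 : (g * g) * O = O * A := by
    calc (g * g) * O = (g * g) * (O * A⁻¹) * A := by
          rw [Matrix.mul_assoc (g * g) (O * A⁻¹) A, Matrix.mul_assoc O,
            nonsing_inv_mul _ (isUnit_iff_ne_zero.2 hne), Matrix.mul_one]
      _ = O * A := by
          rw [← h4, ← Matrix.mul_assoc (g * g) (g * g)⁻¹ O, mul_nonsing_inv _ hPu, Matrix.one_mul]
  have h6 : swapMat a b = (4/15 : ℝ) • (g * g - (g * g)⁻¹) := by
    rw [hPi, hg, hg', boost_mul h, boost_mul h]
    simp only [boost]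
    module
  refine ⟨(4/15 : ℝ) • (A - A⁻¹), ?_⟩
  rw [h6, Matrix.smul_mul, Matrix.sub_mul, h5, h4, Matrix.mul_smul, Matrix.mul_sub]

/-- No proper nonzero subspace is invariant under all the infinitesimal boosts. -/
lemma exists_not_swapMat_invariant {p : ν → Prop} {a₀ b₀ b₁ : ν} (ha : p a₀) (hb₀ : ¬ p b₀)
    (hb₁ : ¬ p b₁) (hb : b₀ ≠ b₁) [Nonempty ι] (hι : Fintype.card ι < Fintype.card ν)
    {O : Matrix ν ι ℝ} (hO : Oᵀ * O = 1) :
    ∃ a b, p a ∧ ¬ p b ∧ ¬ ∃ A : Matrix ι ι ℝ, swapMat a b * O = O * A := by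
  by_contra! hcon
  set L := LinearMap.range O.mulVecLin with hL
  have hne : ∀ a b, p a → ¬ p b → a ≠ b := fun a b h h' e => h' (e ▸ h)
  have hinv : ∀ a b, p a → ¬ p b → ∀ v ∈ L, Pi.single a (v b) + Pi.single b (v a) ∈ L := by
    rintro a b h h' v ⟨x, rfl⟩
    obtain ⟨A, hA⟩ := hcon a b h h'
    rw [← swapMat_mulVec, mulVecLin_apply, mulVec_mulVec, hA, ← mulVec_mulVec]
    exact ⟨_, rfl⟩
  have hs : ∀ (v : ν → ℝ) (a : ν) , v a ≠ 0 → Pi.single a (v a) ∈ L → Pi.single a (1:ℝ) ∈ L := by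
    intro v a h h'
    have := L.smul_mem (v a)⁻¹ h'
    rwa [← Pi.single_smul, smul_eq_mul, inv_mul_cancel₀ h] at this
  -- it suffices to find a positive coordinate vector
  have key : ∀ a, p a → Pi.single a (1:ℝ) ∈ L → False := by
    intro a h hm
    have hneg : ∀ b, ¬ p b → Pi.single b (1:ℝ) ∈ L := by
      intro b h'
      have := hinv a b h h' _ hm
      simpa [Pi.single_eq_of_ne (hne a b h h').symm] using this
    have hpos : ∀ a', p a' → Pi.single a' (1:ℝ) ∈ L := by
      intro a' h'
      have := hinv a' b₀ h' hb₀ _ (hneg b₀ hb₀)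
      simpa [Pi.single_eq_of_ne (hne a' b₀ h' hb₀)] using this
    have htop : L = ⊤ := by
      rw [eq_top_iff, ← (Pi.basisFun ℝ ν).span_eq, Submodule.span_le]
      rintro _ ⟨i, rfl⟩
      rw [Pi.basisFun_apply]
      by_cases hi : p i
      · exact hpos i hi
      · exact hneg i hi
    have h1 : Module.finrank ℝ L ≤ Fintype.card ι := by
      have := LinearMap.finrank_range_le O.mulVecLin
      simpa using this
    rw [htop, finrank_top, Module.finrank_fintype_fun_eq_card] at h1
    omega
  obtain ⟨i₀⟩ := ‹Nonempty ι›
  set v := O *ᵥ Pi.single i₀ 1 with hv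
  have hvL : v ∈ L := ⟨_, rfl⟩
  have hv0 : v ≠ 0 := by
    intro h
    have h1 : Oᵀ *ᵥ v = Pi.single i₀ 1 := by rw [hv, mulVec_mulVec, hO, one_mulVec]
    rw [h, mulVec_zero] at h1
    have := congrFun h1 i₀
    simp at this
  obtain ⟨i, hi⟩ := Function.ne_iff.1 hv0
  have main : ∀ a, p a → v a ≠ 0 → False := by
    intro a h h0
    have h1 := hinv a b₁ h hb₁ _ (hinv a b₁ h hb₁ _ hvL)
    have h2 := hinv a b₀ h hb₀ _ (hinv a b₀ h hb₀ _ h1)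
    have n0 := hne a b₀ h hb₀
    have n1 := hne a b₁ h hb₁
    have : Pi.single a (v a) ∈ L := by
      simpa [Pi.single_apply, n0, n0.symm, n1, n1.symm, hb, hb.symm] using h2
    exact key a h (hs v a h0 this)
  by_cases hpi : p i
  · exact main i hpi hi
  · by_cases h0 : ∃ a, p a ∧ v a ≠ 0
    · obtain ⟨a, h, h'⟩ := h0
      exact main a h h'
    · push Not at h0
      have := hinv a₀ i ha hpi v hvL
      rw [h0 a₀ ha, Pi.single_zero, add_zero] at this
      have h2 := L.smul_mem (v i)⁻¹ this
      rw [← Pi.single_smul, smul_eq_mul, inv_mul_cancel₀ hi] at h2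
      exact key a₀ ha h2

lemma isCompact_stiefel : IsCompact {O : Matrix ν ι ℝ | Oᵀ * O = 1} := by
  have hc : IsClosed {O : Matrix ν ι ℝ | Oᵀ * O = 1} :=
    isClosed_eq (by fun_prop) continuous_const
  have hb : IsCompact (Set.pi Set.univ fun _ : ν => Set.pi Set.univ fun _ : ι =>
      Set.Icc (-1 : ℝ) 1) :=
    isCompact_univ_pi fun _ => isCompact_univ_pi fun _ => isCompact_Icc
  refine hb.of_isClosed_subset hc ?_
  intro (O : Matrix ν ι ℝ) hO i _ j _
  have h1 := congrFun (congrFun (show Oᵀ * O = 1 from hO) j) j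
  rw [Matrix.mul_apply, one_apply_eq] at h1
  have h2 : O i j * O i j ≤ 1 := by
    rw [← h1]
    exact Finset.single_le_sum (f := fun k => Oᵀ j k * O k j)
      (fun k _ => by simpa using mul_self_nonneg (O k j)) (Finset.mem_univ i)
  exact abs_le.1 (by rw [← sq_le_one_iff_abs_le_one]; nlinarith)

lemma exists_stiefel_mul {B : Matrix ν ι ℝ} (hB : gramDet B ≠ 0) :
    ∃ (O : Matrix ν ι ℝ) (R : Matrix ι ι ℝ), Oᵀ * O = 1 ∧ R.det ≠ 0 ∧ B = O * R := by
  obtain ⟨C, hC, h⟩ := (posDef_of_gramDet_ne_zero hB).exists_eq_transpose_mul_self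
  refine ⟨B * C⁻¹, C, ?_, hC.ne_zero, ?_⟩
  · rw [transpose_mul, Matrix.mul_assoc, ← Matrix.mul_assoc Bᵀ, h, transpose_nonsing_inv,
      Matrix.mul_assoc, mul_nonsing_inv _ hC, Matrix.mul_one, nonsing_inv_mul]
    rwa [det_transpose]
  · rw [Matrix.mul_assoc, nonsing_inv_mul _ hC, Matrix.mul_one]

lemma gramDet_mul_ne_zero {M : Matrix ν ν ℝ} (hM : M.det ≠ 0) {B : Matrix ν ι ℝ}
    (hB : gramDet B ≠ 0) : gramDet (M * B) ≠ 0 := by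
  refine (gramDet_pos_iff.2 fun x hx => ?_).ne'
  refine gramDet_pos_iff.1 ((gramDet_nonneg B).lt_of_ne hB.symm) x ?_
  rw [← mulVec_mulVec] at hx
  exact eq_zero_of_mulVec_eq_zero hM hx

lemma gramDet_eq_one {O : Matrix ν ι ℝ} (hO : Oᵀ * O = 1) : gramDet O = 1 := by
  rw [gramDet, hO, det_one]

lemma continuous_gramDet : Continuous (gramDet : Matrix ν ι ℝ → ℝ) := by
  unfold gramDet; fun_prop

lemma exists_gramDet_bounds {M : Matrix ν ν ℝ} (hM : M.det ≠ 0) (ι : Type*) [Fintype ι]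
    [DecidableEq ι] :
    ∃ T : ℝ, 1 ≤ T ∧ ∀ B : Matrix ν ι ℝ, gramDet B ≠ 0 →
      gramDet B ≤ T * gramDet (M * B) ∧ gramDet (M * B) ≤ T * gramDet B := by
  have hcont : Continuous fun O : Matrix ν ι ℝ => gramDet (M * O) :=
    continuous_gramDet.comp (by fun_prop)
  have hpos : ∀ O ∈ {O : Matrix ν ι ℝ | Oᵀ * O = 1}, gramDet (M * O) ≠ 0 := fun O hO =>
    gramDet_mul_ne_zero hM (by rw [gramDet_eq_one hO]; exact one_ne_zero)
  obtain ⟨T₁, h₁⟩ := (isCompact_stiefel (ν := ν) (ι := ι)).bddAbove_image hcont.continuousOn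
  obtain ⟨T₂, h₂⟩ := (isCompact_stiefel (ν := ν) (ι := ι)).bddAbove_image
    (hcont.continuousOn.inv₀ hpos)
  refine ⟨max 1 (max T₁ T₂), le_max_left _ _, fun B hB => ?_⟩
  obtain ⟨O, R, hO, hR, rfl⟩ := exists_stiefel_mul hB
  rw [← Matrix.mul_assoc, gramDet_mul, gramDet_mul, gramDet_eq_one hO, one_mul]
  have hp : 0 < gramDet (M * O) := (gramDet_nonneg _).lt_of_ne (hpos O hO).symm
  have hle₁ : gramDet (M * O) ≤ T₁ := h₁ ⟨O, hO, rfl⟩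
  have hle₂ : (gramDet (M * O))⁻¹ ≤ T₂ := h₂ ⟨O, hO, rfl⟩
  set T := max 1 (max T₁ T₂)
  have i1 : gramDet (M * O) ≤ T := hle₁.trans ((le_max_left _ _).trans (le_max_right _ _))
  have i2 : (gramDet (M * O))⁻¹ ≤ T := hle₂.trans ((le_max_right _ _).trans (le_max_right _ _))
  rw [inv_le_iff_one_le_mul₀ hp] at i2
  constructor
  · nlinarith [sq_nonneg R.det]
  · nlinarith [sq_nonneg R.det]

/-- The index set of the finite family of boosts. -/
abbrev BoostIdx (p : ν → Prop) := {ab : ν × ν // p ab.1 ∧ ¬ p ab.2} × Bool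

/-- The finite family of boosts, closed under inversion. -/
noncomputable def boostFam (p : ν → Prop) (j : BoostIdx p) : Matrix ν ν ℝ :=
  boost j.1.1.1 j.1.1.2 (5/4) (if j.2 then 3/4 else -3/4)

lemma boostFam_det_ne_zero (p : ν → Prop) (j : BoostIdx p) : (boostFam p j).det ≠ 0 := by
  obtain ⟨⟨⟨a, b⟩, ha, hb⟩, t⟩ := j
  have hab : a ≠ b := fun e => hb (e ▸ ha)
  intro h0
  have := congrArg det (boost_mul_boost_neg hab)
  have h' := congrArg det (boost_neg_mul_boost hab)
  rw [det_mul, det_one] at this h'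
  cases t <;> simp_all [boostFam]

lemma exp_neg_le_quadratic {y : ℝ} (hy : |y| ≤ 1) : Real.exp (-y) ≤ 1 - y + y ^ 2 := by
  have := Real.abs_exp_sub_one_sub_id_le (x := -y) (by simpa using hy)
  have := (abs_le.1 this).2
  nlinarith

open Filter Topology in
lemma eventually_boost_contraction (p : ν → Prop) [DecidablePred p] {a₀ b₀ b₁ : ν} (ha : p a₀)
    (hb₀ : ¬ p b₀) (hb₁ : ¬ p b₁) (hb : b₀ ≠ b₁) [Nonempty ι]
    (hι : Fintype.card ι < Fintype.card ν) :
    ∀ᶠ s : ℝ in 𝓝[>] 0, ∃ c < 1, 0 < c ∧ ∀ B : Matrix ν ι ℝ, gramDet B ≠ 0 →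
      ∑ j, gramDet (boostFam p j * B) ^ (-s)
        ≤ c * Fintype.card (BoostIdx p) * gramDet B ^ (-s) := by
  have hposO : ∀ j, ∀ O ∈ {O : Matrix ν ι ℝ | Oᵀ * O = 1}, 0 < gramDet (boostFam p j * O) :=
    fun j O hO => (gramDet_nonneg _).lt_of_ne (gramDet_mul_ne_zero (boostFam_det_ne_zero p j)
      (by rw [gramDet_eq_one hO]; exact one_ne_zero)).symm
  have hcont : ∀ j, ContinuousOn (fun O : Matrix ν ι ℝ => Real.log (gramDet (boostFam p j * O)))
      {O : Matrix ν ι ℝ | Oᵀ * O = 1} := fun j =>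
    (Continuous.continuousOn (continuous_gramDet.comp (by fun_prop))).log
      fun O hO => (hposO j O hO).ne'
  have hcs : ContinuousOn (fun O : Matrix ν ι ℝ => ∑ j, Real.log (gramDet (boostFam p j * O)))
      {O : Matrix ν ι ℝ | Oᵀ * O = 1} := continuousOn_finsetSum _ fun j _ => hcont j
  have hspos : ∀ O ∈ {O : Matrix ν ι ℝ | Oᵀ * O = 1},
      0 < ∑ j, Real.log (gramDet (boostFam p j * O)) := by
    intro O hO
    obtain ⟨a, b, hpa, hpb, hA⟩ := exists_not_swapMat_invariant ha hb₀ hb₁ hb hι hO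
    have hterm : ∀ q : {ab : ν × ν // p ab.1 ∧ ¬ p ab.2},
        ∑ t : Bool, Real.log (gramDet (boostFam p (q, t) * O))
        = Real.log (gramDet (boost q.1.1 q.1.2 (5/4) (3/4) * O)
            * gramDet (boost q.1.1 q.1.2 (5/4) (-3/4) * O)) := by
      intro q
      rw [Fintype.sum_bool, Real.log_mul]
      · simp [boostFam]
      · simpa [boostFam] using (hposO (q, true) O hO).ne'
      · simpa [boostFam] using (hposO (q, false) O hO).ne'
    rw [Fintype.sum_prod_type]
    simp only [hterm]
    have hne : ∀ q : {ab : ν × ν // p ab.1 ∧ ¬ p ab.2}, q.1.1 ≠ q.1.2 :=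
      fun q e => q.2.2 (e ▸ q.2.1)
    refine Finset.sum_pos' (fun q _ => Real.log_nonneg (one_le_gramDet_boost (hne q) hO).1)
      ⟨⟨(a, b), hpa, hpb⟩, Finset.mem_univ _, Real.log_pos ?_⟩
    by_contra! h
    exact hA ((one_le_gramDet_boost (hne ⟨(a, b), hpa, hpb⟩) hO).2 h)
  obtain ⟨η, hη, hηle⟩ : ∃ η > 0, ∀ O ∈ {O : Matrix ν ι ℝ | Oᵀ * O = 1},
      η ≤ ∑ j, Real.log (gramDet (boostFam p j * O)) := by
    rcases Set.eq_empty_or_nonempty {O : Matrix ν ι ℝ | Oᵀ * O = 1} with he | he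
    · exact ⟨1, one_pos, by simp [he]⟩
    · obtain ⟨O, hO, hmin⟩ := isCompact_stiefel.exists_isMinOn he hcs
      exact ⟨_, hspos O hO, fun O' hO' => hmin hO'⟩
  obtain ⟨K, hK⟩ : ∃ K : ℝ, ∀ j, ∀ O ∈ {O : Matrix ν ι ℝ | Oᵀ * O = 1},
      |Real.log (gramDet (boostFam p j * O))| ≤ K := by
    have := fun j => (isCompact_stiefel (ν := ν) (ι := ι)).bddAbove_image (hcont j).abs
    choose K hK using this
    refine ⟨∑ j, |K j|, fun j O hO => (hK j ⟨O, hO, rfl⟩).trans ((le_abs_self _).trans ?_)⟩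
    exact Finset.single_le_sum (f := fun j => |K j|) (fun _ _ => abs_nonneg _) (Finset.mem_univ j)
  set J : ℝ := (Fintype.card (BoostIdx p) : ℝ) with hJ
  have hJpos : 0 < J := by
    have : Nonempty (BoostIdx p) := ⟨⟨⟨(a₀, b₀), ha, hb₀⟩, true⟩⟩
    rw [hJ]; exact Nat.cast_pos.2 Fintype.card_pos
  set K' := max K 1 with hK'
  have hK'1 : 1 ≤ K' := le_max_right _ _
  -- `1 - s η / J + s² K'² < 1` and positive for small `s`
  have hsmall : ∀ᶠ s : ℝ in 𝓝[>] 0, s < 1 / K' ∧ s < η / (J * K' ^ 2) := by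
    refine nhdsWithin_le_nhds ?_
    exact (eventually_lt_nhds (by positivity)).and (eventually_lt_nhds (by positivity))
  filter_upwards [hsmall, self_mem_nhdsWithin] with s ⟨hs1, hs2⟩ hs0
  have hs0 : 0 < s := hs0
  set c := max (1 - s * η / J + s ^ 2 * K' ^ 2) (1/2) with hc
  refine ⟨c, max_lt ?_ (by norm_num), lt_of_lt_of_le (by norm_num) (le_max_right _ _), ?_⟩
  · rw [lt_div_iff₀ (by positivity)] at hs2
    have : s ^ 2 * K' ^ 2 < s * η / J := by
      rw [lt_div_iff₀ hJpos]; nlinarith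
    linarith
  intro B hB
  obtain ⟨O, R, hO, hR, rfl⟩ := exists_stiefel_mul hB
  have hR2 : 0 ≤ R.det ^ 2 := sq_nonneg _
  have hstep : ∀ j, gramDet (boostFam p j * (O * R)) ^ (-s)
      = gramDet (boostFam p j * O) ^ (-s) * (R.det ^ 2) ^ (-s) := fun j => by
    rw [← Matrix.mul_assoc, gramDet_mul, Real.mul_rpow (gramDet_nonneg _) hR2]
  simp only [hstep]
  rw [← Finset.sum_mul, gramDet_mul, gramDet_eq_one hO, one_mul]
  refine mul_le_mul_of_nonneg_right ?_ (Real.rpow_nonneg hR2 _)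
  have hj : ∀ j, gramDet (boostFam p j * O) ^ (-s)
      ≤ 1 - s * Real.log (gramDet (boostFam p j * O)) + s ^ 2 * K' ^ 2 := by
    intro j
    have hle : |Real.log (gramDet (boostFam p j * O))| ≤ K' :=
      (hK j O hO).trans (le_max_left _ _)
    rw [Real.rpow_def_of_pos (hposO j O hO)]
    have h1 : |s * Real.log (gramDet (boostFam p j * O))| ≤ 1 := by
      rw [abs_mul, abs_of_pos hs0]
      rw [lt_div_iff₀ (by positivity)] at hs1
      nlinarith
    have h2 := exp_neg_le_quadratic h1
    have h3 : (s * Real.log (gramDet (boostFam p j * O))) ^ 2 ≤ s ^ 2 * K' ^ 2 := by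
      rw [mul_pow]
      have := sq_le_sq' (abs_le.1 hle).1 (abs_le.1 hle).2
      gcongr
    calc _ = Real.exp (-(s * Real.log (gramDet (boostFam p j * O)))) := by congr 1; ring
      _ ≤ _ := by linarith
  calc _ ≤ ∑ j, (1 - s * Real.log (gramDet (boostFam p j * O)) + s ^ 2 * K' ^ 2) :=
        Finset.sum_le_sum fun j _ => hj j
    _ = J - s * (∑ j, Real.log (gramDet (boostFam p j * O))) + J * (s ^ 2 * K' ^ 2) := by
        rw [Finset.sum_add_distrib, Finset.sum_sub_distrib, ← Finset.mul_sum]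
        simp [hJ]
    _ ≤ J - s * η + J * (s ^ 2 * K' ^ 2) := by
        have := hηle O hO
        gcongr
    _ = (1 - s * η / J + s ^ 2 * K' ^ 2) * J := by field_simp
    _ ≤ c * J := by gcongr; exact le_max_left _ _

end Boost

section IntegerLattice

variable {ν : Type*} [Fintype ν] [DecidableEq ν]
variable {ι : Type*} [Fintype ι] [DecidableEq ι]
variable {κ : Type*} [Fintype κ] [DecidableEq κ]

/-- An integer matrix viewed as a real matrix. -/
def intReal {α β : Type*} (B : Matrix α β ℤ) : Matrix α β ℝ := B.map (Int.castRingHom ℝ)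

@[simp] lemma intReal_apply {α β : Type*} (B : Matrix α β ℤ) (i : α) (j : β) :
    intReal B i j = B i j := rfl

lemma intReal_mul {α β : Type*} (A : Matrix α ν ℤ) (B : Matrix ν β ℤ) :
    intReal (A * B) = intReal A * intReal B := Matrix.map_mul

lemma intReal_one : intReal (1 : Matrix ν ν ℤ) = 1 := by
  simp [intReal]

lemma intReal_transpose {α β : Type*} (B : Matrix α β ℤ) : intReal Bᵀ = (intReal B)ᵀ := rfl

lemma det_intReal (A : Matrix ν ν ℤ) : (intReal A).det = (A.det : ℝ) :=
  ((Int.castRingHom ℝ).map_det A).symm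

lemma intReal_fromCols {α β γ : Type*} (A : Matrix α β ℤ) (B : Matrix α γ ℤ) :
    intReal (fromCols A B) = fromCols (intReal A) (intReal B) := by
  ext i (j | j) <;> rfl

lemma gramDet_intReal (B : Matrix ν ι ℤ) : gramDet (intReal B) = ((Bᵀ * B).det : ℝ) := by
  rw [gramDet, ← intReal_transpose, ← intReal_mul, det_intReal]

lemma gramDet_intReal_ne_zero {B : Matrix ν ι ℤ} (hB : Function.Injective B.mulVec) :
    gramDet (intReal B) ≠ 0 := by
  rw [gramDet_intReal, Int.cast_ne_zero]
  intro h
  obtain ⟨v, hv, h0⟩ := exists_mulVec_eq_zero_iff.2 h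
  apply hv
  apply hB
  rw [mulVec_zero, ← dotProduct_self_eq_zero]
  rw [dotProduct_mulVec, ← mulVec_transpose, mulVec_mulVec, h0, zero_dotProduct]

lemma one_le_gramDet_intReal {B : Matrix ν ι ℤ} (hB : Function.Injective B.mulVec) :
    1 ≤ gramDet (intReal B) := by
  have h := (gramDet_nonneg (intReal B)).lt_of_ne (gramDet_intReal_ne_zero hB).symm
  rw [gramDet_intReal] at h ⊢
  exact_mod_cast h

/-- A submodule of a `ℤ`-module is saturated if its quotient is torsion-free. -/
def IsSaturated {P : Type*} [AddCommGroup P] (L : Submodule ℤ P) : Prop :=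
  ∀ a : ℤ, a ≠ 0 → ∀ x, a • x ∈ L → x ∈ L

lemma IsSaturated.exists_isCompl {P : Type*} [AddCommGroup P] [Module.Finite ℤ P]
    {L : Submodule ℤ P} (hL : IsSaturated L) : ∃ L', IsCompl L L' := by
  have : Module.IsTorsionFree ℤ (P ⧸ L) := by
    refine Module.isTorsionFree_iff_smul_eq_zero.2 ?_
    intro a x hax
    obtain ⟨x, rfl⟩ := L.mkQ_surjective x
    by_cases ha : a = 0
    · exact Or.inl ha
    · right
      rw [← map_smul] at hax
      simp only [Submodule.mkQ_apply, Submodule.Quotient.mk_eq_zero] at hax ⊢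
      exact hL a ha x hax
  obtain ⟨g, hg⟩ := Module.projective_lifting_property L.mkQ LinearMap.id L.mkQ_surjective
  refine ⟨LinearMap.range g, ?_⟩
  have hg' : ∀ y, L.mkQ (g y) = y := fun y => congrArg (fun f => f y) hg
  constructor
  · rw [Submodule.disjoint_def]
    rintro _ hx ⟨y, rfl⟩
    have := hg' y
    rw [Submodule.mkQ_apply, (Submodule.Quotient.mk_eq_zero L).2 hx] at this
    rw [← this, map_zero]
  · rw [codisjoint_iff, eq_top_iff]
    intro x _
    rw [← sub_add_cancel x (g (L.mkQ x))]
    refine Submodule.add_mem_sup ?_ ⟨_, rfl⟩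
    rw [← Submodule.Quotient.mk_eq_zero L, ← Submodule.mkQ_apply, map_sub, hg', sub_self]

lemma IsSaturated.exists_relative_compl {P : Type*} [AddCommGroup P] [IsNoetherian ℤ P]
    {L K : Submodule ℤ P} (hL : IsSaturated L) (hLK : L ≤ K) :
    ∃ L', Disjoint L L' ∧ L ⊔ L' = K := by
  have : IsSaturated (L.comap K.subtype) := fun a ha x hx => hL a ha x hx
  obtain ⟨C, hC⟩ := this.exists_isCompl
  have hm : (L.comap K.subtype).map K.subtype = L := by
    rw [Submodule.map_comap_subtype, inf_eq_right.2 hLK]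
  refine ⟨C.map K.subtype, ?_, ?_⟩
  · rw [← hm]
    exact (Submodule.disjoint_map K.injective_subtype hC.disjoint)
  · conv_lhs => rw [← hm]
    rw [← Submodule.map_sup, hC.sup_eq_top, Submodule.map_top, Submodule.range_subtype]

/-- The saturation of a submodule. -/
def saturation {P : Type*} [AddCommGroup P] (L : Submodule ℤ P) : Submodule ℤ P where
  carrier := {x | ∃ a : ℤ, a ≠ 0 ∧ a • x ∈ L}
  zero_mem' := ⟨1, one_ne_zero, by simp⟩
  add_mem' := by
    rintro x y ⟨a, ha, hx⟩ ⟨b, hb, hy⟩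
    refine ⟨a * b, mul_ne_zero ha hb, ?_⟩
    rw [smul_add]
    refine L.add_mem ?_ ?_
    · rw [mul_comm, mul_smul]; exact L.smul_mem _ hx
    · rw [mul_smul]; exact L.smul_mem _ hy
  smul_mem' := by
    rintro c x ⟨a, ha, hx⟩
    exact ⟨a, ha, by rw [smul_comm]; exact L.smul_mem _ hx⟩

lemma isSaturated_saturation {P : Type*} [AddCommGroup P] (L : Submodule ℤ P) :
    IsSaturated (saturation L) := by
  rintro a ha x ⟨b, hb, hx⟩
  exact ⟨b * a, mul_ne_zero hb ha, by rwa [mul_smul]⟩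

lemma le_saturation {P : Type*} [AddCommGroup P] (L : Submodule ℤ P) : L ≤ saturation L :=
  fun x hx => ⟨1, one_ne_zero, by simpa⟩

lemma exists_matrix_range_eq (L : Submodule ℤ (ν → ℤ)) :
    ∃ (d : ℕ) (B : Matrix ν (Fin d) ℤ), Function.Injective B.mulVec ∧
      LinearMap.range B.mulVecLin = L := by
  let b := Module.finBasis ℤ L
  have key : ∀ x, (of fun a j => (b j : ν → ℤ) a : Matrix ν _ ℤ) *ᵥ x
      = (b.equivFun.symm x : ν → ℤ) := by
    intro x
    ext a
    rw [Module.Basis.equivFun_symm_apply]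
    simp [mulVec, dotProduct, mul_comm]
  refine ⟨_, of fun a j => (b j : ν → ℤ) a, fun x y hxy => ?_, ?_⟩
  · rw [key, key] at hxy
    exact b.equivFun.symm.injective (Subtype.ext hxy)
  · ext v
    constructor
    · rintro ⟨x, rfl⟩
      rw [mulVecLin_apply, key]
      exact Subtype.coe_prop _
    · intro hv
      refine ⟨b.equivFun ⟨v, hv⟩, ?_⟩
      rw [mulVecLin_apply, key, LinearEquiv.symm_apply_apply]

lemma exists_mul_eq_of_range_le {B : Matrix ν ι ℤ} {B' : Matrix ν κ ℤ}
    (h : LinearMap.range B'.mulVecLin ≤ LinearMap.range B.mulVecLin) :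
    ∃ U : Matrix ι κ ℤ, B' = B * U := by
  have : ∀ j, ∃ x, B *ᵥ x = B' *ᵥ Pi.single j 1 := fun j => h ⟨Pi.single j 1, rfl⟩
  choose x hx using this
  refine ⟨of fun i j => x j i, ?_⟩
  ext a j
  have := congrFun (hx j) a
  rw [mulVec_single_one] at this
  exact this.symm

lemma eq_of_mul_eq_mul {B : Matrix ν ι ℤ} (hB : Function.Injective B.mulVec)
    {X Y : Matrix ι κ ℤ} (h : B * X = B * Y) : X = Y := by
  have : ∀ j, X *ᵥ Pi.single j 1 = Y *ᵥ Pi.single j 1 := fun j => hB (by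
    rw [mulVec_mulVec, mulVec_mulVec, h])
  ext a j
  have := congrFun (this j) a
  simpa using this

lemma exists_unimodular_of_range_eq {B : Matrix ν ι ℤ} {B' : Matrix ν κ ℤ}
    (hB : Function.Injective B.mulVec) (hB' : Function.Injective B'.mulVec)
    (h : LinearMap.range B.mulVecLin = LinearMap.range B'.mulVecLin) :
    ∃ (e : κ ≃ ι) (U : Matrix ι ι ℤ), U.det ^ 2 = 1 ∧ B' = (B * U).submatrix id e := by
  obtain ⟨U, hU⟩ := exists_mul_eq_of_range_le h.ge
  obtain ⟨V, hV⟩ := exists_mul_eq_of_range_le h.le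
  have h1 : U * V = 1 := eq_of_mul_eq_mul hB (by rw [← Matrix.mul_assoc, ← hU, ← hV, Matrix.mul_one])
  have h2 : V * U = 1 := eq_of_mul_eq_mul hB' (by rw [← Matrix.mul_assoc, ← hV, ← hU, Matrix.mul_one])
  have hc : Fintype.card κ = Fintype.card ι := by
    have := (toLin'OfInv h1 h2).finrank_eq.symm
    simpa using this
  let e := Fintype.equivOfCardEq hc
  have hu : U.submatrix id e.symm * V.submatrix e.symm id = 1 := by
    rw [submatrix_mul_equiv, h1, submatrix_id_id]
  refine ⟨e, U.submatrix id e.symm, ?_, ?_⟩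
  · have := congrArg det hu
    rw [det_mul, det_one] at this
    have := Int.isUnit_iff.1 (IsUnit.of_mul_eq_one _ this)
    rcases this with h | h <;> rw [h] <;> norm_num
  · rw [hU]
    ext a j
    simp [mul_apply]

lemma gramDet_eq_of_range_eq (M : Matrix ν ν ℝ) {B : Matrix ν ι ℤ} {B' : Matrix ν κ ℤ}
    (hB : Function.Injective B.mulVec) (hB' : Function.Injective B'.mulVec)
    (h : LinearMap.range B.mulVecLin = LinearMap.range B'.mulVecLin) :
    gramDet (M * intReal B') = gramDet (M * intReal B) := by
  obtain ⟨e, U, hU, rfl⟩ := exists_unimodular_of_range_eq hB hB' h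
  have : M * intReal ((B * U).submatrix id e) = (M * intReal B * intReal U).submatrix id e := by
    rw [Matrix.mul_assoc, ← intReal_mul]; rfl
  rw [this, gramDet_reindex, gramDet_mul, det_intReal]
  have : ((U.det : ℝ)) ^ 2 = 1 := by exact_mod_cast hU
  rw [this, mul_one]

lemma range_fromCols (D : Matrix ν ι ℤ) (E : Matrix ν κ ℤ) :
    LinearMap.range (fromCols D E).mulVecLin
      = LinearMap.range D.mulVecLin ⊔ LinearMap.range E.mulVecLin := by
  ext v
  rw [Submodule.mem_sup]
  constructor
  · rintro ⟨x, rfl⟩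
    refine ⟨_, ⟨x ∘ Sum.inl, rfl⟩, _, ⟨x ∘ Sum.inr, rfl⟩, ?_⟩
    simp [fromCols_mulVec]
  · rintro ⟨_, ⟨x, rfl⟩, _, ⟨y, rfl⟩, rfl⟩
    exact ⟨Sum.elim x y, by simp [fromCols_mulVec]⟩

lemma injective_fromCols {D : Matrix ν ι ℤ} {E : Matrix ν κ ℤ}
    (hD : Function.Injective D.mulVec) (hE : Function.Injective E.mulVec)
    (h : Disjoint (LinearMap.range D.mulVecLin) (LinearMap.range E.mulVecLin)) :
    Function.Injective (fromCols D E).mulVec := by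
  refine (injective_iff_map_eq_zero (fromCols D E).mulVecLin).2 fun x hx => ?_
  rw [mulVecLin_apply, fromCols_mulVec] at hx
  have h1 : D *ᵥ (x ∘ Sum.inl) = E *ᵥ (-(x ∘ Sum.inr)) := by
    rw [mulVec_neg]; exact eq_neg_of_add_eq_zero_left hx
  have h2 : D *ᵥ (x ∘ Sum.inl) = 0 :=
    Submodule.disjoint_def.1 h _ ⟨_, rfl⟩ ⟨_, h1.symm⟩
  rw [h2] at h1
  have h3 : x ∘ Sum.inl = 0 := hD (by rw [h2, mulVec_zero])
  have h4 : -(x ∘ Sum.inr) = 0 := hE (by rw [← h1, mulVec_zero])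
  rw [neg_eq_zero] at h4
  ext (j | j)
  · exact congrFun h3 j
  · exact congrFun h4 j

/-- Every nondegenerate integer matrix factors through one with saturated column range. -/
lemma exists_saturated_factor {B : Matrix ν ι ℤ} (hB : Function.Injective B.mulVec) :
    ∃ (B' : Matrix ν ι ℤ) (R : Matrix ι ι ℤ), Function.Injective B'.mulVec ∧
      IsSaturated (LinearMap.range B'.mulVecLin) ∧ R.det ≠ 0 ∧ B = B' * R := by
  obtain ⟨d, C, hC, hr⟩ := exists_matrix_range_eq (saturation (LinearMap.range B.mulVecLin))
  obtain ⟨R, hR⟩ := exists_mul_eq_of_range_le (B := C) (B' := B) (by rw [hr]; exact le_saturation _)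
  have hinj : Function.Injective R.mulVec := by
    intro x y hxy
    apply hB
    rw [hR, ← mulVec_mulVec, hxy, mulVec_mulVec]
  have h1 : Fintype.card ι ≤ d := by
    have := LinearMap.finrank_le_finrank_of_injective (f := R.mulVecLin) hinj
    simpa using this
  have h2 : d ≤ Fintype.card ι := by
    have hex : ∀ j, ∃ a : ℤ, a ≠ 0 ∧ a • (C *ᵥ Pi.single j 1) ∈ LinearMap.range B.mulVecLin := by
      intro j
      have : C *ᵥ Pi.single j 1 ∈ saturation (LinearMap.range B.mulVecLin) := hr ▸ ⟨_, rfl⟩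
      exact this
    choose a ha x hx using hex
    have hCa : C * diagonal a = B * of fun i j => x j i := by
      ext i j
      have := congrFun (hx j) i
      simp only [mulVecLin_apply, mulVec_single_one, Pi.smul_apply, col_apply, smul_eq_mul] at this
      rw [mul_diagonal, mul_comm, ← this]
      rfl
    have hinj' : Function.Injective (of fun i j => x j i : Matrix ι (Fin d) ℤ).mulVec := by
      intro y z hyz
      have : (C * diagonal a) *ᵥ y = (C * diagonal a) *ᵥ z := by
        rw [hCa, ← mulVec_mulVec, ← mulVec_mulVec]; congr 1
      rw [← mulVec_mulVec, ← mulVec_mulVec] at this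
      have := hC this
      ext j
      have := congrFun this j
      rw [mulVec_diagonal, mulVec_diagonal] at this
      exact mul_left_cancel₀ (ha j) this
    have := LinearMap.finrank_le_finrank_of_injective
      (f := (of fun i j => x j i : Matrix ι (Fin d) ℤ).mulVecLin) hinj'
    simpa using this
  have e : ι ≃ Fin d := Fintype.equivFinOfCardEq (le_antisymm h1 h2)
  have hrange : LinearMap.range (C.submatrix id e).mulVecLin = LinearMap.range C.mulVecLin := by
    ext v
    constructor
    · rintro ⟨x, rfl⟩
      refine ⟨x ∘ e.symm, ?_⟩
      simp [submatrix_mulVec_equiv]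
    · rintro ⟨x, rfl⟩
      refine ⟨x ∘ e, ?_⟩
      simp [submatrix_mulVec_equiv, Function.comp_assoc]
  have hmul : B = C.submatrix id e * R.submatrix e id := by
    rw [submatrix_mul_equiv, ← hR, submatrix_id_id]
  refine ⟨C.submatrix id e, R.submatrix e id, ?_, ?_, ?_, hmul⟩
  · intro x y hxy
    simp only [submatrix_mulVec_equiv, Function.comp_id] at hxy
    have := hC hxy
    exact e.symm.surjective.injective_comp_right this
  · rw [hrange, hr]
    exact isSaturated_saturation _
  · intro h0
    obtain ⟨v, hv, h⟩ := exists_mulVec_eq_zero_iff.2 h0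
    apply hv
    apply hB
    rw [mulVec_zero, hmul, ← mulVec_mulVec, h, mulVec_zero]

lemma eq_of_le_of_finrank {L K : Submodule ℤ (ν → ℤ)} (hL : IsSaturated L) (h : L ≤ K)
    (hr : Module.finrank ℤ L = Module.finrank ℤ K) : L = K := by
  obtain ⟨L', hd, hs⟩ := hL.exists_relative_compl h
  obtain ⟨d, D, hD, hDr⟩ := exists_matrix_range_eq L
  obtain ⟨d', D', hD', hDr'⟩ := exists_matrix_range_eq L'
  have hinj := injective_fromCols hD hD' (by rwa [hDr, hDr'])
  have hra := range_fromCols D D'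
  rw [hDr, hDr', hs] at hra
  have h1 := LinearMap.finrank_range_of_inj (f := (fromCols D D').mulVecLin) hinj
  have h2 := LinearMap.finrank_range_of_inj (f := D.mulVecLin) hD
  rw [hra] at h1
  rw [hDr] at h2
  simp only [Module.finrank_fintype_fun_eq_card, Fintype.card_sum, Fintype.card_fin] at h1 h2
  have h3 : d' = 0 := by omega
  subst h3
  have : L' = ⊥ := by
    rw [← hDr', LinearMap.range_eq_bot]
    ext x i
    exact x.elim0
  rw [← hs, this, sup_bot_eq]

/-- Two saturated lattices of the same rank either coincide or are in general position over their
intersection, which then has smaller rank. -/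
lemma exists_adapted_bases {i : ℕ} {B B' : Matrix ν (Fin i) ℤ} (hB : Function.Injective B.mulVec)
    (hB' : Function.Injective B'.mulVec) (hs : IsSaturated (LinearMap.range B.mulVecLin))
    (hs' : IsSaturated (LinearMap.range B'.mulVecLin))
    (hne : LinearMap.range B.mulVecLin ≠ LinearMap.range B'.mulVecLin) :
    ∃ (d k : ℕ) (D : Matrix ν (Fin d) ℤ) (E E' : Matrix ν (Fin k) ℤ), 1 ≤ k ∧ d + k = i ∧
      Function.Injective (fromCols D (fromCols E E')).mulVec ∧
      Function.Injective (fromCols D E).mulVec ∧ Function.Injective (fromCols D E').mulVec ∧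
      LinearMap.range (fromCols D E).mulVecLin = LinearMap.range B.mulVecLin ∧
      LinearMap.range (fromCols D E').mulVecLin = LinearMap.range B'.mulVecLin := by
  set L := LinearMap.range B.mulVecLin with hL
  set L' := LinearMap.range B'.mulVecLin with hL'
  have hrL : Module.finrank ℤ L = i := by
    rw [hL, LinearMap.finrank_range_of_inj hB]; simp
  have hrL' : Module.finrank ℤ L' = i := by
    rw [hL', LinearMap.finrank_range_of_inj hB']; simp
  have hsi : IsSaturated (L ⊓ L') := fun a ha x hx => ⟨hs a ha x hx.1, hs' a ha x hx.2⟩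
  obtain ⟨C, hCd, hCs⟩ := hsi.exists_relative_compl inf_le_left
  obtain ⟨C', hCd', hCs'⟩ := hsi.exists_relative_compl inf_le_right
  obtain ⟨d, D, hD, hDr⟩ := exists_matrix_range_eq (L ⊓ L')
  obtain ⟨k, E, hE, hEr⟩ := exists_matrix_range_eq C
  obtain ⟨k', E', hE', hEr'⟩ := exists_matrix_range_eq C'
  have i1 := injective_fromCols hD hE (by rwa [hDr, hEr])
  have i2 := injective_fromCols hD hE' (by rwa [hDr, hEr'])
  have r1 : LinearMap.range (fromCols D E).mulVecLin = L := by
    rw [range_fromCols, hDr, hEr, hCs]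
  have r2 : LinearMap.range (fromCols D E').mulVecLin = L' := by
    rw [range_fromCols, hDr, hEr', hCs']
  have c1 : d + k = i := by
    have := LinearMap.finrank_range_of_inj (f := (fromCols D E).mulVecLin) i1
    rw [r1, hrL] at this
    simpa using this.symm
  have c2 : d + k' = i := by
    have := LinearMap.finrank_range_of_inj (f := (fromCols D E').mulVecLin) i2
    rw [r2, hrL'] at this
    simpa using this.symm
  obtain rfl : k = k' := by omega
  have hk : 1 ≤ k := by
    by_contra! hk
    have hdi : Module.finrank ℤ ↥(L ⊓ L') = i := by
      rw [← hDr, LinearMap.finrank_range_of_inj hD]; simp; omega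
    exact hne ((eq_of_le_of_finrank hsi inf_le_left (by rw [hdi, hrL])).symm.trans
      (eq_of_le_of_finrank hsi inf_le_right (by rw [hdi, hrL'])))
  refine ⟨d, k, D, E, E', hk, c1, ?_, i1, i2, r1, r2⟩
  refine (injective_iff_map_eq_zero (fromCols D (fromCols E E')).mulVecLin).2 fun x hx => ?_
  rw [mulVecLin_apply, fromCols_mulVec, fromCols_mulVec] at hx
  set x1 := x ∘ Sum.inl
  set x2 := (x ∘ Sum.inr) ∘ Sum.inl
  set x3 := (x ∘ Sum.inr) ∘ Sum.inr
  have m1 : D *ᵥ x1 ∈ L ⊓ L' := hDr ▸ ⟨_, rfl⟩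
  have m2 : E *ᵥ x2 ∈ C := hEr ▸ ⟨_, rfl⟩
  have m3 : E' *ᵥ x3 ∈ C' := hEr' ▸ ⟨_, rfl⟩
  have hCL : C ≤ L := hCs ▸ le_sup_right
  have hCL' : C' ≤ L' := hCs' ▸ le_sup_right
  have m3' : E' *ᵥ x3 ∈ L := by
    have : E' *ᵥ x3 = -(D *ᵥ x1 + E *ᵥ x2) := by
      rw [eq_neg_iff_add_eq_zero, ← hx]; abel
    rw [this]
    exact L.neg_mem (L.add_mem m1.1 (hCL m2))
  have z3 := Submodule.disjoint_def.1 hCd' _ ⟨m3', hCL' m3⟩ m3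
  have y3 : x3 = 0 := hE' (by rw [z3, mulVec_zero])
  have hx' : fromCols D E *ᵥ (Sum.elim x1 x2) = 0 := by
    rw [fromCols_mulVec, ← hx, z3, add_zero]; rfl
  have y12 : Sum.elim x1 x2 = 0 := i1 (by rw [hx', mulVec_zero])
  ext (j | j | j)
  · exact congrFun y12 (Sum.inl j)
  · exact congrFun y12 (Sum.inr j)
  · exact congrFun y3 j

end IntegerLattice

section Reduction

variable {ν : Type*} [Fintype ν] [DecidableEq ν]
variable {ι : Type*} [Fintype ι] [DecidableEq ι]

/-- The real vector underlying an integer vector. -/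
def castVec {α : Type*} (z : α → ℤ) : α → ℝ := fun i => (z i : ℝ)

@[simp] lemma castVec_apply {α : Type*} (z : α → ℤ) (i : α) : castVec z i = z i := rfl

lemma castVec_ne_zero {α : Type*} {z : α → ℤ} (hz : z ≠ 0) : castVec z ≠ 0 := fun h =>
  hz (funext fun i => by simpa using congrFun h i)

lemma castVec_mulVec {α : Type*} (V : Matrix α ι ℤ) (z : ι → ℤ) :
    castVec (V *ᵥ z) = intReal V *ᵥ castVec z := by
  ext i; simp [mulVec, dotProduct]

/-- The quadratic form of a symmetric matrix. -/
def qf (S : Matrix ι ι ℝ) (x : ι → ℝ) : ℝ := x ⬝ᵥ S *ᵥ x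

lemma qf_congr {κ : Type*} [Fintype κ] [DecidableEq κ] (S : Matrix ι ι ℝ) (V : Matrix ι κ ℝ)
    (x : κ → ℝ) : qf (Vᵀ * S * V) x = qf S (V *ᵥ x) := by
  rw [qf, qf, ← mulVec_mulVec, ← mulVec_mulVec, dotProduct_mulVec, ← mulVec_transpose,
    transpose_transpose]

lemma qf_transpose_mul_self {κ : Type*} [Fintype κ] [DecidableEq κ] (C : Matrix κ ι ℝ) (x : ι → ℝ) :
    qf (Cᵀ * C) x = C *ᵥ x ⬝ᵥ C *ᵥ x := by
  have := qf_congr 1 C x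
  rwa [Matrix.mul_one, qf, qf, one_mulVec] at this

lemma qf_smul (S : Matrix ι ι ℝ) (a : ℝ) (x : ι → ℝ) : qf S (a • x) = a ^ 2 * qf S x := by
  simp only [qf, mulVec_smul, dotProduct_smul, smul_dotProduct, smul_eq_mul]; ring

lemma qf_single (S : Matrix ι ι ℝ) (i : ι) : qf S (Pi.single i 1) = S i i := by
  simp [qf]

lemma Matrix.PosDef.qf_pos {S : Matrix ι ι ℝ} (hS : S.PosDef) {x : ι → ℝ} (hx : x ≠ 0) :
    0 < qf S x := by simpa [qf] using hS.dotProduct_mulVec_pos hx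

lemma abs_le_sqrt_dotProduct (y : ι → ℝ) (i : ι) : |y i| ≤ √(y ⬝ᵥ y) := by
  refine Real.abs_le_sqrt ?_
  rw [pow_two]
  exact Finset.single_le_sum (f := fun j => y j * y j) (fun j _ => mul_self_nonneg _)
    (Finset.mem_univ i)

lemma Matrix.PosDef.exists_sq_le_mul_qf {S : Matrix ι ι ℝ} (hS : S.PosDef) :
    ∃ K : ℝ, 0 < K ∧ ∀ x i, x i ^ 2 ≤ K * qf S x := by
  obtain ⟨C, hC, rfl⟩ := hS.exists_eq_transpose_mul_self
  set K := ∑ i, ∑ j, |C⁻¹ i j| with hK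
  have hK0 : 0 ≤ K := Finset.sum_nonneg fun i _ => Finset.sum_nonneg fun j _ => abs_nonneg _
  refine ⟨K ^ 2 + 1, by positivity, fun x i => ?_⟩
  rw [qf_transpose_mul_self]
  set y := C *ᵥ x with hy
  have hx : x = C⁻¹ *ᵥ y := by rw [hy, mulVec_mulVec, nonsing_inv_mul _ hC, one_mulVec]
  have hyy : 0 ≤ y ⬝ᵥ y := Finset.sum_nonneg fun _ _ => mul_self_nonneg _
  have h1 : |x i| ≤ K * √(y ⬝ᵥ y) := by
    conv_lhs => rw [hx]
    calc |(C⁻¹ *ᵥ y) i| ≤ ∑ j, |C⁻¹ i j * y j| := Finset.abs_sum_le_sum_abs _ _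
      _ ≤ ∑ j, |C⁻¹ i j| * √(y ⬝ᵥ y) := Finset.sum_le_sum fun j _ => by
          rw [abs_mul]; gcongr; exact abs_le_sqrt_dotProduct y j
      _ = (∑ j, |C⁻¹ i j|) * √(y ⬝ᵥ y) := by rw [Finset.sum_mul]
      _ ≤ _ := by
          gcongr
          exact Finset.single_le_sum (f := fun i => ∑ j, |C⁻¹ i j|)
            (fun _ _ => Finset.sum_nonneg fun _ _ => abs_nonneg _) (Finset.mem_univ i)
  calc x i ^ 2 = |x i| ^ 2 := (sq_abs _).symm
    _ ≤ (K * √(y ⬝ᵥ y)) ^ 2 := by gcongr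
    _ = K ^ 2 * (y ⬝ᵥ y) := by rw [mul_pow, Real.sq_sqrt hyy]
    _ ≤ _ := by nlinarith

lemma Matrix.PosDef.exists_pos_le_qf {S : Matrix ι ι ℝ} (hS : S.PosDef) :
    ∃ r : ℝ, 0 < r ∧ ∀ z : ι → ℤ, z ≠ 0 → r ≤ qf S (castVec z) := by
  obtain ⟨K, hK, h⟩ := hS.exists_sq_le_mul_qf
  refine ⟨K⁻¹, inv_pos.2 hK, fun z hz => ?_⟩
  obtain ⟨i, hi⟩ := Function.ne_iff.1 hz
  have hi : z i ≠ 0 := hi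
  have h1 : (1 : ℝ) ≤ (castVec z i) ^ 2 := by
    have : 1 ≤ (z i) ^ 2 := Int.add_one_le_iff.2 (sq_pos_of_ne_zero hi)
    rw [castVec_apply]; exact_mod_cast this
  rw [inv_le_iff_one_le_mul₀ hK, mul_comm]
  exact h1.trans (h _ _)

lemma Matrix.PosDef.finite_qf_le {S : Matrix ι ι ℝ} (hS : S.PosDef) (c : ℝ) :
    {z : ι → ℤ | qf S (castVec z) ≤ c}.Finite := by
  obtain ⟨K, hK, h⟩ := hS.exists_sq_le_mul_qf
  refine (Set.finite_Icc (fun _ => -⌈K * c⌉ : ι → ℤ) fun _ => ⌈K * c⌉).subset fun z hz => ?_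
  have hb : ∀ i, |z i| ≤ ⌈K * c⌉ := fun i => by
    have h1 : ((z i : ℝ)) ^ 2 ≤ K * c := (h (castVec z) i).trans (by gcongr; exact hz)
    have h2 : (z i) ^ 2 ≤ ⌈K * c⌉ := by
      have := h1.trans (Int.le_ceil _); exact_mod_cast this
    have h3 : |z i| ≤ (z i) ^ 2 := by
      rw [← sq_abs]; exact Int.le_self_sq _
    exact h3.trans h2
  exact ⟨fun i => (abs_le.1 (hb i)).1, fun i => (abs_le.1 (hb i)).2⟩

/-- A shortest nonzero vector can be chosen to span a saturated submodule. -/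
lemma Matrix.PosDef.exists_saturated_min [Nonempty ι] {S : Matrix ι ι ℝ} (hS : S.PosDef) :
    ∃ B : Matrix ι (Fin 1) ℤ, Function.Injective B.mulVec ∧
      IsSaturated (LinearMap.range B.mulVecLin) ∧
      ∀ z : ι → ℤ, z ≠ 0 → qf S (castVec fun i => B i 0) ≤ qf S (castVec z) := by
  obtain ⟨i₀⟩ := ‹Nonempty ι›
  have hne : (Pi.single i₀ 1 : ι → ℤ) ≠ 0 := by simp
  obtain ⟨v, ⟨hv0, hvc⟩, hv⟩ := ((hS.finite_qf_le (qf S (castVec (Pi.single i₀ 1)))).inter_of_right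
    {z : ι → ℤ | z ≠ 0}).exists_minimalFor (fun z => qf S (castVec z)) _ ⟨_, hne, le_refl (qf S (castVec (Pi.single i₀ 1)))⟩
  have hmin : ∀ z : ι → ℤ, z ≠ 0 → qf S (castVec v) ≤ qf S (castVec z) := by
    intro z hz
    by_contra! h
    exact absurd (hv ⟨hz, h.le.trans hvc⟩ h.le) (not_le.2 h)
  have hmul : ∀ (B : Matrix ι (Fin 1) ℤ) (x : Fin 1 → ℤ), B *ᵥ x = x 0 • fun i => B i 0 := by
    intro B x; ext i; simp [mulVec, dotProduct, mul_comm]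
  have hinj : Function.Injective (of fun i (_ : Fin 1) => v i).mulVec := by
    intro x y hxy
    rw [hmul, hmul] at hxy
    ext j
    rw [Subsingleton.elim j 0]
    obtain ⟨i, hi⟩ := Function.ne_iff.1 hv0
    have := congrFun hxy i
    simp only [Pi.smul_apply, of_apply, smul_eq_mul] at this
    exact mul_right_cancel₀ hi this
  obtain ⟨B, R, hB, hs, hR, h⟩ := exists_saturated_factor hinj
  refine ⟨B, hB, hs, fun z hz => le_trans ?_ (hmin z hz)⟩
  have hvB : castVec v = (R 0 0 : ℝ) • castVec fun i => B i 0 := by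
    ext i
    have := congrFun (congrFun h i) 0
    rw [of_apply, mul_apply] at this
    simp [this, mul_comm]
  rw [hvB, qf_smul]
  rw [det_fin_one] at hR
  have h1 : (1 : ℝ) ≤ (R 0 0 : ℝ) ^ 2 := by
    have : 1 ≤ (R 0 0) ^ 2 := Int.add_one_le_iff.2 (sq_pos_of_ne_zero hR)
    exact_mod_cast this
  have h2 : 0 ≤ qf S (castVec fun i => B i 0) := by
    by_cases h0 : (castVec fun i => B i 0) = 0
    · rw [h0]; simp [qf]
    · exact (hS.qf_pos h0).le
  nlinarith

lemma exists_int_abs_add_le (a : ℝ) : ∃ t : ℤ, |(t : ℝ) + a| ≤ 1 / 2 :=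
  ⟨-round a, by have := abs_sub_round a; push_cast; rwa [neg_add_eq_sub]⟩

/-- One step of Hermite's reduction. -/
lemma Matrix.PosDef.hermite_step {N : ℕ} (hι : Fintype.card ι = N + 1) {S : Matrix ι ι ℝ}
    (hS : S.PosDef) :
    ∃ (s : ℝ) (S' : Matrix (Fin N) (Fin N) ℝ) (e : Fin 1 ⊕ Fin N ≃ ι) (U : Matrix ι ι ℤ),
      U.det ^ 2 = 1 ∧ S'.PosDef ∧ (∃ z : ι → ℤ, z ≠ 0 ∧ s = qf S (castVec z)) ∧
      (∀ x : Fin N → ℤ, x ≠ 0 → 3 / 4 * s ≤ qf S' (castVec x)) ∧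
      S.det = s * S'.det ∧
      s = qf S (intReal (U.submatrix id e) *ᵥ (Pi.single (Sum.inl 0) 1)) ∧
      ∀ x : Fin N → ℤ, ∃ t : ℤ,
        qf S (intReal (U.submatrix id e) *ᵥ castVec (Sum.elim (fun _ => t) x))
          ≤ s / 4 + qf S' (castVec x) := by
  have : Nonempty ι := Fintype.card_pos_iff.1 (by omega)
  obtain ⟨B, hB, hsat, hmin⟩ := hS.exists_saturated_min
  obtain ⟨L, hL, hLs⟩ := hsat.exists_relative_compl le_top
  obtain ⟨d, E, hE, rfl⟩ := exists_matrix_range_eq L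
  have hVinj := injective_fromCols hB hE hL
  have hVr : LinearMap.range (1 : Matrix ι ι ℤ).mulVecLin
      = LinearMap.range (fromCols B E).mulVecLin := by
    rw [range_fromCols, hLs, mulVecLin_one, LinearMap.range_id]
  obtain ⟨e, U, hU, hV⟩ := exists_unimodular_of_range_eq
    (by intro x y h; simpa using h) hVinj hVr
  rw [Matrix.one_mul] at hV
  obtain rfl : d = N := by
    have := Fintype.card_congr e
    simp at this; omega
  set V := intReal (U.submatrix id e) with hVdef
  have hVe : V = (intReal U).submatrix id e := rfl
  set T := Vᵀ * S * V with hT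
  have hUr : (intReal U).det ^ 2 = 1 := by rw [det_intReal]; exact_mod_cast hU
  have hTe : T = ((intReal U)ᵀ * S * intReal U).submatrix e e := by
    rw [hT, hVe]
    ext i j
    simp [mul_apply]
  have hTdet : T.det = S.det := by
    rw [hTe, det_submatrix_equiv_self, det_mul, det_mul, det_transpose]
    linear_combination S.det * hUr
  have hTP : T.PosDef := by
    rw [hTe]
    refine PosDef.submatrix ?_ e.injective
    have := hS.conjTranspose_mul_mul_same (B := intReal U) (mulVec_injective_iff_isUnit.2
      ((isUnit_iff_isUnit_det _).2 (isUnit_iff_ne_zero.2 (by intro h; simp [h] at hUr))))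
    rwa [conjTranspose_eq_transpose_of_trivial] at this
  set s := T (Sum.inl 0) (Sum.inl 0) with hs
  have hs0 : 0 < s := hTP.diag_pos
  have hsq : s = qf S (V *ᵥ (Pi.single (Sum.inl 0) 1)) := by rw [← qf_congr, qf_single]
  have hVB : V *ᵥ (Pi.single (Sum.inl 0) 1) = castVec fun i => B i 0 := by
    rw [hVdef, ← hV]; ext i; simp
  have hsB : s = qf S (castVec fun i => B i 0) := by rw [hsq, hVB]
  have hB0 : (fun i => B i 0) ≠ 0 := by
    intro h0
    have := hB (a₁ := Pi.single 0 1) (a₂ := 0) (by rw [mulVec_zero, mulVec_single_one]; exact h0)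
    simpa using congrFun this 0
  set b : Fin d → ℝ := fun j => T (Sum.inl 0) (Sum.inr j) with hb
  have hsymm : ∀ i j, T i j = T j i := fun i j => by
    have := hTP.isHermitian.apply j i
    simpa using this
  set S' : Matrix (Fin d) (Fin d) ℝ := of fun i j => T (Sum.inr i) (Sum.inr j) - b i * b j / s
    with hS'
  have hq : ∀ (t : ℝ) (x : Fin d → ℝ),
      qf T (Sum.elim (fun _ => t) x) = s * (t + b ⬝ᵥ x / s) ^ 2 + qf S' x := by
    intro t x
    have e1 : ∑ i, x i * b i = b ⬝ᵥ x := by simp [dotProduct, mul_comm]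
    have e2 : qf S' x = (∑ i, x i * ∑ j, T (Sum.inr i) (Sum.inr j) * x j)
        - (b ⬝ᵥ x) * (b ⬝ᵥ x) / s := by
      have : ∀ i, x i * ∑ j, S' i j * x j
          = x i * (∑ j, T (Sum.inr i) (Sum.inr j) * x j) - x i * b i * (b ⬝ᵥ x) / s := by
        intro i
        simp only [hS', of_apply, sub_mul, Finset.sum_sub_distrib, mul_sub, dotProduct,
          Finset.mul_sum, Finset.sum_div]
        congr 1
        exact Finset.sum_congr rfl fun j _ => by ring
      simp only [qf, dotProduct, mulVec] at this ⊢
      simp only [this, Finset.sum_sub_distrib, ← Finset.sum_div, ← Finset.sum_mul]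
      rw [show ∑ i, x i * b i = ∑ i, b i * x i from e1]
    rw [e2]
    simp only [qf, dotProduct, mulVec, Fintype.sum_sum_type, Finset.univ_unique, Sum.elim_inl,
      Sum.elim_inr, Finset.sum_singleton, Fin.default_eq_zero, Fin.isValue, mul_add,
      Finset.sum_add_distrib]
    simp only [hsymm (Sum.inr _) (Sum.inl 0)]
    have e3 : ∑ i, T (Sum.inl 0) (Sum.inr i) * x i = b ⬝ᵥ x := rfl
    have e4 : ∑ i, x i * (T (Sum.inl 0) (Sum.inr i) * t) = b ⬝ᵥ x * t := by
      rw [← e1, Finset.sum_mul]; exact Finset.sum_congr rfl fun i _ => by rw [hb]; ring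
    rw [e3, e4, ← hs]
    simp only [dotProduct]
    field_simp
    ring
  have hcast : ∀ (t : ℤ) (x : Fin d → ℤ),
      castVec (Sum.elim (fun _ : Fin 1 => t) x) = Sum.elim (fun _ => (t : ℝ)) (castVec x) := by
    intro t x; ext (i | i) <;> rfl
  refine ⟨s, S', e, U, hU, ?_, ⟨_, hB0, hsB⟩, ?_, ?_, hsq, ?_⟩
  · refine PosDef.of_dotProduct_mulVec_pos ?_ fun x hx => ?_
    · ext i j
      simp only [conjTranspose_apply, star_trivial, hS', of_apply, hsymm (Sum.inr j)]
      ring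
    · have h1 := hq (-(b ⬝ᵥ x / s)) x
      rw [neg_add_cancel] at h1
      have h2 : (Sum.elim (fun _ : Fin 1 => -(b ⬝ᵥ x / s)) x) ≠ 0 := fun h => hx (by
        ext i; exact congrFun h (Sum.inr i))
      have := hTP.qf_pos h2
      rw [h1] at this
      simpa [qf] using this
  · intro x hx
    obtain ⟨t, ht⟩ := exists_int_abs_add_le (b ⬝ᵥ castVec x / s)
    have h1 := hq t (castVec x)
    rw [← hcast, hT, qf_congr, hVdef, ← castVec_mulVec] at h1
    have h2 : (U.submatrix id e) *ᵥ (Sum.elim (fun _ : Fin 1 => t) x) ≠ 0 := by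
      intro h
      rw [← hV] at h
      have := hVinj (h.trans (mulVec_zero _).symm)
      exact hx (by ext i; exact congrFun this (Sum.inr i))
    have h3 := hmin _ h2
    rw [← hsB, h1] at h3
    have h4 : (t + b ⬝ᵥ castVec x / s) ^ 2 ≤ (1 / 2) ^ 2 := sq_le_sq' (abs_le.1 ht).1 (abs_le.1 ht).2
    nlinarith
  · rw [← hTdet]
    have hbl : T = fromBlocks (of fun _ _ => s) (of fun _ j => b j) (of fun i _ => b i)
        (of fun i j => T (Sum.inr i) (Sum.inr j)) := by
      ext (i | i) (j | j)
      · rw [Subsingleton.elim i 0, Subsingleton.elim j 0]; rfl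
      · rw [Subsingleton.elim i 0]; rfl
      · rw [Subsingleton.elim j 0, hsymm]; rfl
      · rfl
    have hA : (of fun _ _ => s : Matrix (Fin 1) (Fin 1) ℝ) * (of fun _ _ => s⁻¹) = 1 := by
      ext i j
      rw [Subsingleton.elim i 0, Subsingleton.elim j 0]
      simp [mul_apply, hs0.ne']
    let _ : Invertible (of fun _ _ => s : Matrix (Fin 1) (Fin 1) ℝ) :=
      invertibleOfRightInverse _ _ hA
    rw [hbl, det_fromBlocks₁₁]
    congr 1
    · simp
    · congr 1
      ext i j
      rw [show ⅟(of fun _ _ => s : Matrix (Fin 1) (Fin 1) ℝ) = of fun _ _ => s⁻¹ from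
        invOf_eq_right_inv hA]
      simp [mul_apply, hS', div_eq_mul_inv]
      ring
  · intro x
    obtain ⟨t, ht⟩ := exists_int_abs_add_le (b ⬝ᵥ castVec x / s)
    refine ⟨t, ?_⟩
    rw [← qf_congr, hcast, ← hT, hq]
    have h4 : (t + b ⬝ᵥ castVec x / s) ^ 2 ≤ (1 / 2) ^ 2 := sq_le_sq' (abs_le.1 ht).1 (abs_le.1 ht).2
    nlinarith

/-- Hermite's inequality. -/
lemma exists_hermite_constant (N : ℕ) : ∃ c : ℝ, 0 < c ∧ ∀ (ι : Type) [Fintype ι] [DecidableEq ι],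
    Fintype.card ι = N → ∀ (S : Matrix ι ι ℝ), S.PosDef → ∀ m : ℝ, 0 < m →
      (∀ z : ι → ℤ, z ≠ 0 → m ≤ qf S (castVec z)) → c * m ^ N ≤ S.det := by
  induction N with
  | zero =>
    refine ⟨1, one_pos, fun ι _ _ h S _ m _ _ => ?_⟩
    have := Fintype.card_eq_zero_iff.1 h
    simp
  | succ N ih =>
    obtain ⟨c, hc, h⟩ := ih
    refine ⟨c * (3 / 4) ^ N, by positivity, fun ι _ _ hι S hS m hm hmin => ?_⟩
    obtain ⟨s, S', e, U, -, hS', ⟨z, hz, hsz⟩, h1, h2, -, -⟩ := hS.hermite_step hι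
    have hms : m ≤ s := hsz ▸ hmin z hz
    have h3 := h (Fin N) (by simp) S' hS' (3 / 4 * m) (by positivity) fun x hx =>
      le_trans (by gcongr) (h1 x hx)
    rw [h2]
    calc c * (3 / 4) ^ N * m ^ (N + 1) = m * (c * (3 / 4 * m) ^ N) := by rw [mul_pow]; ring
      _ ≤ s * S'.det := mul_le_mul hms h3 (by positivity) (hm.le.trans hms)

/-- Mahler's criterion in the form of a reduction statement. -/
lemma exists_mahler_bound (N : ℕ) : ∀ ε : ℝ, 0 < ε → ∀ δ : ℝ,
    ∃ R : ℝ, ∀ (ι : Type) [Fintype ι] [DecidableEq ι],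
    Fintype.card ι = N → ∀ (S : Matrix ι ι ℝ), S.PosDef →
      (∀ z : ι → ℤ, z ≠ 0 → ε ≤ qf S (castVec z)) → S.det ≤ δ →
      ∃ U : Matrix ι ι ℤ, U.det ^ 2 = 1 ∧ ∀ i, qf S (intReal U *ᵥ Pi.single i 1) ≤ R := by
  induction N with
  | zero =>
    refine fun ε _ δ => ⟨0, fun ι _ _ h S _ _ _ => ?_⟩
    have := Fintype.card_eq_zero_iff.1 h
    exact ⟨1, by simp, fun i => isEmptyElim i⟩
  | succ N ih =>
    intro ε hε δ
    obtain ⟨c, hc, hherm⟩ := exists_hermite_constant N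
    obtain ⟨R, hR⟩ := ih (3 / 4 * ε) (by positivity) (δ / ε)
    set s₀ := δ / (c * (3 / 4 * ε) ^ N) with hs₀
    refine ⟨max s₀ (s₀ / 4 + R), fun ι _ _ hι S hS hmin hdet => ?_⟩
    obtain ⟨s, S', e, U, hU, hS', ⟨z, hz, hsz⟩, h1, h2, h3, h4⟩ := hS.hermite_step hι
    have hεs : ε ≤ s := hsz ▸ hmin z hz
    have hs0 : 0 < s := hε.trans_le hεs
    have hss : s ≤ s₀ := by
      have h5 := hherm (Fin N) (by simp) S' hS' (3 / 4 * s) (by positivity) h1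
      rw [hs₀, le_div_iff₀ (by positivity)]
      calc s * (c * (3 / 4 * ε) ^ N) ≤ s * (c * (3 / 4 * s) ^ N) := by gcongr
        _ ≤ s * S'.det := by gcongr
        _ ≤ δ := h2 ▸ hdet
    obtain ⟨U', hU', hU'R⟩ := hR (Fin N) (by simp) S' hS'
      (fun x hx => le_trans (by gcongr) (h1 x hx)) (by
        rw [le_div_iff₀ hε]
        have := hS'.det_pos
        nlinarith)
    choose t ht using fun j => h4 (U' *ᵥ Pi.single j 1)
    set W : Matrix (Fin 1 ⊕ Fin N) (Fin 1 ⊕ Fin N) ℤ := fromBlocks 1 (of fun _ j => t j) 0 U'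
      with hW
    refine ⟨U * W.submatrix e.symm e.symm, ?_, ?_⟩
    · rw [det_mul, det_submatrix_equiv_self, hW, det_fromBlocks_zero₂₁, det_one, one_mul, mul_pow,
        hU, hU', one_mul]
    · intro i
      have hcol : intReal (U * W.submatrix e.symm e.symm) *ᵥ Pi.single i 1
          = intReal (U.submatrix id e) *ᵥ castVec (fun k => W k (e.symm i)) := by
        have : castVec (Pi.single i 1 : ι → ℤ) = Pi.single i 1 := by
          ext j; simp [Pi.single_apply]
        rw [← this, ← castVec_mulVec, ← castVec_mulVec]
        congr 1
        ext a
        rw [mulVec_single_one, col_apply, mul_apply, ← Equiv.sum_comp e]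
        simp [mulVec, dotProduct]
      rw [hcol]
      rcases h : e.symm i with j | j
      · refine le_trans (le_of_eq ?_) (hss.trans (le_max_left _ _))
        rw [h3]
        congr 2
        ext (k | k)
        · rw [Subsingleton.elim j 0, Subsingleton.elim k 0]; simp [hW]
        · simp [hW]
      · have hc' : (fun k => W k (Sum.inr j)) = Sum.elim (fun _ => t j) (U' *ᵥ Pi.single j 1) := by
          ext (k | k) <;> simp [hW]
        rw [hc']
        refine (ht j).trans (le_trans ?_ (le_max_right _ _))
        have : castVec (U' *ᵥ Pi.single j 1) = intReal U' *ᵥ Pi.single j 1 := by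
          rw [castVec_mulVec]; congr 1; ext k; simp [Pi.single_apply]
        rw [this]
        have := hU'R j
        gcongr

end Reduction

section Lyapunov

variable {ν : Type*} [Fintype ν] [DecidableEq ν]
variable {ι : Type*} [Fintype ι] [DecidableEq ι]

lemma det_boost_eq_neg {a b : ν} (h : a ≠ b) (c s : ℝ) :
    (boost a b c s).det = (boost a b c (-s)).det := by
  have hD : diagonal (Function.update (1 : ν → ℝ) b (-1)) * boost a b c s
      * diagonal (Function.update (1 : ν → ℝ) b (-1)) = boost a b c (-s) := by
    ext i j
    rw [mul_diagonal, diagonal_mul]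
    simp only [boost, swapMat, Function.update_apply, Matrix.add_apply, Matrix.smul_apply,
      single_apply, one_apply, smul_eq_mul, Pi.one_apply]
    by_cases hi : i = b <;> by_cases hj : j = b <;> subst_vars <;> simp_all [eq_comm] <;>
      split_ifs <;> simp_all
  rw [← hD, det_mul, det_mul, det_diagonal]
  have : (∏ i, Function.update (1 : ν → ℝ) b (-1) i) = -1 := by
    rw [Finset.prod_update_of_mem (Finset.mem_univ b)]; simp
  rw [this]; ring

lemma det_boost {a b : ν} (h : a ≠ b) : (boost a b (5/4) (3/4)).det = 1 := by
  have h1 : (boost a b (5/4) (3/4)).det * (boost a b (5/4) (-3/4)).det = 1 := by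
    rw [← det_mul, boost_mul_boost_neg h, det_one]
  rw [neg_div, ← det_boost_eq_neg h] at h1
  have h2 : boost a b (5/4) (3/4)
      = boost a b (3 / (2 * √2)) (1 / (2 * √2)) * boost a b (3 / (2 * √2)) (1 / (2 * √2)) := by
    rw [boost_mul h]
    have h3 : √2 * √2 = 2 := Real.mul_self_sqrt (by norm_num)
    have : (√2) ≠ 0 := by positivity
    congr 1 <;> field_simp <;> norm_num
  have h3 : 0 ≤ (boost a b (5/4) (3/4)).det := by rw [h2, det_mul]; exact mul_self_nonneg _
  nlinarith

lemma det_boostFam (p : ν → Prop) (j : BoostIdx p) : (boostFam p j).det = 1 := by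
  obtain ⟨⟨⟨a, b⟩, ha, hb⟩, t⟩ := j
  have hab : a ≠ b := fun e => hb (e ▸ ha)
  cases t
  · simp only [boostFam, Bool.false_eq_true, if_false]
    rw [neg_div, ← det_boost_eq_neg hab, det_boost hab]
  · simpa [boostFam] using det_boost hab

/-- The Eskin–Margulis–Mozes function: the largest value of a negative power of the covolume
among the rank `i` sublattices of the lattice `M ℤ^ν`. -/
noncomputable def emm (s : ℝ) (i : ℕ) (M : Matrix ν ν ℝ) : ℝ :=
  ⨆ B : {B : Matrix ν (Fin i) ℤ // Function.Injective B.mulVec},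
    gramDet (M * intReal B.1) ^ (-s)

lemma exists_gramDet_le {M : Matrix ν ν ℝ} (hM : M.det ≠ 0) (ι : Type*) [Fintype ι]
    [DecidableEq ι] : ∃ r : ℝ, 0 < r ∧ ∀ B : Matrix ν ι ℤ, Function.Injective B.mulVec →
      r ≤ gramDet (M * intReal B) := by
  obtain ⟨T, hT, h⟩ := exists_gramDet_bounds hM ι
  refine ⟨T⁻¹, by positivity, fun B hB => ?_⟩
  have := (one_le_gramDet_intReal hB).trans (h _ (gramDet_intReal_ne_zero hB)).1
  rwa [inv_le_iff_one_le_mul₀' (by positivity)]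

lemma gramDet_mul_intReal_pos {M : Matrix ν ν ℝ} (hM : M.det ≠ 0) {B : Matrix ν ι ℤ}
    (hB : Function.Injective B.mulVec) : 0 < gramDet (M * intReal B) :=
  (gramDet_nonneg _).lt_of_ne (gramDet_mul_ne_zero hM (gramDet_intReal_ne_zero hB)).symm

lemma emm_bddAbove {s : ℝ} (hs : 0 < s) (i : ℕ) {M : Matrix ν ν ℝ} (hM : M.det ≠ 0) :
    BddAbove (Set.range fun B : {B : Matrix ν (Fin i) ℤ // Function.Injective B.mulVec} =>
      gramDet (M * intReal B.1) ^ (-s)) := by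
  obtain ⟨r, hr, h⟩ := exists_gramDet_le hM (Fin i)
  refine ⟨r ^ (-s), ?_⟩
  rintro _ ⟨B, rfl⟩
  exact Real.rpow_le_rpow_of_nonpos hr (h B.1 B.2) (by linarith)

lemma emm_nonneg (s : ℝ) (i : ℕ) (M : Matrix ν ν ℝ) : 0 ≤ emm s i M :=
  Real.iSup_nonneg fun _ => Real.rpow_nonneg (gramDet_nonneg _) _

lemma rpow_gramDet_le_emm {s : ℝ} (hs : 0 < s) {i : ℕ} {M : Matrix ν ν ℝ} (hM : M.det ≠ 0)
    (hι : Fintype.card ι = i) {B : Matrix ν ι ℤ} (hB : Function.Injective B.mulVec) :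
    gramDet (M * intReal B) ^ (-s) ≤ emm s i M := by
  have e : Fin i ≃ ι := (Fintype.equivFinOfCardEq hι).symm
  have h1 : M * intReal (B.submatrix id e) = (M * intReal B).submatrix id e := rfl
  have h2 : Function.Injective (B.submatrix id e).mulVec := by
    intro x y hxy
    simp only [submatrix_mulVec_equiv, Function.comp_id] at hxy
    exact e.symm.surjective.injective_comp_right (hB hxy)
  have := le_ciSup (emm_bddAbove hs i hM) ⟨B.submatrix id e, h2⟩
  simp only [h1, gramDet_reindex] at this
  exact this

lemma emm_le {s : ℝ} {i : ℕ} {M : Matrix ν ν ℝ} {c : ℝ} (hc : 0 ≤ c)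
    (h : ∀ B : Matrix ν (Fin i) ℤ, Function.Injective B.mulVec →
      gramDet (M * intReal B) ^ (-s) ≤ c) : emm s i M ≤ c :=
  Real.iSup_le (fun B => h B.1 B.2) hc

lemma emm_mul_intReal_le {s : ℝ} (hs : 0 < s) (i : ℕ) {M : Matrix ν ν ℝ} (hM : M.det ≠ 0)
    {V : Matrix ν ν ℤ} (hV : V.det ≠ 0) : emm s i (M * intReal V) ≤ emm s i M := by
  refine emm_le (emm_nonneg _ _ _) fun B hB => ?_
  rw [Matrix.mul_assoc, ← intReal_mul]
  refine rpow_gramDet_le_emm hs hM (by simp) ?_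
  intro x y hxy
  rw [← mulVec_mulVec, ← mulVec_mulVec] at hxy
  have h1 := V.adjugate_mul
  have h2 := congrArg (fun v => V.adjugate *ᵥ v) hxy
  simp only [mulVec_mulVec, ← Matrix.mul_assoc, V.adjugate_mul, Matrix.smul_mul, Matrix.one_mul,
    smul_mulVec] at h2
  exact hB (smul_right_injective _ hV h2)

lemma emm_mul_unimodular {s : ℝ} (hs : 0 < s) (i : ℕ) {M : Matrix ν ν ℝ} (hM : M.det ≠ 0)
    {V : Matrix ν ν ℤ} (hV : V.det ^ 2 = 1) : emm s i (M * intReal V) = emm s i M := by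
  have hV0 : V.det ≠ 0 := by intro h; simp [h] at hV
  refine le_antisymm (emm_mul_intReal_le hs i hM hV0) ?_
  have hVu : IsUnit V.det := IsUnit.of_mul_eq_one _ (by rw [← pow_two]; exact hV)
  have h1 : M = M * intReal V * intReal V⁻¹ := by
    rw [Matrix.mul_assoc, ← intReal_mul, mul_nonsing_inv _ hVu, intReal_one, Matrix.mul_one]
  conv_lhs => rw [h1]
  refine emm_mul_intReal_le hs i ?_ ?_
  · rw [det_mul, det_intReal]; exact mul_ne_zero hM (by exact_mod_cast hV0)
  · have := V.det_nonsing_inv_mul_det hVu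
    intro h; rw [h, zero_mul] at this; exact zero_ne_one this

lemma emm_zero_le (s : ℝ) (M : Matrix ν ν ℝ) : emm s 0 M ≤ 1 := by
  refine emm_le zero_le_one fun B _ => ?_
  rw [gramDet, det_isEmpty, Real.one_rpow]

lemma emm_card_le {s : ℝ} (hs : 0 < s) {M : Matrix ν ν ℝ} (hM : M.det ≠ 0) :
    emm s (Fintype.card ν) M ≤ (M.det ^ 2) ^ (-s) := by
  refine emm_le (by positivity) fun B hB => ?_
  have e := (Fintype.equivFin ν)
  have h1 : gramDet (M * intReal B) = M.det ^ 2 * gramDet (intReal B) := by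
    have h2 : ∀ X : Matrix ν (Fin (Fintype.card ν)) ℝ, gramDet X = (X.submatrix id e).det ^ 2 := by
      intro X
      rw [← gramDet_reindex X e, gramDet, det_mul, det_transpose, pow_two]
    have h3 : (M * intReal B).submatrix id e = M * (intReal B).submatrix id e := rfl
    rw [h2, h2, h3, det_mul, mul_pow]
  rw [h1]
  have h2 : 0 < M.det ^ 2 := by positivity
  refine Real.rpow_le_rpow_of_nonpos h2 ?_ (by linarith)
  nlinarith [one_le_gramDet_intReal hB]

lemma measurable_emm {X : Type*} [TopologicalSpace X] [MeasurableSpace X] [BorelSpace X]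
    {φ : X → Matrix ν ν ℝ} (hφ : Continuous φ) (hd : ∀ x, (φ x).det ≠ 0) (s : ℝ) (i : ℕ) :
    Measurable fun x => emm s i (φ x) := by
  have : Countable (Matrix ν (Fin i) ℤ) := inferInstanceAs (Countable (ν → Fin i → ℤ))
  refine Measurable.iSup fun B => Continuous.measurable ?_
  refine Continuous.rpow_const (continuous_gramDet.comp (by fun_prop)) fun x => Or.inl ?_
  exact (gramDet_mul_intReal_pos (hd x) B.2).ne'

lemma emm_mul_le {s : ℝ} (hs : 0 < s) {i : ℕ} {g M : Matrix ν ν ℝ} (hM : M.det ≠ 0) {T : ℝ}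
    (hT : 1 ≤ T) (h : ∀ B : Matrix ν (Fin i) ℝ, gramDet B ≠ 0 → gramDet B ≤ T * gramDet (g * B)) :
    emm s i (g * M) ≤ T ^ s * emm s i M := by
  refine emm_le (mul_nonneg (by positivity) (emm_nonneg _ _ _)) fun B hB => ?_
  have h0 := gramDet_mul_intReal_pos hM hB
  have h1 := h _ h0.ne'
  rw [← Matrix.mul_assoc] at h1
  refine le_trans ?_ (mul_le_mul_of_nonneg_left (rpow_gramDet_le_emm hs hM (by simp) hB)
    (by positivity))
  have h2 : T⁻¹ * gramDet (M * intReal B) ≤ gramDet (g * M * intReal B) := by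
    rw [inv_mul_le_iff₀ (by positivity)]; exact h1
  calc _ ≤ (T⁻¹ * gramDet (M * intReal B)) ^ (-s) :=
        Real.rpow_le_rpow_of_nonpos (by positivity) h2 (by linarith)
    _ = _ := by
        rw [Real.mul_rpow (by positivity) h0.le, Real.rpow_neg (by positivity) s,
          Real.inv_rpow (by positivity), inv_inv]

lemma rpow_gramDet_mul_le_emm_mul {s : ℝ} (hs : 0 < s) {i : ℕ} {M : Matrix ν ν ℝ}
    (hM : M.det ≠ 0) {B B' : Matrix ν (Fin i) ℤ} (hB : Function.Injective B.mulVec)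
    (hB' : Function.Injective B'.mulVec) (hsat : IsSaturated (LinearMap.range B.mulVecLin))
    (hsat' : IsSaturated (LinearMap.range B'.mulVecLin))
    (hne : LinearMap.range B.mulVecLin ≠ LinearMap.range B'.mulVecLin) :
    ∃ d k r : ℕ, 1 ≤ k ∧ d + k = i ∧ d + 2 * k + r = Fintype.card ν ∧
      gramDet (M * intReal B) ^ (-s) * gramDet (M * intReal B') ^ (-s)
        ≤ emm s d M * emm s (d + 2 * k) M := by
  obtain ⟨d, k, D, E, E', hk, hd, i1, i2, i3, r1, r2⟩ := exists_adapted_bases hB hB' hsat hsat' hne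
  have hcard : d + 2 * k ≤ Fintype.card ν := by
    have := LinearMap.finrank_le_finrank_of_injective
      (f := (fromCols D (fromCols E E')).mulVecLin) i1
    simp at this; omega
  have iD : Function.Injective D.mulVec := by
    intro x y hxy
    have := i2 (a₁ := Sum.elim x 0) (a₂ := Sum.elim y 0) (by simp [fromCols_mulVec, hxy])
    ext j; exact congrFun this (Sum.inl j)
  refine ⟨d, k, Fintype.card ν - (d + 2 * k), hk, hd, by omega, ?_⟩
  have e1 := rpow_gramDet_le_emm hs hM (i := d) (by simp) iD
  have e2 := rpow_gramDet_le_emm hs hM (i := d + 2 * k) (by simp; ring) i1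
  refine le_trans ?_ (mul_le_mul e1 e2 (Real.rpow_nonneg (gramDet_nonneg _) _) (emm_nonneg _ _ _))
  rw [gramDet_eq_of_range_eq M i2 hB r1, gramDet_eq_of_range_eq M i3 hB' r2,
    ← Real.mul_rpow (gramDet_nonneg _) (gramDet_nonneg _),
    ← Real.mul_rpow (gramDet_nonneg _) (gramDet_nonneg _)]
  refine Real.rpow_le_rpow_of_nonpos (mul_pos (gramDet_mul_intReal_pos hM iD)
    (gramDet_mul_intReal_pos hM i1)) ?_ (by linarith)
  have hsub := gramDet_submodular (M * intReal D) (M * intReal E) (M * intReal E')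
    (by rw [← mul_fromCols, ← intReal_fromCols]; exact (gramDet_mul_intReal_pos hM i2).ne')
  rw [← mul_fromCols, ← mul_fromCols, ← mul_fromCols, ← mul_fromCols, ← intReal_fromCols,
    ← intReal_fromCols, ← intReal_fromCols, ← intReal_fromCols] at hsub
  linarith

lemma exists_saturated_rpow_ge {s : ℝ} (hs : 0 < s) {i : ℕ} {M : Matrix ν ν ℝ} (hM : M.det ≠ 0)
    {B : Matrix ν (Fin i) ℤ} (hB : Function.Injective B.mulVec) :
    ∃ B' : Matrix ν (Fin i) ℤ, Function.Injective B'.mulVec ∧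
      IsSaturated (LinearMap.range B'.mulVecLin) ∧
      gramDet (M * intReal B) ^ (-s) ≤ gramDet (M * intReal B') ^ (-s) := by
  obtain ⟨B', R, hB', hsat, hR, rfl⟩ := exists_saturated_factor hB
  refine ⟨B', hB', hsat, ?_⟩
  refine Real.rpow_le_rpow_of_nonpos (gramDet_mul_intReal_pos hM hB') ?_ (by linarith)
  rw [intReal_mul, ← Matrix.mul_assoc, gramDet_mul, det_intReal]
  have h1 : (1 : ℝ) ≤ (R.det : ℝ) ^ 2 := by
    have : 1 ≤ R.det ^ 2 := Int.add_one_le_iff.2 (sq_pos_of_ne_zero hR)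
    exact_mod_cast this
  nlinarith [gramDet_nonneg (M * intReal B')]

/-- The dichotomy behind the Eskin–Margulis–Mozes inequality. -/
lemma emm_dichotomy {J : Type*} [Fintype J] {g : J → Matrix ν ν ℝ} (hg : ∀ j, (g j).det ≠ 0)
    {s : ℝ} (hs : 0 < s) {i : ℕ} (hi : i ≤ Fintype.card ν) {T c : ℝ} (hT : 1 ≤ T) (hc : 0 ≤ c)
    (hTg : ∀ j, ∀ B : Matrix ν (Fin i) ℝ, gramDet B ≠ 0 →
      gramDet B ≤ T * gramDet (g j * B) ∧ gramDet (g j * B) ≤ T * gramDet B)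
    (hcg : ∀ B : Matrix ν (Fin i) ℝ, gramDet B ≠ 0 →
      ∑ j, gramDet (g j * B) ^ (-s) ≤ c * Fintype.card J * gramDet B ^ (-s))
    {M : Matrix ν ν ℝ} (hM : M.det ≠ 0) :
    (∃ d k r : ℕ, 1 ≤ k ∧ d + k = i ∧ d + 2 * k + r = Fintype.card ν ∧
      emm s i M ^ 2 ≤ (2 * T ^ s) ^ 2 * (emm s d M * emm s (d + 2 * k) M)) ∨
    ∑ j, emm s i (g j * M) ≤ c * Fintype.card J * emm s i M := by
  have hTs : 0 < T ^ s := by positivity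
  have hne : Nonempty {B : Matrix ν (Fin i) ℤ // Function.Injective B.mulVec} := by
    obtain ⟨e⟩ : Nonempty (Fin i ↪ ν) := by
      rw [Function.Embedding.nonempty_iff_card_le]; simpa using hi
    refine ⟨⟨(1 : Matrix ν ν ℤ).submatrix id e, fun x y hxy => ?_⟩⟩
    ext j
    have := congrFun hxy (e j)
    simpa [mulVec, dotProduct, one_apply, e.injective.eq_iff] using this
  have hposi : ∀ B : Matrix ν (Fin i) ℤ, Function.Injective B.mulVec →
      0 < gramDet (M * intReal B) ^ (-s) := fun B hB =>
    Real.rpow_pos_of_pos (gramDet_mul_intReal_pos hM hB) _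
  have hemm : 0 < emm s i M := by
    obtain ⟨B, hB⟩ := hne
    exact (hposi B hB).trans_le (rpow_gramDet_le_emm hs hM (by simp) hB)
  obtain ⟨B, hB, hsat, hBm⟩ : ∃ B : Matrix ν (Fin i) ℤ, Function.Injective B.mulVec ∧
      IsSaturated (LinearMap.range B.mulVecLin) ∧
      emm s i M ≤ 2 * gramDet (M * intReal B) ^ (-s) := by
    obtain ⟨⟨B, hB⟩, h⟩ := exists_lt_of_lt_ciSup (show emm s i M / 2 < emm s i M by linarith)
    obtain ⟨B', hB', hsat, h'⟩ := exists_saturated_rpow_ge hs hM hB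
    exact ⟨B', hB', hsat, by simp only at h; linarith⟩
  by_cases hcase : ∃ B' : Matrix ν (Fin i) ℤ, Function.Injective B'.mulVec ∧
      IsSaturated (LinearMap.range B'.mulVecLin) ∧
      LinearMap.range B.mulVecLin ≠ LinearMap.range B'.mulVecLin ∧
      emm s i M ≤ 2 * (T ^ s) ^ 2 * gramDet (M * intReal B') ^ (-s)
  · left
    obtain ⟨B', hB', hsat', hne', hB'm⟩ := hcase
    obtain ⟨d, k, r, hk, hd, hr, h⟩ := rpow_gramDet_mul_le_emm_mul hs hM hB hB' hsat hsat' hne'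
    refine ⟨d, k, r, hk, hd, hr, ?_⟩
    calc emm s i M ^ 2 = emm s i M * emm s i M := pow_two _
      _ ≤ (2 * gramDet (M * intReal B) ^ (-s)) * (2 * (T ^ s) ^ 2 * gramDet (M * intReal B') ^ (-s)) :=
          mul_le_mul hBm hB'm hemm.le (by have := hposi B hB; positivity)
      _ = (2 * T ^ s) ^ 2 * (gramDet (M * intReal B) ^ (-s) * gramDet (M * intReal B') ^ (-s)) := by
          ring
      _ ≤ _ := by gcongr
  · right
    push Not at hcase
    have hgM : ∀ j, (g j * M).det ≠ 0 := fun j => by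
      rw [det_mul]; exact mul_ne_zero (hg j) hM
    have key : ∀ j, emm s i (g j * M) ≤ gramDet (g j * M * intReal B) ^ (-s) := by
      intro j
      refine emm_le (Real.rpow_nonneg (gramDet_nonneg _) _) fun B₁ hB₁ => ?_
      obtain ⟨B', hB', hsat', h'⟩ := exists_saturated_rpow_ge hs (hgM j) hB₁
      refine h'.trans ?_
      by_cases hr : LinearMap.range B.mulVecLin = LinearMap.range B'.mulVecLin
      · rw [gramDet_eq_of_range_eq _ hB hB' hr]
      · have h1 := hcase B' hB' hsat' hr
        have hp := gramDet_mul_intReal_pos hM hB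
        have hp' := gramDet_mul_intReal_pos hM hB'
        have hpg := gramDet_mul_intReal_pos (hgM j) hB
        have hpg' := gramDet_mul_intReal_pos (hgM j) hB'
        have b1 := (hTg j _ hp'.ne').1
        have b2 := (hTg j _ hp.ne').2
        rw [← Matrix.mul_assoc] at b1 b2
        have c1 : gramDet (g j * M * intReal B') ^ (-s)
            ≤ T ^ s * gramDet (M * intReal B') ^ (-s) := by
          rw [Real.rpow_neg hpg'.le, Real.rpow_neg hp'.le, inv_le_iff_one_le_mul₀ (by positivity)]
          have := Real.rpow_le_rpow hp'.le b1 hs.le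
          rw [Real.mul_rpow (by positivity) hpg'.le] at this
          have h4 : 0 < gramDet (M * intReal B') ^ s := by positivity
          field_simp
          linarith
        have c2 : gramDet (M * intReal B) ^ (-s)
            ≤ T ^ s * gramDet (g j * M * intReal B) ^ (-s) := by
          rw [Real.rpow_neg hpg.le, Real.rpow_neg hp.le, inv_le_iff_one_le_mul₀ (by positivity)]
          have := Real.rpow_le_rpow hpg.le b2 hs.le
          rw [Real.mul_rpow (by positivity) hp.le] at this
          have h4 : 0 < gramDet (g j * M * intReal B) ^ s := by positivity
          field_simp
          linarith
        refine c1.trans ?_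
        have h2 : (T ^ s) ^ 2 * gramDet (M * intReal B') ^ (-s) ≤ gramDet (M * intReal B) ^ (-s) := by
          linarith
        nlinarith
    calc ∑ j, emm s i (g j * M) ≤ ∑ j, gramDet (g j * (M * intReal B)) ^ (-s) :=
          Finset.sum_le_sum fun j _ => by rw [← Matrix.mul_assoc]; exact key j
      _ ≤ c * Fintype.card J * gramDet (M * intReal B) ^ (-s) :=
          hcg _ (gramDet_mul_intReal_pos hM hB).ne'
      _ ≤ _ := by
          gcongr
          exact rpow_gramDet_le_emm hs hM (by simp) hB

end Lyapunov

section Lyapunov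

variable {ν : Type*} [Fintype ν] [DecidableEq ν]

lemma exists_uniform_gramDet_bounds (p : ν → Prop) [DecidablePred p] (N : ℕ) :
    ∃ T : ℝ, 1 ≤ T ∧ ∀ i ≤ N, ∀ j : BoostIdx p, ∀ B : Matrix ν (Fin i) ℝ, gramDet B ≠ 0 →
      gramDet B ≤ T * gramDet (boostFam p j * B) ∧ gramDet (boostFam p j * B) ≤ T * gramDet B := by
  have h (i : ℕ) (j : BoostIdx p) :=
    exists_gramDet_bounds (M := boostFam p j) (boostFam_det_ne_zero p j) (Fin i)
  choose T hT1 hT using h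
  have hnn : ∀ i j, 0 ≤ T i j := fun i j => by linarith [hT1 i j]
  refine ⟨1 + ∑ i ∈ Finset.range (N + 1), ∑ j, T i j,
    by linarith [Finset.sum_nonneg fun i (_ : i ∈ Finset.range (N + 1)) =>
      Finset.sum_nonneg fun j (_ : j ∈ Finset.univ) => hnn i j], fun i hi j B hB => ?_⟩
  have h1 : T i j ≤ 1 + ∑ i ∈ Finset.range (N + 1), ∑ j, T i j := by
    have h2 := Finset.single_le_sum (f := T i) (fun j _ => hnn i j) (Finset.mem_univ j)
    have h3 := Finset.single_le_sum (f := fun i => ∑ j, T i j)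
      (fun i _ => Finset.sum_nonneg fun j _ => hnn i j)
      (Finset.mem_range.2 (Nat.lt_succ_of_le hi))
    linarith
  exact ⟨(hT i j B hB).1.trans (mul_le_mul_of_nonneg_right h1 (gramDet_nonneg _)),
    (hT i j B hB).2.trans (mul_le_mul_of_nonneg_right h1 (gramDet_nonneg _))⟩

lemma exists_uniform_contraction (p : ν → Prop) [DecidablePred p] {a₀ b₀ b₁ : ν} (ha : p a₀)
    (hb₀ : ¬ p b₀) (hb₁ : ¬ p b₁) (hb : b₀ ≠ b₁) :
    ∃ s : ℝ, 0 < s ∧ ∃ c : ℝ, 0 ≤ c ∧ c < 1 ∧ ∀ i : ℕ, 0 < i → i < Fintype.card ν →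
      ∀ B : Matrix ν (Fin i) ℝ, gramDet B ≠ 0 → ∑ j, gramDet (boostFam p j * B) ^ (-s)
        ≤ c * Fintype.card (BoostIdx p) * gramDet B ^ (-s) := by
  have h : ∀ᶠ s in nhdsWithin (0 : ℝ) (Set.Ioi 0), ∀ i ∈ Finset.range (Fintype.card ν),
      ∃ c : ℝ, 0 ≤ c ∧ c < 1 ∧ (0 < i → ∀ B : Matrix ν (Fin i) ℝ, gramDet B ≠ 0 →
        ∑ j, gramDet (boostFam p j * B) ^ (-s)
          ≤ c * Fintype.card (BoostIdx p) * gramDet B ^ (-s)) := by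
    rw [Filter.eventually_all_finset]
    intro i hi
    rcases Nat.eq_zero_or_pos i with rfl | h0
    · exact Filter.Eventually.of_forall fun s => ⟨0, le_rfl, one_pos, fun h => absurd h (lt_irrefl _)⟩
    · have : Nonempty (Fin i) := ⟨⟨0, h0⟩⟩
      filter_upwards [eventually_boost_contraction (ι := Fin i) p ha hb₀ hb₁ hb
        (by simpa using hi)] with s hs
      obtain ⟨c, h1, h2, h3⟩ := hs
      exact ⟨c, h2.le, h1, fun _ => h3⟩
  obtain ⟨s, hs, hs0⟩ := (h.and self_mem_nhdsWithin).exists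
  refine ⟨s, hs0, ?_⟩
  choose! c hc0 hc1 hc using hs
  have hne : (Finset.range (Fintype.card ν)).Nonempty :=
    Finset.nonempty_range_iff.2 (Fintype.card_pos_iff.2 ⟨a₀⟩).ne'
  refine ⟨(Finset.range (Fintype.card ν)).sup' hne c, ?_, ?_, fun i h0 hi B hB => ?_⟩
  · obtain ⟨i, hi⟩ := hne
    exact (hc0 i hi).trans (Finset.le_sup' c hi)
  · exact (Finset.sup'_lt_iff hne).2 hc1
  · have hi' := Finset.mem_range.2 hi
    refine (hc i hi' h0 B hB).trans ?_
    have := Finset.le_sup' c hi'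
    have h2 := Real.rpow_nonneg (gramDet_nonneg B) (-s)
    gcongr

/-- The concave-weighted sum of the functions `emm s i`. -/
noncomputable def wsum (s ε : ℝ) (M : Matrix ν ν ℝ) : ℝ :=
  ∑ i ∈ Finset.range (Fintype.card ν + 1), ε ^ (i * (Fintype.card ν - i)) * emm s i M

lemma wsum_nonneg (s : ℝ) {ε : ℝ} (hε : 0 ≤ ε) (M : Matrix ν ν ℝ) : 0 ≤ wsum s ε M :=
  Finset.sum_nonneg fun _ _ => mul_nonneg (pow_nonneg hε _) (emm_nonneg _ _ _)

lemma emm_le_wsum (s : ℝ) {ε : ℝ} (hε : 0 ≤ ε) (M : Matrix ν ν ℝ) {i : ℕ}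
    (hi : i ≤ Fintype.card ν) :
    ε ^ (i * (Fintype.card ν - i)) * emm s i M ≤ wsum s ε M :=
  Finset.single_le_sum (f := fun i => ε ^ (i * (Fintype.card ν - i)) * emm s i M)
    (fun _ _ => mul_nonneg (pow_nonneg hε _) (emm_nonneg _ _ _))
    (Finset.mem_range.2 (Nat.lt_succ_of_le hi))

lemma le_mul_wsum_of_sq_le {s ε C : ℝ} (hε : 0 ≤ ε) (hε1 : ε ≤ 1) (hC : 0 ≤ C)
    (M : Matrix ν ν ℝ) {d k r : ℕ} (hk : 1 ≤ k) (hN : d + 2 * k + r = Fintype.card ν)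
    (h : emm s (d + k) M ^ 2 ≤ C ^ 2 * (emm s d M * emm s (d + 2 * k) M)) :
    ε ^ ((d + k) * (Fintype.card ν - (d + k))) * emm s (d + k) M ≤ C * ε * wsum s ε M := by
  have hd := emm_le_wsum s hε M (i := d) (by omega)
  have hdk := emm_le_wsum s hε M (i := d + 2 * k) (by omega)
  have e1 : Fintype.card ν - (d + k) = k + r := by omega
  have e2 : Fintype.card ν - d = 2 * k + r := by omega
  have e3 : Fintype.card ν - (d + 2 * k) = r := by omega
  rw [e2] at hd
  rw [e3] at hdk
  rw [e1]
  have hf := wsum_nonneg s hε M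
  refine (sq_le_sq₀ (mul_nonneg (pow_nonneg hε _) (emm_nonneg _ _ _)) (by positivity)).1 ?_
  have hX : (ε ^ (d * (2 * k + r)) * emm s d M) * (ε ^ ((d + 2 * k) * r) * emm s (d + 2 * k) M)
      ≤ wsum s ε M * wsum s ε M :=
    mul_le_mul hd hdk (mul_nonneg (pow_nonneg hε _) (emm_nonneg _ _ _)) hf
  have hk2 : ε ^ (2 * k ^ 2) ≤ ε ^ 2 := pow_le_pow_of_le_one hε hε1 (by nlinarith)
  calc (ε ^ ((d + k) * (k + r)) * emm s (d + k) M) ^ 2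
      = ε ^ (2 * ((d + k) * (k + r))) * emm s (d + k) M ^ 2 := by ring
    _ ≤ ε ^ (2 * ((d + k) * (k + r))) * (C ^ 2 * (emm s d M * emm s (d + 2 * k) M)) :=
        mul_le_mul_of_nonneg_left h (pow_nonneg hε _)
    _ = C ^ 2 * (ε ^ (2 * k ^ 2) * ((ε ^ (d * (2 * k + r)) * emm s d M) *
          (ε ^ ((d + 2 * k) * r) * emm s (d + 2 * k) M))) := by ring
    _ ≤ C ^ 2 * (ε ^ 2 * (wsum s ε M * wsum s ε M)) := by
        gcongr
        exact mul_nonneg (mul_nonneg (pow_nonneg hε _) (emm_nonneg _ _ _))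
          (mul_nonneg (pow_nonneg hε _) (emm_nonneg _ _ _))
    _ = _ := by ring

lemma gramDet_mul_intReal_replicateCol (M : Matrix ν ν ℝ) (z : ν → ℤ) :
    gramDet (M * intReal (replicateCol Unit z)) = qf (Mᵀ * M) (castVec z) := by
  have h : M * intReal (replicateCol Unit z) = replicateCol Unit (M *ᵥ castVec z) := by
    rw [replicateCol_mulVec]; rfl
  rw [qf_transpose_mul_self, gramDet, h, det_unique]
  simp [Matrix.mul_apply, dotProduct]

lemma injective_replicateCol {z : ν → ℤ} (hz : z ≠ 0) :
    Function.Injective (replicateCol Unit z).mulVec := by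
  intro x y hxy
  obtain ⟨i, hi⟩ := Function.ne_iff.1 hz
  have h := congrFun hxy i
  simp only [mulVec, dotProduct, replicateCol_apply, Finset.univ_unique, Finset.sum_singleton] at h
  ext u
  exact mul_left_cancel₀ hi h

lemma dotProduct_self_pos_of_ne {M : Matrix ν ν ℝ} (hM : M.det ≠ 0) {x : ν → ℝ} (hx : x ≠ 0) :
    0 < M *ᵥ x ⬝ᵥ M *ᵥ x := by
  have h : M *ᵥ x ≠ 0 := fun h => hx (eq_zero_of_mulVec_eq_zero hM h)
  simpa using dotProduct_star_self_pos_iff.2 h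

/-- A proper Lyapunov function for the averaging operator of the boost family. -/
theorem exists_lyapunov (p : ν → Prop) [DecidablePred p] {a₀ b₀ b₁ : ν} (ha : p a₀)
    (hb₀ : ¬ p b₀) (hb₁ : ¬ p b₁) (hb : b₀ ≠ b₁) {δ : ℝ} (hδ : 0 < δ) :
    ∃ f : Matrix ν ν ℝ → ℝ, (∀ M, 0 ≤ f M) ∧
      (∀ M V, M.det ≠ 0 → V.det ^ 2 = 1 → f (M * intReal V) = f M) ∧
      (∃ c b : ℝ, 0 ≤ c ∧ c < 1 ∧ 0 ≤ b ∧ ∀ M : Matrix ν ν ℝ, M.det ^ 2 = δ →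
        ∑ j, f (boostFam p j * M) ≤ Fintype.card (BoostIdx p) * (c * f M + b)) ∧
      (∀ R, ∃ r > 0, ∀ M : Matrix ν ν ℝ, M.det ≠ 0 → f M ≤ R →
        ∀ z : ν → ℤ, z ≠ 0 → r ≤ qf (Mᵀ * M) (castVec z)) ∧
      (∀ (X : Type) [TopologicalSpace X] [MeasurableSpace X] [BorelSpace X]
        (φ : X → Matrix ν ν ℝ), Continuous φ → (∀ x, (φ x).det ≠ 0) →
        Measurable fun x => f (φ x)) := by
  obtain ⟨s, hs, c, hc0, hc1, hc⟩ := exists_uniform_contraction p ha hb₀ hb₁ hb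
  obtain ⟨T, hT1, hT⟩ := exists_uniform_gramDet_bounds p (Fintype.card ν)
  set N := Fintype.card ν with hN
  have hTs : 1 ≤ T ^ s := Real.one_le_rpow hT1 hs.le
  set ε : ℝ := (1 - c) / (4 * (N + 1) * T ^ s * T ^ s) with hε
  have hε0 : 0 < ε := by have : 0 < 1 - c := by linarith
                         positivity
  have hε1 : ε ≤ 1 := by
    rw [hε, div_le_one (by positivity)]
    have h1 : (1 : ℝ) ≤ N + 1 := by linarith [(Nat.cast_nonneg N : (0 : ℝ) ≤ N)]
    have h2 : (1 : ℝ) ≤ (N + 1) * T ^ s := by nlinarith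
    have h3 : (1 : ℝ) ≤ (N + 1) * T ^ s * T ^ s := by nlinarith
    nlinarith
  refine ⟨wsum s ε, wsum_nonneg s hε0.le, fun M V hM hV => ?_, ?_, fun R => ?_, ?_⟩
  · simp only [wsum, emm_mul_unimodular hs _ hM hV]
  · set b : ℝ := 1 + δ ^ (-s) with hb
    have hb0 : 0 ≤ b := by positivity
    refine ⟨c + (1 - c) / 2, (N + 1) * b, by linarith, by linarith, by positivity, fun M hM => ?_⟩
    have hM0 : M.det ≠ 0 := by rintro h; rw [h] at hM; norm_num at hM; exact hδ.ne hM
    set J := Fintype.card (BoostIdx p) with hJ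
    have hf := wsum_nonneg s hε0.le M
    have key : ∀ i ∈ Finset.range (N + 1),
        ε ^ (i * (N - i)) * ∑ j, emm s i (boostFam p j * M)
          ≤ J * (c * (ε ^ (i * (N - i)) * emm s i M) + 2 * T ^ s * T ^ s * ε * wsum s ε M + b) := by
      intro i hi
      have hi' : i ≤ N := Nat.lt_succ_iff.1 (Finset.mem_range.1 hi)
      have hX0 : 0 ≤ ε ^ (i * (N - i)) * emm s i M :=
        mul_nonneg (pow_nonneg hε0.le _) (emm_nonneg _ _ _)
      have hW : 0 ≤ 2 * T ^ s * T ^ s * ε * wsum s ε M := by positivity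
      have hJ0 : (0 : ℝ) ≤ J := Nat.cast_nonneg _
      have hend : (∀ j, emm s i (boostFam p j * M) ≤ b) → i * (N - i) = 0 →
          ε ^ (i * (N - i)) * ∑ j, emm s i (boostFam p j * M)
          ≤ J * (c * (ε ^ (i * (N - i)) * emm s i M) + 2 * T ^ s * T ^ s * ε * wsum s ε M + b) := by
        intro h h0
        have h1 := Finset.sum_le_card_nsmul Finset.univ _ b fun j _ => h j
        rw [nsmul_eq_mul, Finset.card_univ, ← hJ] at h1
        have h2 := mul_nonneg hc0 hX0
        have h3 : ε ^ (i * (N - i)) * ∑ j, emm s i (boostFam p j * M)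
            = ∑ j, emm s i (boostFam p j * M) := by rw [h0, pow_zero, one_mul]
        rw [h3]
        exact h1.trans (mul_le_mul_of_nonneg_left (by linarith) hJ0)
      rcases Nat.eq_zero_or_pos i with rfl | h0
      · refine hend (fun j => (emm_zero_le _ _).trans ?_) (by simp)
        rw [hb]; linarith [Real.rpow_nonneg hδ.le (-s)]
      rcases hi'.eq_or_lt with hiN | hlt
      · refine hend (fun j => ?_) (by simp [hiN])
        rw [hiN]
        refine (emm_card_le hs ?_).trans ?_
        · rw [det_mul, det_boostFam, one_mul]; exact hM0
        · rw [det_mul, det_boostFam, one_mul, hM, hb]; linarith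
      rcases emm_dichotomy (boostFam_det_ne_zero p) hs hi' hT1 hc0 (hT i hi') (hc i h0 hlt) hM0
        with ⟨d, k, r, hk, rfl, hdk, h⟩ | h
      · have h1 := le_mul_wsum_of_sq_le hε0.le hε1 (by positivity) M hk hdk h
        have h2 : ∑ j, emm s (d + k) (boostFam p j * M) ≤ J * (T ^ s * emm s (d + k) M) := by
          have := Finset.sum_le_card_nsmul Finset.univ
            (fun j => emm s (d + k) (boostFam p j * M)) (T ^ s * emm s (d + k) M)
            fun j _ => emm_mul_le hs hM0 hT1 fun B hB => (hT _ hi' j B hB).1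
          rwa [nsmul_eq_mul, Finset.card_univ] at this
        calc _ ≤ ε ^ ((d + k) * (N - (d + k))) * (J * (T ^ s * emm s (d + k) M)) :=
              mul_le_mul_of_nonneg_left h2 (pow_nonneg hε0.le _)
          _ = J * (T ^ s * (ε ^ ((d + k) * (N - (d + k))) * emm s (d + k) M)) := by ring
          _ ≤ J * (T ^ s * (2 * T ^ s * ε * wsum s ε M)) := by gcongr
          _ ≤ _ := by
              refine mul_le_mul_of_nonneg_left ?_ hJ0
              nlinarith [mul_nonneg hc0 hX0]
      · calc _ ≤ ε ^ (i * (N - i)) * (c * J * emm s i M) :=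
              mul_le_mul_of_nonneg_left h (pow_nonneg hε0.le _)
          _ = J * (c * (ε ^ (i * (N - i)) * emm s i M)) := by ring
          _ ≤ _ := by
              refine mul_le_mul_of_nonneg_left ?_ hJ0
              linarith
    calc ∑ j, wsum s ε (boostFam p j * M)
        = ∑ i ∈ Finset.range (N + 1), ε ^ (i * (N - i)) * ∑ j, emm s i (boostFam p j * M) := by
          simp only [wsum, Finset.mul_sum]
          rw [Finset.sum_comm]
      _ ≤ _ := Finset.sum_le_sum key
      _ = J * (c * wsum s ε M + (N + 1) * (2 * T ^ s * T ^ s * ε) * wsum s ε M + (N + 1) * b) := by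
          rw [← Finset.mul_sum, Finset.sum_add_distrib, Finset.sum_add_distrib, ← Finset.mul_sum]
          simp only [Finset.sum_const, Finset.card_range, nsmul_eq_mul]
          rw [← wsum]; push_cast; ring
      _ = _ := by
          have : (N + 1) * (2 * T ^ s * T ^ s * ε) = (1 - c) / 2 := by
            rw [hε]; field_simp; ring
          rw [this]; ring
  · have hN1 : 1 ≤ N := Fintype.card_pos_iff.2 ⟨a₀⟩
    set K : ℝ := max R 1 / ε ^ (1 * (N - 1)) with hK
    have hR : 0 < max R 1 := lt_max_of_lt_right one_pos
    have hK0 : 0 < K := by positivity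
    refine ⟨K ^ (-s⁻¹), by positivity, fun M hM hf z hz => ?_⟩
    have hB := injective_replicateCol hz
    have h1 := rpow_gramDet_le_emm hs hM (Fintype.card_unit) hB
    have h2 := (emm_le_wsum s hε0.le M hN1).trans (hf.trans (le_max_left R 1))
    have h3 : emm s 1 M ≤ K := by
      rw [hK, le_div_iff₀ (by positivity), mul_comm]; exact h2
    have h4 : gramDet (M * intReal (replicateCol Unit z)) = qf (Mᵀ * M) (castVec z) :=
      gramDet_mul_intReal_replicateCol M z
    have hq : 0 < qf (Mᵀ * M) (castVec z) := by
      rw [qf_transpose_mul_self]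
      exact dotProduct_self_pos_of_ne hM (castVec_ne_zero hz)
    rw [h4] at h1
    by_contra! hlt
    have h5 := Real.rpow_lt_rpow_of_neg hq hlt (neg_lt_zero.2 hs)
    rw [← Real.rpow_mul hK0.le, neg_mul_neg, inv_mul_cancel₀ hs.ne', Real.rpow_one] at h5
    linarith
  · intro X _ _ _ φ hφ hd
    exact Finset.measurable_sum _ fun i _ => (measurable_emm hφ hd s i).const_mul _

end Lyapunov

section LatticeCriterion

variable {G : Type*} [Group G] [TopologicalSpace G] [IsTopologicalGroup G]
  [SecondCountableTopology G]

/-- A set meeting every orbit of a subgroup exactly once. -/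
def IsStrictDomain (Λ : Subgroup G) (D : Set G) : Prop :=
  (∀ g : G, ∃ γ : Λ, ∃ d ∈ D, g = (γ : G) * d) ∧
    ∀ d₁ ∈ D, ∀ d₂ ∈ D, ∀ γ : Λ, d₁ = (γ : G) * d₂ → d₁ = d₂

lemma exists_open_one_mem_of_discrete (Λ : Subgroup G) [DiscreteTopology Λ] :
    ∃ U : Set G, IsOpen U ∧ (1 : G) ∈ U ∧ ∀ x ∈ U, ∀ y ∈ U, x * y⁻¹ ∈ Λ → x = y := by
  have h1 : IsOpen ({1} : Set Λ) := isOpen_discrete _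
  obtain ⟨W, hW, hW1⟩ := isOpen_induced_iff.1 h1
  have h1W : (1 : G) ∈ W := by
    have : (1 : Λ) ∈ (Subtype.val ⁻¹' W : Set Λ) := by rw [hW1]; rfl
    exact this
  have hc : Continuous fun q : G × G => q.1 * q.2⁻¹ := by fun_prop
  have h2 : (fun q : G × G => q.1 * q.2⁻¹) ⁻¹' W ∈ nhds ((1 : G), (1 : G)) :=
    hc.continuousAt.preimage_mem_nhds (hW.mem_nhds (by simpa using h1W))
  rw [nhds_prod_eq, Filter.mem_prod_same_iff] at h2
  obtain ⟨t, ht, htW⟩ := h2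
  obtain ⟨U, hUt, hU, h1U⟩ := mem_nhds_iff.1 ht
  refine ⟨U, hU, h1U, fun x hx y hy hxy => ?_⟩
  have h3 : x * y⁻¹ ∈ W := htW (Set.mk_mem_prod (hUt hx) (hUt hy))
  have h4 : (⟨x * y⁻¹, hxy⟩ : Λ) ∈ ({1} : Set Λ) := by rw [← hW1]; exact h3
  exact mul_inv_eq_one.1 (congrArg Subtype.val h4)

lemma exists_measurable_strictDomain [MeasurableSpace G] [BorelSpace G]
    (Λ : Subgroup G) [DiscreteTopology Λ] :
    ∃ D : Set G, MeasurableSet D ∧ IsStrictDomain Λ D := by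
  obtain ⟨U, hU, h1U, hUΛ⟩ := exists_open_one_mem_of_discrete Λ
  obtain ⟨s, hs⟩ := TopologicalSpace.exists_dense_seq G
  set V : ℕ → Set G := fun k => (fun x => x * s k) '' U with hV
  have hVo : ∀ k, IsOpen (V k) := fun k => isOpenMap_mul_right (s k) U hU
  have hVΛ : ∀ k, ∀ x ∈ V k, ∀ y ∈ V k, ∀ γ : Λ, x = γ * y → x = y := by
    rintro k _ ⟨x, hx, rfl⟩ _ ⟨y, hy, rfl⟩ γ h
    simp only at h ⊢
    rw [← mul_assoc] at h
    have h2 := mul_right_cancel h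
    rw [hUΛ x hx y hy (by rw [h2]; simp)]
  have hcov : ∀ x, ∃ k, x ∈ V k := by
    intro x
    have ho : IsOpen ((fun t => x * t⁻¹) ⁻¹' U) := hU.preimage (by fun_prop)
    obtain ⟨k, hk⟩ := hs.exists_mem_open ho ⟨x, by simpa using h1U⟩
    exact ⟨k, x * (s k)⁻¹, hk, by simp⟩
  set W : ℕ → Set G := fun k => ⋃ γ : Λ, (fun x => (γ : G) * x) '' V k with hW
  have hWo : ∀ k, IsOpen (W k) := fun k => isOpen_iUnion fun γ => isOpenMap_mul_left _ _ (hVo k)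
  have hWmem : ∀ k x, x ∈ W k ↔ ∃ γ : Λ, ∃ y ∈ V k, (γ : G) * y = x := by
    intro k x
    simp only [hW, Set.mem_iUnion, Set.mem_image]
  refine ⟨⋃ k, V k \ ⋃ j, ⋃ (_ : j < k), W j, ?_, ?_, ?_⟩
  · exact MeasurableSet.iUnion fun k => (hVo k).measurableSet.diff
      (MeasurableSet.iUnion fun j => MeasurableSet.iUnion fun _ => (hWo j).measurableSet)
  · intro x
    classical
    have hex : ∃ k, x ∈ W k := by
      obtain ⟨k, hk⟩ := hcov x
      exact ⟨k, (hWmem _ _).2 ⟨1, x, hk, by simp⟩⟩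
    obtain ⟨γ, y, hy, hxy⟩ := (hWmem _ _).1 (Nat.find_spec hex)
    refine ⟨γ, y, Set.mem_iUnion.2 ⟨Nat.find hex, hy, ?_⟩, hxy.symm⟩
    simp only [Set.mem_iUnion, not_exists]
    intro j hj hyj
    obtain ⟨γ', z, hz, hzy⟩ := (hWmem _ _).1 hyj
    refine Nat.find_min hex hj ((hWmem _ _).2 ⟨γ * γ', z, hz, ?_⟩)
    rw [Subgroup.coe_mul, mul_assoc, hzy, hxy]
  · intro d₁ h₁ d₂ h₂ γ h
    obtain ⟨k, hk, hk'⟩ := Set.mem_iUnion.1 h₁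
    obtain ⟨l, hl, hl'⟩ := Set.mem_iUnion.1 h₂
    simp only [Set.mem_iUnion, not_exists] at hk' hl'
    rcases lt_trichotomy k l with hkl | rfl | hkl
    · exact absurd ((hWmem _ _).2 ⟨γ⁻¹, d₁, hk, by rw [h]; simp⟩) (hl' k hkl)
    · exact hVΛ k _ hk _ hl γ h
    · exact absurd ((hWmem _ _).2 ⟨γ, d₂, hl, h.symm⟩) (hk' l hkl)

lemma IsStrictDomain.isFundamentalDomain [MeasurableSpace G] [BorelSpace G] {Λ : Subgroup G}
    {D : Set G} (h : IsStrictDomain Λ D) (hD : MeasurableSet D) (μ : Measure G) :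
    IsFundamentalDomain Λ D μ where
  nullMeasurableSet := hD.nullMeasurableSet
  ae_covers := by
    refine Filter.Eventually.of_forall fun x => ?_
    obtain ⟨γ, d, hd, hx⟩ := h.1 x
    refine ⟨γ⁻¹, ?_⟩
    rw [Subgroup.smul_def, hx]
    simpa using hd
  aedisjoint := by
    intro γ γ' hne
    refine Disjoint.aedisjoint (Set.disjoint_left.2 ?_)
    rintro _ ⟨d, hd, rfl⟩ ⟨d', hd', hdd⟩
    simp only [Subgroup.smul_def, smul_eq_mul] at hdd
    have h1 : d' = ((γ'⁻¹ * γ : Λ) : G) * d := by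
      rw [Subgroup.coe_mul, mul_assoc, ← hdd]; simp
    have h2 := h.2 _ hd' _ hd _ h1
    rw [h2] at hdd
    exact hne (Subtype.ext (mul_right_cancel hdd)).symm

lemma IsStrictDomain.mul_right {Λ : Subgroup G} {D : Set G} (h : IsStrictDomain Λ D) (a : G) :
    IsStrictDomain Λ ((fun x => x * a) '' D) := by
  constructor
  · intro x
    obtain ⟨γ, d, hd, hx⟩ := h.1 (x * a⁻¹)
    exact ⟨γ, d * a, ⟨d, hd, rfl⟩, by rw [← mul_assoc, ← hx]; simp⟩
  · rintro _ ⟨x, hx, rfl⟩ _ ⟨y, hy, rfl⟩ γ hxy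
    simp only at hxy ⊢
    rw [← mul_assoc] at hxy
    rw [h.2 x hx y hy γ (mul_right_cancel hxy)]

lemma map_mul_right_eq_of_conj_inv [LocallyCompactSpace G] [MeasurableSpace G] [BorelSpace G]
    (μ : Measure G) [μ.IsHaarMeasure] {a h : G} (hah : h * a * h⁻¹ = a⁻¹) :
    μ.map (fun x => x * a) = μ := by
  have h1 : Measure.modularCharacter a = 1 := by
    have h2 := congrArg (Measure.modularCharacter (G := G)) hah
    rw [map_mul, map_mul, mul_right_comm, ← map_mul, mul_inv_cancel, map_one, one_mul] at h2
    have h3 : Measure.modularCharacter a * Measure.modularCharacter a = 1 := by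
      nth_rw 1 [h2]
      rw [← map_mul, inv_mul_cancel, map_one]
    have h4 : Measure.modularCharacter a ^ 2 = 1 := by rw [pow_two, h3]
    exact (pow_eq_one_iff_of_nonneg zero_le two_ne_zero).1 h4
  have h2 : Measure.haarScalarFactor (μ.map (fun x => x * a)) μ = 1 := by
    rw [← Measure.modularCharacterFun_eq_haarScalarFactor μ a]; exact h1
  have h3 := Measure.isMulLeftInvariant_eq_smul (μ.map (fun x => x * a)) μ
  rwa [h2, one_smul] at h3

lemma IsStrictDomain.setLIntegral_mul_right [MeasurableSpace G] [BorelSpace G] {Λ : Subgroup G}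
    [Countable Λ] {D : Set G} (h : IsStrictDomain Λ D) (hD : MeasurableSet D) {μ : Measure G}
    [μ.IsMulLeftInvariant] {a : G} (ha : μ.map (fun x => x * a) = μ) {k : G → ENNReal}
    (hk : ∀ γ ∈ Λ, ∀ x, k (γ * x) = k x) :
    ∫⁻ x in D, k (x * a) ∂μ = ∫⁻ x in D, k x ∂μ := by
  have hmp : MeasurePreserving (fun x => x * a) μ μ := ⟨measurable_mul_const a, ha⟩
  have hemb : MeasurableEmbedding fun x : G => x * a := measurableEmbedding_mulRight a
  rw [hmp.setLIntegral_comp_emb hemb]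
  refine ((h.mul_right a).isFundamentalDomain (hemb.measurableSet_image.2 hD) μ).setLIntegral_eq
    (h.isFundamentalDomain hD μ) _ fun γ x => ?_
  exact hk γ γ.2 x

lemma IsStrictDomain.measure_inter_lt_top [MeasurableSpace G] [BorelSpace G] {Λ : Subgroup G}
    [Countable Λ] {D : Set G} (h : IsStrictDomain Λ D) (hD : MeasurableSet D) {μ : Measure G}
    [μ.IsMulLeftInvariant] [IsFiniteMeasureOnCompacts μ] {C S : Set G} (hC : IsCompact C)
    (hS : ∀ x ∈ S, ∃ γ ∈ Λ, ∃ y ∈ C, x = γ * y) : μ (S ∩ D) < ⊤ := by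
  have h1 := (h.isFundamentalDomain hD μ).measure_eq_tsum C
  refine lt_of_le_of_lt ?_ (hC.measure_lt_top (μ := μ))
  rw [h1]
  refine le_trans (measure_mono ?_) (measure_iUnion_le _)
  rintro x ⟨hx, hxD⟩
  obtain ⟨γ, hγ, y, hy, rfl⟩ := hS x hx
  exact Set.mem_iUnion.2 ⟨⟨γ, hγ⟩, ⟨y, hy, rfl⟩, hxD⟩

theorem isLattice_of_lyapunov [LocallyCompactSpace G] [MeasurableSpace G] [BorelSpace G]
    (μ : Measure G) [μ.IsHaarMeasure] (Λ : Subgroup G) [hΛ : DiscreteTopology Λ]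
    {J : Type*} [Fintype J] [Nonempty J] (a : J → G) (ha : ∀ j, ∃ h, h * a j * h⁻¹ = (a j)⁻¹)
    {f : G → ℝ} (hf0 : ∀ x, 0 ≤ f x) (hf : Measurable f) (hfΛ : ∀ γ ∈ Λ, ∀ x, f (γ * x) = f x)
    {c b : ℝ} (hc : c < 1) (hb : 0 ≤ b)
    (hfa : ∀ x, ∑ j, f (x * a j) ≤ Fintype.card J * (c * f x + b))
    (hfC : ∀ R, ∃ C : Set G, IsCompact C ∧ ∀ x, f x ≤ R → ∃ γ ∈ Λ, ∃ y ∈ C, x = γ * y) :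
    IsLattice μ Λ := by
  obtain ⟨D, hD, hDΛ⟩ := exists_measurable_strictDomain Λ
  have hcount : Countable Λ := TopologicalSpace.separableSpace_iff_countable.1 inferInstance
  refine ⟨hΛ, D, hD, ?_, hDΛ.1, hDΛ.2⟩
  wlog hb' : 0 < b generalizing b
  · refine this (b := b + 1) (by linarith) (fun x => (hfa x).trans ?_) (by linarith)
    gcongr
    linarith
  have hfin : ∀ R, μ ({x | f x ≤ R} ∩ D) < ⊤ := fun R => by
    obtain ⟨C, hC, hfC⟩ := hfC R
    exact hDΛ.measure_inter_lt_top hD hC hfC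
  set R₀ := 2 * b / (1 - c) with hR₀
  set K := {x | f x ≤ R₀} with hK
  have hKm : MeasurableSet K := hf measurableSet_Iic
  have hJ : (Fintype.card J : ENNReal) ≠ 0 := by simp
  have hbound : ∀ R : ℝ, μ ({x | f x ≤ R} ∩ D) ≤ 2 * μ (K ∩ D) := by
    intro R
    set F := {x | f x ≤ R} with hF
    have hFm : MeasurableSet F := hf measurableSet_Iic
    set k : G → ENNReal := fun x => ENNReal.ofReal (R - f x) with hk
    have hkm : Measurable k := ENNReal.measurable_ofReal.comp (measurable_const.sub hf)
    have hpt : ∀ x, Fintype.card J * (k x + F.indicator (fun _ => ENNReal.ofReal b) x)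
        ≤ ∑ j, k (x * a j) + Fintype.card J * K.indicator (fun _ => ENNReal.ofReal (2 * b)) x := by
      intro x
      by_cases hxF : x ∈ F
      swap
      · have : k x = 0 := ENNReal.ofReal_of_nonpos (by simp [hF] at hxF; linarith)
        rw [Set.indicator_of_notMem hxF, this]; simp
      set w : ℝ := K.indicator (fun _ => 2 * b) x with hw
      have hw0 : 0 ≤ w := Set.indicator_nonneg (fun _ _ => by linarith) _
      have hwK : K.indicator (fun _ => ENNReal.ofReal (2 * b)) x = ENNReal.ofReal w := by
        by_cases hx : x ∈ K <;> simp [hw, hx]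
      have hw2 : 2 * b - w ≤ (1 - c) * f x := by
        by_cases hx : x ∈ K
        · simp only [hw, Set.indicator_of_mem hx]
          nlinarith [hf0 x]
        · simp only [hw, Set.indicator_of_notMem hx, sub_zero]
          simp only [hK, Set.mem_ofPred_eq, not_le, hR₀] at hx
          rw [div_lt_iff₀ (by linarith)] at hx
          linarith
      rw [hwK, Set.indicator_of_mem hxF]
      simp only [hk]
      have hRf : 0 ≤ R - f x := sub_nonneg.2 hxF
      rw [← ENNReal.ofReal_add hRf hb, ← ENNReal.ofReal_natCast,
        ← ENNReal.ofReal_mul (Nat.cast_nonneg _), ← ENNReal.ofReal_mul (Nat.cast_nonneg _)]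
      have h1 : ENNReal.ofReal (∑ j, (R - f (x * a j))) ≤ ∑ j, ENNReal.ofReal (R - f (x * a j)) := by
        refine (ENNReal.ofReal_le_ofReal (Finset.sum_le_sum fun j _ => le_max_left _ 0)).trans ?_
        rw [ENNReal.ofReal_sum_of_nonneg fun j _ => le_max_right _ _]
        refine Finset.sum_le_sum fun j _ => ?_
        rcases le_total (R - f (x * a j)) 0 with h | h <;> simp [h]
      refine le_trans ?_ (add_le_add h1 le_rfl)
      refine le_trans ?_ ENNReal.ofReal_add_le
      refine ENNReal.ofReal_le_ofReal ?_
      rw [Finset.sum_sub_distrib]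
      simp only [Finset.sum_const, Finset.card_univ, nsmul_eq_mul]
      have h2 := hfa x
      have h3 : (0 : ℝ) ≤ Fintype.card J := Nat.cast_nonneg _
      nlinarith [mul_le_mul_of_nonneg_left hw2 h3]
    have hint := lintegral_mono (μ := μ.restrict D) hpt
    rw [lintegral_const_mul _ (by fun_prop (disch := assumption)), lintegral_add_left hkm,
      lintegral_add_left (by fun_prop), lintegral_const_mul _ (by fun_prop (disch := assumption)),
      lintegral_finsetSum _ (fun j _ => by fun_prop)] at hint
    have hmj : ∀ j, ∫⁻ x in D, k (x * a j) ∂μ = ∫⁻ x in D, k x ∂μ := by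
      intro j
      obtain ⟨h, hh⟩ := ha j
      exact hDΛ.setLIntegral_mul_right hD (map_mul_right_eq_of_conj_inv μ hh)
        fun γ hγ x => by simp only [hk, hfΛ γ hγ x]
    simp only [hmj, Finset.sum_const, Finset.card_univ, nsmul_eq_mul] at hint
    rw [← mul_add, ENNReal.mul_le_mul_iff_right hJ (ENNReal.natCast_ne_top _)] at hint
    have hkfin : ∫⁻ x in D, k x ∂μ ≠ ⊤ := by
      refine ne_top_of_le_ne_top (b := ENNReal.ofReal R * μ (F ∩ D))
        (ENNReal.mul_ne_top ENNReal.ofReal_ne_top (hfin R).ne) ?_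
      rw [← Measure.restrict_apply hFm, ← lintegral_indicator_const hFm]
      refine lintegral_mono fun x => ?_
      by_cases hx : x ∈ F
      · rw [Set.indicator_of_mem hx]
        exact ENNReal.ofReal_le_ofReal (by linarith [hf0 x])
      · rw [Set.indicator_of_notMem hx]
        exact (ENNReal.ofReal_of_nonpos (by simp [hF] at hx; linarith)).le
    rw [ENNReal.add_le_add_iff_left hkfin, lintegral_indicator_const hFm,
      lintegral_indicator_const hKm, Measure.restrict_apply hFm, Measure.restrict_apply hKm,
      mul_comm 2 b, ENNReal.ofReal_mul hb, mul_assoc,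
      ENNReal.mul_le_mul_iff_right (by simpa using hb') ENNReal.ofReal_ne_top] at hint
    simpa using hint
  have hUn : D = ⋃ N : ℕ, {x | f x ≤ N} ∩ D := by
    ext x
    simp only [Set.mem_iUnion, Set.mem_inter_iff, Set.mem_ofPred_eq, exists_and_right]
    exact ⟨fun h => ⟨exists_nat_ge _, h⟩, fun h => h.2⟩
  have hmono : Monotone fun N : ℕ => {x | f x ≤ N} ∩ D := fun i j hij =>
    Set.inter_subset_inter_left _ fun x (hx : f x ≤ i) => hx.trans (by exact_mod_cast hij)
  rw [hUn, hmono.measure_iUnion]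
  exact lt_of_le_of_lt (iSup_le fun N => hbound N) (ENNReal.mul_lt_top (by simp) (hfin R₀))

end LatticeCriterion

section SOQBasics

lemma eq_of_forall_qf_eq {ι : Type*} [Fintype ι] [DecidableEq ι] {S S' : Matrix ι ι ℝ}
    (hS : Sᵀ = S) (hS' : S'ᵀ = S') (h : ∀ x, qf S x = qf S' x) : S = S' := by
  have hb : ∀ T : Matrix ι ι ℝ, Tᵀ = T → ∀ i j,
      2 * T i j = qf T (Pi.single i 1 + Pi.single j 1) - qf T (Pi.single i 1)
        - qf T (Pi.single j 1) := by
    intro T hT i j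
    have : T j i = T i j := congrFun (congrFun hT i) j
    simp only [qf, mulVec_add, dotProduct_add, add_dotProduct, mulVec_single_one,
      single_one_dotProduct, col_apply]
    linarith
  ext i j
  linarith [hb S hS i j, hb S' hS' i j, h (Pi.single i 1 + Pi.single j 1), h (Pi.single i 1),
    h (Pi.single j 1)]

variable (n m : ℕ)

/-- The signs of the diagonal form `Qform n m`. -/
def sgnQ : Fin (n + m) ⊕ Fin (n + m) → ℝ :=
  Sum.elim (fun i => if (i : ℕ) < n then 1 else -1) fun _ => -1

/-- The coordinates on which `Qform n m` is positive. -/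
def IsPosIdx (a : Fin (n + m) ⊕ Fin (n + m)) : Prop := sgnQ n m a = 1

noncomputable instance : DecidablePred (IsPosIdx n m) := fun _ => Classical.dec _

/-- The Gram matrix of `Qform n m`. -/
def JQ : Matrix (Fin (n + m) ⊕ Fin (n + m)) (Fin (n + m) ⊕ Fin (n + m)) ℝ := diagonal (sgnQ n m)

lemma Qform_eq_qf (x : Fin (n + m) ⊕ Fin (n + m) → ℝ) : Qform n m x = qf (JQ n m) x := by
  simp only [Qform, qf, JQ, dotProduct, mulVec_diagonal, Fintype.sum_sum_type, sgnQ, Sum.elim_inl,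
    Sum.elim_inr]
  rw [sub_eq_add_neg, ← Finset.sum_neg_distrib]
  congr 1 <;> exact Finset.sum_congr rfl fun i _ => by ring

lemma sgnQ_eq_or (a : Fin (n + m) ⊕ Fin (n + m)) : sgnQ n m a = 1 ∨ sgnQ n m a = -1 := by
  rcases a with i | i <;> simp only [sgnQ, Sum.elim_inl, Sum.elim_inr]
  · split_ifs <;> simp
  · simp

lemma sgnQ_mul_self (a : Fin (n + m) ⊕ Fin (n + m)) : sgnQ n m a * sgnQ n m a = 1 := by
  rcases sgnQ_eq_or n m a with h | h <;> rw [h] <;> norm_num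

lemma JQ_mul_self : JQ n m * JQ n m = 1 := by
  rw [JQ, diagonal_mul_diagonal]
  simp only [sgnQ_mul_self]
  exact diagonal_one

lemma JQ_transpose : (JQ n m)ᵀ = JQ n m := diagonal_transpose _

variable {n m}

lemma mem_SOQgrp_iff {A : GL (Fin (n + m) ⊕ Fin (n + m)) ℝ} :
    A ∈ SOQgrp n m ↔ A.val.det = 1 ∧ A.valᵀ * JQ n m * A.val = JQ n m := by
  change (_ ∧ _) ↔ _
  refine and_congr_right fun _ => ⟨fun h => ?_, fun h x => ?_⟩
  · refine eq_of_forall_qf_eq ?_ (JQ_transpose n m) fun x => ?_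
    · simp only [transpose_mul, transpose_transpose, JQ_transpose, Matrix.mul_assoc]
    · rw [qf_congr, ← Qform_eq_qf, ← Qform_eq_qf, h]
  · rw [Qform_eq_qf, Qform_eq_qf, ← qf_congr, h]

lemma SOQgrp.det_eq_one (g : SOQgrp n m) : g.val.val.det = 1 := (mem_SOQgrp_iff.1 g.2).1

lemma SOQgrp.congr_eq (g : SOQgrp n m) : g.val.valᵀ * JQ n m * g.val.val = JQ n m :=
  (mem_SOQgrp_iff.1 g.2).2

lemma JQ_mul_transpose_mul_JQ_mul {M : Matrix (Fin (n + m) ⊕ Fin (n + m)) (Fin (n + m) ⊕ Fin (n + m)) ℝ}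
    (h : Mᵀ * JQ n m * M = JQ n m) : JQ n m * Mᵀ * JQ n m * M = 1 := by
  rw [Matrix.mul_assoc (JQ n m), Matrix.mul_assoc (JQ n m), h, JQ_mul_self]

/-- The element of `SO(Q)` with a given matrix. -/
def SOQgrp.mk (M : Matrix (Fin (n + m) ⊕ Fin (n + m)) (Fin (n + m) ⊕ Fin (n + m)) ℝ)
    (hd : M.det = 1) (h : Mᵀ * JQ n m * M = JQ n m) : SOQgrp n m :=
  ⟨⟨M, JQ n m * Mᵀ * JQ n m, mul_eq_one_comm.1 (JQ_mul_transpose_mul_JQ_mul h),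
    JQ_mul_transpose_mul_JQ_mul h⟩, mem_SOQgrp_iff.2 ⟨hd, h⟩⟩

lemma SOQgrp.ext {g h : SOQgrp n m} (H : g.val.val = h.val.val) : g = h :=
  Subtype.ext (Units.ext H)

lemma SOQgrp.val_mul (g h : SOQgrp n m) : (g * h).val.val = g.val.val * h.val.val := rfl

lemma SOQgrp.val_one : (1 : SOQgrp n m).val.val = 1 := rfl

lemma SOQgrp.val_inv_mul (g : SOQgrp n m) : g⁻¹.val.val * g.val.val = 1 := by
  rw [← SOQgrp.val_mul, inv_mul_cancel, SOQgrp.val_one]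

lemma SOQgrp.continuous_val : Continuous fun g : SOQgrp n m => g.val.val :=
  Units.continuous_val.comp continuous_subtype_val

/-- `SO(Q)` is homeomorphic to a set of matrices. -/
def SOQgrp.homeo : SOQgrp n m ≃ₜ
    {M : Matrix (Fin (n + m) ⊕ Fin (n + m)) (Fin (n + m) ⊕ Fin (n + m)) ℝ //
      M.det = 1 ∧ Mᵀ * JQ n m * M = JQ n m} where
  toFun g := ⟨g.val.val, SOQgrp.det_eq_one g, SOQgrp.congr_eq g⟩
  invFun M := SOQgrp.mk M.1 M.2.1 M.2.2
  left_inv _ := SOQgrp.ext rfl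
  right_inv _ := rfl
  continuous_toFun := SOQgrp.continuous_val.subtype_mk _
  continuous_invFun := by
    refine Continuous.subtype_mk (Units.continuous_iff.2 ⟨continuous_subtype_val, ?_⟩) _
    change Continuous fun M : {M : Matrix (Fin (n + m) ⊕ Fin (n + m)) (Fin (n + m) ⊕ Fin (n + m)) ℝ //
      M.det = 1 ∧ Mᵀ * JQ n m * M = JQ n m} => JQ n m * M.1ᵀ * JQ n m
    have := continuous_subtype_val (p := fun M : Matrix (Fin (n + m) ⊕ Fin (n + m)) (Fin (n + m) ⊕ Fin (n + m)) ℝ =>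
      M.det = 1 ∧ Mᵀ * JQ n m * M = JQ n m)
    fun_prop

lemma SOQgrp.isClosedEmbedding_val :
    Topology.IsClosedEmbedding fun g : SOQgrp n m => g.val.val := by
  have hc : IsClosed {M : Matrix (Fin (n + m) ⊕ Fin (n + m)) (Fin (n + m) ⊕ Fin (n + m)) ℝ |
      M.det = 1 ∧ Mᵀ * JQ n m * M = JQ n m} :=
    (isClosed_eq (by fun_prop) continuous_const).inter (isClosed_eq (by fun_prop) continuous_const)
  exact hc.isClosedEmbedding_subtypeVal.comp SOQgrp.homeo.isClosedEmbedding

instance : LocallyCompactSpace (SOQgrp n m) := by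
  have : LocallyCompactSpace (Matrix (Fin (n + m) ⊕ Fin (n + m)) (Fin (n + m) ⊕ Fin (n + m)) ℝ) :=
    inferInstanceAs (LocallyCompactSpace (Fin (n + m) ⊕ Fin (n + m) → Fin (n + m) ⊕ Fin (n + m) → ℝ))
  exact SOQgrp.isClosedEmbedding_val.locallyCompactSpace

instance : SecondCountableTopology (SOQgrp n m) := by
  have : SecondCountableTopology (Matrix (Fin (n + m) ⊕ Fin (n + m)) (Fin (n + m) ⊕ Fin (n + m)) ℝ) :=
    inferInstanceAs (SecondCountableTopology (Fin (n + m) ⊕ Fin (n + m) → Fin (n + m) ⊕ Fin (n + m) → ℝ))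
  exact SOQgrp.isClosedEmbedding_val.isEmbedding.secondCountableTopology

lemma SOQgrp.isCompact_entries_le {A : Matrix (Fin (n + m) ⊕ Fin (n + m)) (Fin (n + m) ⊕ Fin (n + m)) ℝ}
    (hA : A.det ≠ 0) (R : ℝ) :
    IsCompact {g : SOQgrp n m | ∀ i j, |(g.val.val * A) i j| ≤ R} := by
  have h1 : IsCompact {X : Matrix (Fin (n + m) ⊕ Fin (n + m)) (Fin (n + m) ⊕ Fin (n + m)) ℝ |
      ∀ i j, |X i j| ≤ R} := by
    have h0 : IsCompact {X : Fin (n + m) ⊕ Fin (n + m) → Fin (n + m) ⊕ Fin (n + m) → ℝ |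
        ∀ i j, |X i j| ≤ R} := by
      have := isCompact_univ_pi fun _ : Fin (n + m) ⊕ Fin (n + m) =>
        isCompact_univ_pi fun _ : Fin (n + m) ⊕ Fin (n + m) => isCompact_Icc (a := -R) (b := R)
      refine this.of_isClosed_subset ?_ fun X hX i _ j _ => abs_le.1 (hX i j)
      simp only [Set.ofPred_forall]
      exact isClosed_iInter fun i => isClosed_iInter fun j =>
        isClosed_le (by fun_prop) continuous_const
    exact h0
  have h2 := SOQgrp.isClosedEmbedding_val.isCompact_preimage
    (h1.image (f := fun X => X * A⁻¹) (by fun_prop))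
  suffices heq : {g : SOQgrp n m | ∀ i j, |(g.val.val * A) i j| ≤ R}
      = (fun g : SOQgrp n m => g.val.val) ⁻¹' ((fun X => X * A⁻¹) '' {X | ∀ i j, |X i j| ≤ R}) by
    rw [heq]; exact h2
  ext g
  constructor
  · exact fun hg => ⟨g.val.val * A, hg, by
      simp only; rw [Matrix.mul_assoc, mul_nonsing_inv A (isUnit_iff_ne_zero.2 hA), Matrix.mul_one]⟩
  · rintro ⟨X, hX, hg⟩ i j
    simp only at hg
    rw [← hg, Matrix.mul_assoc, nonsing_inv_mul A (isUnit_iff_ne_zero.2 hA), Matrix.mul_one]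
    exact hX i j

end SOQBasics

section Reduction

variable {ι : Type} [Fintype ι] [DecidableEq ι]

lemma exists_bounded_unimodular [Nonempty ι] (g₀ : Matrix ι ι ℝ) (hg₀ : g₀.det ≠ 0) {ε : ℝ}
    (hε : 0 < ε) :
    ∃ R : ℝ, 0 ≤ R ∧ ∀ g : Matrix ι ι ℝ, g.det = 1 →
      (∀ z : ι → ℤ, z ≠ 0 → ε ≤ qf ((g * g₀)ᵀ * (g * g₀)) (castVec z)) →
      ∃ U : Matrix ι ι ℤ, U.det = 1 ∧ ∀ i j, |(g * g₀ * intReal U) i j| ≤ R := by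
  obtain ⟨R, hR⟩ := exists_mahler_bound (Fintype.card ι) ε hε (g₀.det ^ 2)
  refine ⟨√R, Real.sqrt_nonneg R, fun g hg hz => ?_⟩
  have hd : (g * g₀).det = g₀.det := by rw [det_mul, hg, one_mul]
  obtain ⟨U, hU, hUR⟩ := hR ι rfl ((g * g₀)ᵀ * (g * g₀))
    (posDef_of_gramDet_ne_zero (by
      rw [gramDet, det_mul, det_transpose, hd]; exact mul_ne_zero hg₀ hg₀)) hz
    (by rw [det_mul, det_transpose, hd, pow_two])
  have hb : ∀ i j, |(g * g₀ * intReal U) i j| ≤ √R := by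
    intro i j
    have h1 := hUR j
    rw [qf_transpose_mul_self, mulVec_mulVec] at h1
    have h2 := abs_le_sqrt_dotProduct ((g * g₀ * intReal U) *ᵥ Pi.single j 1) i
    rw [mulVec_single_one] at h1 h2
    exact h2.trans (Real.sqrt_le_sqrt h1)
  rcases sq_eq_sq_iff_eq_or_eq_neg.1 (hU.trans (one_pow 2).symm) with h | h
  · exact ⟨U, h, hb⟩
  · obtain ⟨i₀⟩ := ‹Nonempty ι›
    set D : ι → ℤ := Function.update 1 i₀ (-1) with hD
    refine ⟨U * diagonal D, ?_, fun i j => ?_⟩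
    · rw [det_mul, h, det_diagonal, hD, Finset.prod_update_of_mem (Finset.mem_univ _)]
      simp
    · have h1 : intReal (diagonal D) = diagonal fun i => (D i : ℝ) := by
        ext a b; by_cases hab : a = b <;> simp [intReal, diagonal, hab]
      rw [intReal_mul, ← Matrix.mul_assoc, h1, mul_diagonal, abs_mul]
      have h2 : |(D j : ℝ)| = 1 := by
        by_cases hj : j = i₀ <;> simp [hD, hj]
      rw [h2, mul_one]
      exact hb i j

lemma exists_finite_representatives {α β : Type*} (P : α → Prop) (key : α → β)
    (h : (key '' {a | P a}).Finite) :
    ∃ T : Set α, T.Finite ∧ (∀ a ∈ T, P a) ∧ ∀ a, P a → ∃ a' ∈ T, key a' = key a := by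
  have hex : ∀ κ : key '' {a | P a}, ∃ a, P a ∧ key a = κ := fun ⟨κ, a, ha, hk⟩ => ⟨a, ha, hk⟩
  choose r hrP hr using hex
  have := h.to_subtype
  exact ⟨Set.range r, Set.finite_range r, by rintro _ ⟨κ, rfl⟩; exact hrP κ,
    fun a ha => ⟨r ⟨key a, a, ha, rfl⟩, ⟨_, rfl⟩, hr _⟩⟩

lemma abs_congr_apply_le {X J : Matrix ι ι ℝ} {R : ℝ} (hR : 0 ≤ R) (h : ∀ i j, |X i j| ≤ R)
    (i j : ι) : |(Xᵀ * J * X) i j| ≤ ∑ k, ∑ l, R * |J l k| * R := by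
  rw [Matrix.mul_apply]
  refine (Finset.abs_sum_le_sum_abs _ _).trans (Finset.sum_le_sum fun k _ => ?_)
  rw [Matrix.mul_apply, Finset.sum_mul]
  refine (Finset.abs_sum_le_sum_abs _ _).trans (Finset.sum_le_sum fun l _ => ?_)
  rw [abs_mul, abs_mul, transpose_apply]
  have := h l i
  have := h k j
  gcongr

/-- Finiteness of the number of reduced forms in a fixed integral class. -/
theorem exists_finite_reduction [Nonempty ι] {τ : Type} [Fintype τ] [DecidableEq τ]
    (Jf : τ → Matrix ι ι ℝ) (Sf : τ → Matrix ι ι ℤ) (g₀ : Matrix ι ι ℝ) (hg₀ : g₀.det ≠ 0)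
    (hS : ∀ t, g₀ᵀ * Jf t * g₀ = intReal (Sf t)) {ε : ℝ} (hε : 0 < ε) :
    ∃ T : Set (Matrix ι ι ℤ), T.Finite ∧ (∀ U ∈ T, U.det = 1) ∧ ∃ R : ℝ, ∀ g : Matrix ι ι ℝ,
      g.det = 1 → (∀ t, gᵀ * Jf t * g = Jf t) →
      (∀ z : ι → ℤ, z ≠ 0 → ε ≤ qf ((g * g₀)ᵀ * (g * g₀)) (castVec z)) →
      ∃ U ∈ T, ∃ V : Matrix ι ι ℤ, V.det = 1 ∧ (∀ t, Vᵀ * Sf t * V = Sf t) ∧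
        ∀ i j, |(g * g₀ * intReal V * intReal U) i j| ≤ R := by
  obtain ⟨R, hR0, hR⟩ := exists_bounded_unimodular g₀ hg₀ hε
  set P : Matrix ι ι ℤ → Prop := fun U => U.det = 1 ∧ ∃ g : Matrix ι ι ℝ,
    (∀ t, gᵀ * Jf t * g = Jf t) ∧ ∀ i j, |(g * g₀ * intReal U) i j| ≤ R with hP
  set key : Matrix ι ι ℤ → (τ → ι → ι → ℤ) := fun U t => Uᵀ * Sf t * U with hkey
  have hkeyR : ∀ (U : Matrix ι ι ℤ) (g : Matrix ι ι ℝ) (t : τ), gᵀ * Jf t * g = Jf t →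
      intReal (Uᵀ * Sf t * U) = (g * g₀ * intReal U)ᵀ * Jf t * (g * g₀ * intReal U) := by
    intro U g t hg
    rw [intReal_mul, intReal_mul, ← hS, ← hg, intReal_transpose]
    simp only [transpose_mul, Matrix.mul_assoc]
    have hg' : gᵀ * (Jf t * g) = Jf t := by rw [← Matrix.mul_assoc, hg]
    have : ∀ Y : Matrix ι ι ℝ, gᵀ * (Jf t * (g * Y)) = Jf t * Y := fun Y => by
      rw [← Matrix.mul_assoc (Jf t), ← Matrix.mul_assoc gᵀ, hg']
    simp only [this]
  set B : ℤ := ∑ t, ⌈∑ k, ∑ l, R * |Jf t l k| * R⌉ with hB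
  have hfin : (key '' {U | P U}).Finite := by
    refine (Set.finite_Icc (fun _ _ _ => -B : τ → ι → ι → ℤ) (fun _ _ _ => B)).subset ?_
    rintro _ ⟨U, ⟨hU, g, hg, hgU⟩, rfl⟩
    have hb : ∀ t i j, |key U t i j| ≤ B := by
      intro t i j
      have h1 := abs_congr_apply_le (J := Jf t) hR0 hgU i j
      rw [← hkeyR U g t (hg t), intReal_apply] at h1
      have h2 : |key U t i j| ≤ ⌈∑ k, ∑ l, R * |Jf t l k| * R⌉ := by
        have h3 := h1.trans (Int.le_ceil _)
        exact_mod_cast h3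
      refine h2.trans (Finset.single_le_sum (f := fun t => ⌈∑ k, ∑ l, R * |Jf t l k| * R⌉)
        (fun t _ => Int.ceil_nonneg ?_) (Finset.mem_univ t))
      positivity
    exact ⟨fun t i j => (abs_le.1 (hb t i j)).1, fun t i j => (abs_le.1 (hb t i j)).2⟩
  obtain ⟨T, hT, hTP, hTkey⟩ := exists_finite_representatives P key hfin
  refine ⟨T, hT, fun U hU => (hTP U hU).1, R, fun g hg hgJ hz => ?_⟩
  obtain ⟨U, hU, hUR⟩ := hR g hg hz
  obtain ⟨U', hU', hk⟩ := hTkey U ⟨hU, g, hgJ, hUR⟩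
  have hd := (hTP U' hU').1
  have hinv : U' * U'.adjugate = 1 := by rw [mul_adjugate, hd, one_smul]
  have hinv' : U'.adjugate * U' = 1 := by rw [adjugate_mul, hd, one_smul]
  refine ⟨U', hU', U * U'.adjugate, ?_, fun t => ?_, fun i j => ?_⟩
  · have := congrArg Matrix.det hinv
    rw [det_mul, hd, one_mul, det_one] at this
    rw [det_mul, hU, this, one_mul]
  · have h1 : U'ᵀ * Sf t * U' = Uᵀ * Sf t * U := congrFun hk t
    have h2 : U'.adjugateᵀ * U'ᵀ = 1 := by rw [← transpose_mul, hinv, transpose_one]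
    calc (U * U'.adjugate)ᵀ * Sf t * (U * U'.adjugate)
        = U'.adjugateᵀ * (Uᵀ * Sf t * U) * U'.adjugate := by
          rw [transpose_mul]; simp only [Matrix.mul_assoc]
      _ = (U'.adjugateᵀ * U'ᵀ) * Sf t * (U' * U'.adjugate) := by
          rw [← h1]; simp only [Matrix.mul_assoc]
      _ = Sf t := by rw [h2, hinv, Matrix.one_mul, Matrix.mul_one]
  · rw [Matrix.mul_assoc, ← intReal_mul, Matrix.mul_assoc U, hinv', Matrix.mul_one]
    exact hUR i j

end Reduction

section IntegralModel

variable (n m : ℕ)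

/-- Column weights of the integral model. -/
noncomputable def wtQ (i : Fin (n + m)) : ℝ := if (i : ℕ) < n then √(√2) else 1

/-- The base change identifying `Qform n m` with an integral form. -/
noncomputable def gQ : Matrix (Fin (n + m) ⊕ Fin (n + m)) (Fin (n + m) ⊕ Fin (n + m)) ℝ :=
  fromBlocks (diagonal (wtQ n m)) (diagonal fun i => √2 * wtQ n m i)
    (diagonal (wtQ n m)) (diagonal fun i => -(√2 * wtQ n m i))

/-- A second diagonal form, proportional on each summand to `Qform n m`. -/
noncomputable def JQ' : Matrix (Fin (n + m) ⊕ Fin (n + m)) (Fin (n + m) ⊕ Fin (n + m)) ℝ :=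
  diagonal (Sum.elim (fun i => √2 * sgnQ n m (Sum.inl i)) fun _ => √2)

/-- The integral Gram matrix of `JQ` in the basis `gQ`. -/
def SQ : Matrix (Fin (n + m) ⊕ Fin (n + m)) (Fin (n + m) ⊕ Fin (n + m)) ℤ :=
  fromBlocks (diagonal fun i : Fin (n + m) => if (i : ℕ) < n then 0 else -2)
    (diagonal fun i : Fin (n + m) => if (i : ℕ) < n then 4 else 0)
    (diagonal fun i : Fin (n + m) => if (i : ℕ) < n then 4 else 0)
    (diagonal fun i : Fin (n + m) => if (i : ℕ) < n then 0 else -4)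

/-- The integral Gram matrix of `JQ'` in the basis `gQ`. -/
def SQ' : Matrix (Fin (n + m) ⊕ Fin (n + m)) (Fin (n + m) ⊕ Fin (n + m)) ℤ :=
  fromBlocks (diagonal fun i : Fin (n + m) => if (i : ℕ) < n then 4 else 0)
    (diagonal fun i : Fin (n + m) => if (i : ℕ) < n then 0 else -4)
    (diagonal fun i : Fin (n + m) => if (i : ℕ) < n then 0 else -4)
    (diagonal fun i : Fin (n + m) => if (i : ℕ) < n then 8 else 0)

variable {n m}

lemma wtQ_pos (i : Fin (n + m)) : 0 < wtQ n m i := by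
  unfold wtQ; split_ifs <;> positivity

lemma wtQ_mul_self (i : Fin (n + m)) : wtQ n m i * wtQ n m i = if (i : ℕ) < n then √2 else 1 := by
  unfold wtQ; split_ifs
  · exact Real.mul_self_sqrt (Real.sqrt_nonneg 2)
  · norm_num

lemma det_gQ_ne_zero : (gQ n m).det ≠ 0 := by
  have h : gQ n m * fromBlocks (diagonal fun i => 1 / (2 * wtQ n m i))
      (diagonal fun i => 1 / (2 * wtQ n m i)) (diagonal fun i => 1 / (2 * √2 * wtQ n m i))
      (diagonal fun i => -(1 / (2 * √2 * wtQ n m i))) = 1 := by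
    rw [gQ, fromBlocks_multiply]
    simp only [diagonal_mul_diagonal, diagonal_add]
    rw [← fromBlocks_one, ← diagonal_zero, ← diagonal_one]
    have hw := fun i => (wtQ_pos (n := n) (m := m) i).ne'
    congr 2 <;> ext i <;> have := hw i <;> field_simp <;> norm_num
  intro h0
  have := congrArg Matrix.det h
  rw [det_mul, h0, zero_mul, det_one] at this
  exact zero_ne_one this

lemma diagonal_sumElim (a b : Fin (n + m) → ℝ) :
    diagonal (Sum.elim a b) = fromBlocks (diagonal a) 0 0 (diagonal b) :=
  (fromBlocks_diagonal a b).symm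

lemma gQ_congr_JQ : (gQ n m)ᵀ * JQ n m * gQ n m = intReal (SQ n m) := by
  have h : JQ n m = fromBlocks (diagonal fun i => sgnQ n m (Sum.inl i)) 0 0 (diagonal fun _ => -1) := by
    rw [← diagonal_sumElim, JQ]; congr 1
  rw [h, gQ, fromBlocks_transpose, fromBlocks_multiply, fromBlocks_multiply, intReal, SQ,
    fromBlocks_map]
  simp only [diagonal_transpose, diagonal_mul_diagonal, diagonal_add, Matrix.mul_zero,
    add_zero, zero_add]
  have h2 : √2 * √2 = 2 := Real.mul_self_sqrt (by norm_num)
  congr 1 <;> rw [diagonal_map (by simp)] <;> congr 1 <;> ext i <;>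
    have hw := wtQ_mul_self (n := n) (m := m) i <;>
    by_cases hi : (i : ℕ) < n <;> simp only [hi, if_true, if_false, sgnQ, Sum.elim_inl] at hw ⊢ <;>
    norm_num <;> grind

lemma gQ_congr_JQ' : (gQ n m)ᵀ * JQ' n m * gQ n m = intReal (SQ' n m) := by
  rw [JQ', diagonal_sumElim, gQ, fromBlocks_transpose, fromBlocks_multiply, fromBlocks_multiply,
    intReal, SQ', fromBlocks_map]
  simp only [diagonal_transpose, diagonal_mul_diagonal, diagonal_add, Matrix.mul_zero,
    add_zero, zero_add]
  have h2 : √2 * √2 = 2 := Real.mul_self_sqrt (by norm_num)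
  congr 1 <;> rw [diagonal_map (by simp)] <;> congr 1 <;> ext i <;>
    have hw := wtQ_mul_self (n := n) (m := m) i <;>
    by_cases hi : (i : ℕ) < n <;> simp only [hi, if_true, if_false, sgnQ, Sum.elim_inl] at hw ⊢ <;>
    norm_num <;> grind

lemma gQ_mulVec_inr (x : Fin (n + m) ⊕ Fin (n + m) → ℝ) (i : Fin (n + m)) :
    (gQ n m *ᵥ x) (Sum.inr i) = wtQ n m i * (x (Sum.inl i) - √2 * x (Sum.inr i)) := by
  rw [gQ, fromBlocks_mulVec]
  simp only [Sum.elim_inr, Pi.add_apply, mulVec_diagonal, Function.comp]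
  ring

lemma qf_diagonal {ι : Type*} [Fintype ι] [DecidableEq ι] (d x : ι → ℝ) :
    qf (diagonal d) x = ∑ i, d i * x i ^ 2 := by
  simp only [qf, dotProduct, mulVec_diagonal]
  exact Finset.sum_congr rfl fun i _ => by ring

lemma abs_qf_diagonal_le {ι : Type*} [Fintype ι] [DecidableEq ι] {d : ι → ℝ} {C : ℝ}
    (h : ∀ i, |d i| ≤ C) (x : ι → ℝ) : |qf (diagonal d) x| ≤ C * (x ⬝ᵥ x) := by
  rw [qf_diagonal, dotProduct, Finset.mul_sum]
  refine (Finset.abs_sum_le_sum_abs _ _).trans (Finset.sum_le_sum fun i _ => ?_)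
  rw [abs_mul, abs_pow, sq_abs, pow_two]
  exact mul_le_mul_of_nonneg_right (h i) (mul_self_nonneg _)

lemma exists_int_qf_intReal {ι : Type*} [Fintype ι] [DecidableEq ι] (S : Matrix ι ι ℤ) (z : ι → ℤ) :
    ∃ a : ℤ, qf (intReal S) (castVec z) = a := by
  refine ⟨z ⬝ᵥ S *ᵥ z, ?_⟩
  rw [qf, ← castVec_mulVec]
  simp [dotProduct]

lemma half_le_qf_of_preserves
    {h : Matrix (Fin (n + m) ⊕ Fin (n + m)) (Fin (n + m) ⊕ Fin (n + m)) ℝ}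
    (hJ : hᵀ * JQ n m * h = JQ n m) (hJ' : hᵀ * JQ' n m * h = JQ' n m)
    {z : Fin (n + m) ⊕ Fin (n + m) → ℤ} (hz : z ≠ 0) :
    1 / 2 ≤ qf ((h * gQ n m)ᵀ * (h * gQ n m)) (castVec z) := by
  by_contra! hlt
  rw [qf_transpose_mul_self, ← mulVec_mulVec] at hlt
  set x := gQ n m *ᵥ castVec z with hx
  have s2 : 0 < √2 := by positivity
  have h2 : √2 * √2 = 2 := Real.mul_self_sqrt (by norm_num)
  have s2' : √2 < 2 := by nlinarith
  obtain ⟨a, ha⟩ := exists_int_qf_intReal (SQ n m) z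
  obtain ⟨b, hb⟩ := exists_int_qf_intReal (SQ' n m) z
  rw [← gQ_congr_JQ, qf_congr, ← hx] at ha
  rw [← gQ_congr_JQ', qf_congr, ← hx] at hb
  have ha1 : |qf (JQ n m) x| ≤ 1 * (h *ᵥ x ⬝ᵥ h *ᵥ x) := by
    rw [← hJ, qf_congr]
    refine abs_qf_diagonal_le (fun i => ?_) _
    rcases sgnQ_eq_or n m i with h | h <;> rw [h] <;> norm_num
  have hb1 : |qf (JQ' n m) x| ≤ √2 * (h *ᵥ x ⬝ᵥ h *ᵥ x) := by
    rw [← hJ', qf_congr]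
    refine abs_qf_diagonal_le (fun i => ?_) _
    rcases i with i | i
    · simp only [Sum.elim_inl, abs_mul, abs_of_pos s2]
      rcases sgnQ_eq_or n m (Sum.inl i) with h | h <;> rw [h] <;> norm_num
    · simp [abs_of_pos s2]
  have ha0 : a = 0 := by
    rw [ha] at ha1
    have : |(a : ℝ)| < 1 := by linarith
    exact Int.abs_lt_one_iff.1 (by exact_mod_cast this)
  have hb0 : b = 0 := by
    rw [hb] at hb1
    have : |(b : ℝ)| < 1 := by nlinarith
    exact Int.abs_lt_one_iff.1 (by exact_mod_cast this)
  rw [ha0, Int.cast_zero, JQ, qf_diagonal, Fintype.sum_sum_type] at ha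
  rw [hb0, Int.cast_zero, JQ', qf_diagonal, Fintype.sum_sum_type] at hb
  simp only [Sum.elim_inl, Sum.elim_inr, mul_assoc, ← Finset.mul_sum] at hb
  have e : ∑ i, sgnQ n m (Sum.inr i) * x (Sum.inr i) ^ 2 = -∑ i, x (Sum.inr i) ^ 2 := by
    rw [← Finset.sum_neg_distrib]
    exact Finset.sum_congr rfl fun i _ => by simp [sgnQ]
  rw [e] at ha
  have hsum : ∑ i, x (Sum.inr i) ^ 2 = 0 := by
    rw [← mul_add] at hb
    rcases mul_eq_zero.1 hb with h | h <;> linarith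
  rw [Finset.sum_eq_zero_iff_of_nonneg fun i _ => sq_nonneg _] at hsum
  have key : ∀ i, z (Sum.inl i) = 0 ∧ z (Sum.inr i) = 0 := by
    intro i
    have h3 := pow_eq_zero_iff two_ne_zero |>.1 (hsum i (Finset.mem_univ i))
    rw [hx, gQ_mulVec_inr] at h3
    have h4 := (mul_eq_zero.1 h3).resolve_left (wtQ_pos i).ne'
    simp only [castVec_apply] at h4
    have h5 : z (Sum.inr i) = 0 := by
      by_contra hne
      have hirr := irrational_sqrt_two.mul_intCast hne
      exact hirr ⟨z (Sum.inl i), by push_cast; linarith⟩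
    rw [h5, Int.cast_zero, mul_zero, sub_zero] at h4
    exact ⟨by exact_mod_cast h4, h5⟩
  refine hz (funext fun i => ?_)
  rcases i with i | i
  · exact (key i).1
  · exact (key i).2

lemma congr_eq_of_intertwine {J M : Matrix (Fin (n + m) ⊕ Fin (n + m)) (Fin (n + m) ⊕ Fin (n + m)) ℝ}
    {S V : Matrix (Fin (n + m) ⊕ Fin (n + m)) (Fin (n + m) ⊕ Fin (n + m)) ℤ}
    (hJ : (gQ n m)ᵀ * J * gQ n m = intReal S) (hV : Vᵀ * S * V = S)
    (hM : M * gQ n m = gQ n m * intReal V) : Mᵀ * J * M = J := by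
  have hu : IsUnit (gQ n m) := (isUnit_iff_isUnit_det _).2 (isUnit_iff_ne_zero.2 det_gQ_ne_zero)
  have hut : IsUnit (gQ n m)ᵀ := by
    rw [isUnit_iff_isUnit_det, det_transpose]; exact isUnit_iff_ne_zero.2 det_gQ_ne_zero
  have h : (gQ n m)ᵀ * (Mᵀ * J * M * gQ n m) = (gQ n m)ᵀ * (J * gQ n m) := by
    calc _ = (M * gQ n m)ᵀ * J * (M * gQ n m) := by
          rw [transpose_mul]; simp only [Matrix.mul_assoc]
      _ = (intReal V)ᵀ * ((gQ n m)ᵀ * J * gQ n m) * intReal V := by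
          rw [hM, transpose_mul]; simp only [Matrix.mul_assoc]
      _ = (gQ n m)ᵀ * J * gQ n m := by
          rw [hJ, ← intReal_transpose, ← intReal_mul, ← intReal_mul, hV]
      _ = _ := Matrix.mul_assoc _ _ _
  exact hu.mul_right_cancel (hut.mul_left_cancel h)

variable (n m) in
/-- The arithmetic subgroup of `SO(Q)` preserving the lattice spanned by the columns of `gQ`. -/
def LamQ : Subgroup (SOQgrp n m) where
  carrier := {g | (∃ V, g.val.val * gQ n m = gQ n m * intReal V) ∧
    ∃ V, g⁻¹.val.val * gQ n m = gQ n m * intReal V}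
  one_mem' := ⟨⟨1, by rw [SOQgrp.val_one, intReal_one, Matrix.one_mul, Matrix.mul_one]⟩,
    ⟨1, by rw [inv_one, SOQgrp.val_one, intReal_one, Matrix.one_mul, Matrix.mul_one]⟩⟩
  mul_mem' := by
    rintro a b ⟨⟨A, hA⟩, ⟨A', hA'⟩⟩ ⟨⟨B, hB⟩, ⟨B', hB'⟩⟩
    refine ⟨⟨A * B, ?_⟩, ⟨B' * A', ?_⟩⟩
    · rw [SOQgrp.val_mul, Matrix.mul_assoc, hB, ← Matrix.mul_assoc, hA, Matrix.mul_assoc, intReal_mul]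
    · rw [_root_.mul_inv_rev, SOQgrp.val_mul, Matrix.mul_assoc, hA', ← Matrix.mul_assoc, hB',
        Matrix.mul_assoc, intReal_mul]
  inv_mem' := by
    rintro a ⟨h, h'⟩
    exact ⟨h', by rwa [inv_inv]⟩

lemma exists_mem_LamQ {V : Matrix (Fin (n + m) ⊕ Fin (n + m)) (Fin (n + m) ⊕ Fin (n + m)) ℤ}
    (hd : V.det = 1) (hV : Vᵀ * SQ n m * V = SQ n m) :
    ∃ γ ∈ LamQ n m, γ.val.val * gQ n m = gQ n m * intReal V := by
  have hu := isUnit_iff_ne_zero.2 (det_gQ_ne_zero (n := n) (m := m))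
  have hM : (gQ n m * intReal V * (gQ n m)⁻¹) * gQ n m = gQ n m * intReal V := by
    rw [Matrix.mul_assoc, nonsing_inv_mul _ hu, Matrix.mul_one]
  have hdM : (gQ n m * intReal V * (gQ n m)⁻¹).det = 1 := by
    have := congrArg Matrix.det hM
    rw [det_mul, det_mul (gQ n m), det_intReal, hd, Int.cast_one, mul_one] at this
    exact (mul_eq_right₀ det_gQ_ne_zero).1 this
  set γ := SOQgrp.mk _ hdM (congr_eq_of_intertwine gQ_congr_JQ hV hM) with hγ
  have hγV : γ.val.val * gQ n m = gQ n m * intReal V := hM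
  refine ⟨γ, ⟨⟨V, hγV⟩, V.adjugate, ?_⟩, hγV⟩
  have h1 : γ.val.val * (gQ n m * intReal V.adjugate) = gQ n m := by
    rw [← Matrix.mul_assoc, hγV, Matrix.mul_assoc, ← intReal_mul, mul_adjugate, hd, one_smul,
      intReal_one, Matrix.mul_one]
  calc γ⁻¹.val.val * gQ n m = γ⁻¹.val.val * (γ.val.val * (gQ n m * intReal V.adjugate)) := by rw [h1]
    _ = _ := by rw [← Matrix.mul_assoc, SOQgrp.val_inv_mul, Matrix.one_mul]

instance : DiscreteTopology (LamQ n m) := by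
  have hu := isUnit_iff_ne_zero.2 (det_gQ_ne_zero (n := n) (m := m))
  refine discreteTopology_of_isOpen_singleton_one ?_
  set O : Set (LamQ n m) := ⋂ i, ⋂ j, {γ | |((gQ n m)⁻¹ * γ.val.val.val * gQ n m) i j
    - (1 : Matrix _ _ ℝ) i j| < 1} with hO
  have hOo : IsOpen O := by
    refine isOpen_iInter_of_finite fun i => isOpen_iInter_of_finite fun j => ?_
    have hc : Continuous fun γ : LamQ n m => γ.val.val.val :=
      SOQgrp.continuous_val.comp continuous_subtype_val
    have hc2 : Continuous fun γ : LamQ n m => (gQ n m)⁻¹ * γ.val.val.val * gQ n m := by fun_prop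
    exact isOpen_lt (((hc2.matrix_elem i j).sub continuous_const).abs) continuous_const
  suffices h : ({1} : Set (LamQ n m)) = O by rw [h]; exact hOo
  ext γ
  simp only [hO, Set.mem_singleton_iff, Set.mem_iInter]
  constructor
  · rintro rfl i j
    change |((gQ n m)⁻¹ * (1 : Matrix (Fin (n + m) ⊕ Fin (n + m)) (Fin (n + m) ⊕ Fin (n + m)) ℝ) * gQ n m) i j - (1 : Matrix _ _ ℝ) i j| < 1
    rw [Matrix.mul_one, nonsing_inv_mul _ hu]
    simp
  · intro h
    obtain ⟨V, hV⟩ := γ.2.1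
    have h1 : V = 1 := by
      ext i j
      have h2 := h i j
      change |((gQ n m)⁻¹ * γ.val.val.val * gQ n m) i j - (1 : Matrix _ _ ℝ) i j| < 1 at h2
      rw [Matrix.mul_assoc, hV, ← Matrix.mul_assoc, nonsing_inv_mul _ hu, Matrix.one_mul,
        ← intReal_one, intReal_apply, intReal_apply] at h2
      have h3 : |V i j - (1 : Matrix _ _ ℤ) i j| < 1 := by exact_mod_cast h2
      exact sub_eq_zero.1 (Int.abs_lt_one_iff.1 h3)
    rw [h1, intReal_one, Matrix.mul_one] at hV
    refine Subtype.ext (SOQgrp.ext ?_)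
    have := congrArg (fun X => X * (gQ n m)⁻¹) hV
    simp only [Matrix.mul_assoc, mul_nonsing_inv _ hu, Matrix.mul_one] at this
    exact this

end IntegralModel

section Boosts

lemma diagonal_mul_boost {ν : Type*} [Fintype ν] [DecidableEq ν] {d : ν → ℝ}
    (hd : ∀ i, d i * d i = 1) {a b : ν} (hab : d a = -d b) (c s : ℝ) :
    diagonal d * boost a b c s = boost a b c (-s) * diagonal d := by
  have hne : a ≠ b := by
    rintro rfl
    have := hd a
    have h0 : d a = 0 := by linarith
    simp [h0] at this
  ext i j
  rw [diagonal_mul, mul_diagonal]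
  simp only [boost, swapMat, Matrix.add_apply, Matrix.smul_apply, single_apply, one_apply,
    smul_eq_mul]
  grind

/-- The sign vector changing the signs of two coordinates. -/
def flipSigns {ν : Type*} [DecidableEq ν] (b c : ν) : ν → ℝ :=
  Function.update (1 : ν → ℝ) b (-1) * Function.update (1 : ν → ℝ) c (-1)

lemma flipSigns_mul_self {ν : Type*} [DecidableEq ν] (b c i : ν) :
    flipSigns b c i * flipSigns b c i = 1 := by
  simp only [flipSigns, Pi.mul_apply, Function.update_apply, Pi.one_apply]
  split_ifs <;> norm_num

lemma det_diagonal_flipSigns {ν : Type*} [Fintype ν] [DecidableEq ν] (b c : ν) :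
    (diagonal (flipSigns b c)).det = 1 := by
  have hu : ∀ k : ν, (∏ i, Function.update (1 : ν → ℝ) k (-1) i) = -1 :=
    fun k => by rw [Finset.prod_update_of_mem (Finset.mem_univ k)]; simp
  rw [det_diagonal]
  simp only [flipSigns, Pi.mul_apply]
  rw [Finset.prod_mul_distrib, hu, hu]
  norm_num

variable {n m : ℕ}

lemma boostFam_congr_JQ (j : BoostIdx (IsPosIdx n m)) :
    (boostFam (IsPosIdx n m) j)ᵀ * JQ n m * boostFam (IsPosIdx n m) j = JQ n m := by
  obtain ⟨⟨⟨a, b⟩, ha, hb⟩, t⟩ := j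
  have hab : a ≠ b := fun e => hb (e ▸ ha)
  have hs : sgnQ n m a = -sgnQ n m b := by
    rw [(sgnQ_eq_or n m b).resolve_left hb, neg_neg]; exact ha
  simp only [boostFam]
  rw [boost_transpose, Matrix.mul_assoc, JQ, diagonal_mul_boost (sgnQ_mul_self n m) hs,
    ← Matrix.mul_assoc, boost_mul hab]
  cases t <;> norm_num

/-- The boosts as elements of `SO(Q)`. -/
noncomputable def SOQgrp.boost (j : BoostIdx (IsPosIdx n m)) : SOQgrp n m :=
  SOQgrp.mk (boostFam (IsPosIdx n m) j) (det_boostFam _ j) (boostFam_congr_JQ j)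

lemma SOQgrp.exists_conj_boost (hn : 1 ≤ n) (hm : 1 ≤ m) (j : BoostIdx (IsPosIdx n m)) :
    ∃ h : SOQgrp n m, h * (SOQgrp.boost j)⁻¹ * h⁻¹ = (SOQgrp.boost j)⁻¹⁻¹ := by
  obtain ⟨⟨⟨a, b⟩, ha, hb⟩, t⟩ := j
  have hab : a ≠ b := fun e => hb (e ▸ ha)
  obtain ⟨c, hc⟩ : ∃ c, c ∉ ({a, b} : Finset (Fin (n + m) ⊕ Fin (n + m))) := by
    by_contra! hcon
    have h1 := Finset.card_le_card fun x (_ : x ∈ Finset.univ) => hcon x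
    have h2 := Finset.card_le_two (a := a) (b := b)
    rw [Finset.card_univ, Fintype.card_sum, Fintype.card_fin] at h1
    omega
  simp only [Finset.mem_insert, Finset.mem_singleton, not_or] at hc
  have hdd := flipSigns_mul_self b c
  have hdet := det_diagonal_flipSigns b c
  set d := flipSigns b c with hd
  have hdJ : (diagonal d)ᵀ * JQ n m * diagonal d = JQ n m := by
    rw [diagonal_transpose, JQ, diagonal_mul_diagonal, diagonal_mul_diagonal]
    congr 1; ext i
    linear_combination (sgnQ n m i) * hdd i
  have hdab : d a = -d b := by
    simp [hd, flipSigns, hab, Ne.symm hc.1, Ne.symm hc.2]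
  refine ⟨SOQgrp.mk _ hdet hdJ, ?_⟩
  set D := SOQgrp.mk _ hdet hdJ with hD
  set B := SOQgrp.boost (n := n) (m := m) ⟨⟨⟨a, b⟩, ha, hb⟩, t⟩ with hB
  have hDB : B * (D * B) = D := by
    refine SOQgrp.ext ?_
    change boostFam (IsPosIdx n m) ⟨⟨⟨a, b⟩, ha, hb⟩, t⟩ *
      (diagonal d * boostFam (IsPosIdx n m) ⟨⟨⟨a, b⟩, ha, hb⟩, t⟩) = diagonal d
    simp only [boostFam]
    rw [diagonal_mul_boost hdd hdab, ← Matrix.mul_assoc, boost_mul hab]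
    cases t <;> norm_num
  rw [inv_inv, mul_inv_eq_iff_eq_mul, mul_inv_eq_iff_eq_mul]
  rw [mul_assoc]; exact hDB.symm

end Boosts

section Lattice

variable {n m : ℕ}

lemma det_sq_eq_one_of_intertwine
    {M : Matrix (Fin (n + m) ⊕ Fin (n + m)) (Fin (n + m) ⊕ Fin (n + m)) ℝ}
    {V : Matrix (Fin (n + m) ⊕ Fin (n + m)) (Fin (n + m) ⊕ Fin (n + m)) ℤ} (hd : M.det = 1)
    (hM : M * gQ n m = gQ n m * intReal V) : V.det ^ 2 = 1 := by
  have := congrArg Matrix.det hM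
  rw [det_mul, det_mul (gQ n m), det_intReal, hd, one_mul] at this
  have h1 := (left_eq_mul₀ det_gQ_ne_zero).1 this
  have h2 : V.det = 1 := by exact_mod_cast h1
  rw [h2, one_pow]

/-- A bounded set of representatives in `SO(Q)`. -/
def repSet (T : Set (Matrix (Fin (n + m) ⊕ Fin (n + m)) (Fin (n + m) ⊕ Fin (n + m)) ℤ)) (R : ℝ) :
    Set (SOQgrp n m) :=
  ⋃ U ∈ T, {g | ∀ i j, |(g.val.val * (gQ n m * intReal U)) i j| ≤ R}

lemma isCompact_repSet
    {T : Set (Matrix (Fin (n + m) ⊕ Fin (n + m)) (Fin (n + m) ⊕ Fin (n + m)) ℤ)}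
    (hT : T.Finite) (hd : ∀ U ∈ T, U.det = 1) (R : ℝ) : IsCompact (repSet (n := n) T R) :=
  hT.isCompact_biUnion fun U hU => SOQgrp.isCompact_entries_le (by
    rw [det_mul, det_intReal, hd U hU, Int.cast_one, mul_one]; exact det_gQ_ne_zero) R

lemma isLattice_LamQ (hn : 1 ≤ n) (hm : 1 ≤ m) [MeasurableSpace (SOQgrp n m)]
    [BorelSpace (SOQgrp n m)] (μ : Measure (SOQgrp n m)) [μ.IsHaarMeasure] :
    IsLattice μ (LamQ n m) := by
  have ha : IsPosIdx n m (Sum.inl ⟨0, by omega⟩) := by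
    simp [IsPosIdx, sgnQ, show 0 < n by omega]
  have hb₀ : ¬ IsPosIdx n m (Sum.inr ⟨0, by omega⟩) := by
    simp only [IsPosIdx, sgnQ, Sum.elim_inr]; norm_num
  have hb₁ : ¬ IsPosIdx n m (Sum.inl ⟨n, by omega⟩) := by
    simp only [IsPosIdx, sgnQ, Sum.elim_inl, lt_irrefl, if_false]; norm_num
  have hδ : 0 < (gQ n m).det ^ 2 := by have := det_gQ_ne_zero (n := n) (m := m); positivity
  obtain ⟨f, hf0, hfV, ⟨c, b, -, hc, hb, hfa⟩, hfr, hfm⟩ :=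
    exists_lyapunov (IsPosIdx n m) ha hb₀ hb₁ (by simp) hδ
  have hdet : ∀ x : SOQgrp n m, (x⁻¹.val.val * gQ n m).det = (gQ n m).det := fun x => by
    rw [det_mul, SOQgrp.det_eq_one, one_mul]
  have : Nonempty (Fin (n + m) ⊕ Fin (n + m)) := ⟨Sum.inl ⟨0, by omega⟩⟩
  have : Nonempty (BoostIdx (IsPosIdx n m)) := ⟨⟨⟨(_, _), ha, hb₀⟩, true⟩⟩
  refine isLattice_of_lyapunov μ (LamQ n m) (fun j => (SOQgrp.boost j)⁻¹)
    (SOQgrp.exists_conj_boost hn hm) (f := fun x => f (x⁻¹.val.val * gQ n m))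
    (fun x => hf0 _) ?_ ?_ hc hb (fun x => ?_) fun R => ?_
  · refine hfm (SOQgrp n m) _ ?_ fun x => by rw [hdet]; exact det_gQ_ne_zero
    exact (SOQgrp.continuous_val.comp continuous_inv).matrix_mul continuous_const
  · rintro γ ⟨-, V, hV⟩ x
    rw [_root_.mul_inv_rev, SOQgrp.val_mul, Matrix.mul_assoc, hV, ← Matrix.mul_assoc]
    exact hfV _ _ (by rw [hdet]; exact det_gQ_ne_zero)
      (det_sq_eq_one_of_intertwine (SOQgrp.det_eq_one _) hV)
  · have h := hfa (x⁻¹.val.val * gQ n m) (by rw [hdet])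
    refine le_of_eq_of_le (Finset.sum_congr rfl fun j _ => ?_) h
    rw [_root_.mul_inv_rev, inv_inv, SOQgrp.val_mul, Matrix.mul_assoc]
    rfl
  · obtain ⟨r, hr, hfr⟩ := hfr R
    obtain ⟨T, hT, hTd, R', h⟩ := exists_finite_reduction (fun _ : Unit => JQ n m)
      (fun _ => SQ n m) (gQ n m) det_gQ_ne_zero (fun _ => gQ_congr_JQ) hr
    refine ⟨(repSet T R')⁻¹, (isCompact_repSet hT hTd R').inv, fun x hx => ?_⟩
    obtain ⟨U, hU, V, hVd, hVS, hUV⟩ := h x⁻¹.val.val (SOQgrp.det_eq_one _)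
      (fun _ => SOQgrp.congr_eq _) (hfr _ (by rw [hdet]; exact det_gQ_ne_zero) hx)
    obtain ⟨γ, hγ, hγV⟩ := exists_mem_LamQ hVd (hVS ())
    refine ⟨γ, hγ, γ⁻¹ * x, ?_, by group⟩
    rw [Set.mem_inv, _root_.mul_inv_rev, inv_inv]
    refine Set.mem_biUnion hU fun i j => ?_
    have := hUV i j
    rwa [Matrix.mul_assoc x⁻¹.val.val, ← hγV, Matrix.mul_assoc, Matrix.mul_assoc,
      ← Matrix.mul_assoc, ← SOQgrp.val_mul] at this

end Lattice

section NonCocompact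

variable {n m : ℕ}

lemma boost_mulVec_single_add_single {ν : Type*} [Fintype ν] [DecidableEq ν] {a b : ν} (hab : a ≠ b)
    (c s : ℝ) :
    boost a b c s *ᵥ (Pi.single a 1 + Pi.single b 1) = (c + s) • (Pi.single a 1 + Pi.single b 1) := by
  simp only [boost, add_mulVec, smul_mulVec, swapMat_mulVec, one_mulVec, single_mulVec]
  ext i
  by_cases hi : i = a <;> by_cases hj : i = b <;> subst_vars <;>
    simp_all [eq_comm]

lemma gQ_mulVec_single (i : Fin (n + m)) :
    gQ n m *ᵥ Pi.single (Sum.inl i) 1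
      = wtQ n m i • (Pi.single (Sum.inl i) 1 + Pi.single (Sum.inr i) 1) := by
  ext (j | j) <;> simp [gQ, Matrix.col, diagonal_apply, Pi.single_apply] <;>
    exact ite_congr rfl (fun h => by rw [h]) fun _ => rfl

lemma not_compactSpace_quotient_LamQ (hn : 1 ≤ n) :
    ¬ CompactSpace (SOQgrp n m ⧸ LamQ n m) := by
  intro hcomp
  set i₀ : Fin (n + m) := ⟨0, by omega⟩
  have ha : IsPosIdx n m (Sum.inl i₀) := by
    simp [IsPosIdx, sgnQ, i₀, show 0 < n by omega]
  have hb : ¬ IsPosIdx n m (Sum.inr i₀) := by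
    simp only [IsPosIdx, sgnQ, Sum.elim_inr]; norm_num
  set e : Fin (n + m) ⊕ Fin (n + m) → ℤ := Pi.single (Sum.inl i₀) 1 with he
  have he0 : e ≠ 0 := by simp [he]
  have hce : castVec e = Pi.single (Sum.inl i₀) 1 := by
    ext j; simp [he, Pi.single_apply]
  set w := gQ n m *ᵥ castVec e with hw
  set B : SOQgrp n m := SOQgrp.boost ⟨⟨(Sum.inl i₀, Sum.inr i₀), ha, hb⟩, false⟩ with hB
  have hBw : B.val.val *ᵥ w = (1 / 2 : ℝ) • w := by
    rw [hw, hce, gQ_mulVec_single, mulVec_smul]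
    change _ • (boostFam (IsPosIdx n m) _ *ᵥ _) = _
    rw [boostFam, boost_mulVec_single_add_single (by simp), smul_comm]
    norm_num
  have hBk : ∀ k : ℕ, (B ^ k).val.val *ᵥ w = (1 / 2 : ℝ) ^ k • w := by
    intro k
    induction k with
    | zero => rw [pow_zero, pow_zero, one_smul, SOQgrp.val_one, one_mulVec]
    | succ k ih =>
      rw [pow_succ, SOQgrp.val_mul, ← mulVec_mulVec, hBw, mulVec_smul, ih, smul_smul, pow_succ,
        mul_comm]
  have hpd : ((gQ n m)ᵀ * gQ n m).PosDef :=
    posDef_of_gramDet_ne_zero (by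
      rw [gramDet, det_mul, det_transpose]; exact mul_ne_zero det_gQ_ne_zero det_gQ_ne_zero)
  obtain ⟨r, hr, hrz⟩ := hpd.exists_pos_le_qf
  set N : SOQgrp n m → ℝ := fun g => g⁻¹.val.val *ᵥ w ⬝ᵥ g⁻¹.val.val *ᵥ w with hN
  have hNc : Continuous N := by
    have h1 : Continuous fun g : SOQgrp n m => g⁻¹.val.val :=
      SOQgrp.continuous_val.comp continuous_inv
    have h2 : Continuous fun g : SOQgrp n m => g⁻¹.val.val *ᵥ w := h1.matrix_mulVec continuous_const
    exact h2.dotProduct h2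
  obtain ⟨k, hk⟩ := isCompact_univ.elim_directed_cover
    (fun k : ℕ => (QuotientGroup.mk : SOQgrp n m → SOQgrp n m ⧸ LamQ n m) '' {g | N g < k})
    (fun k => QuotientGroup.isOpenMap_coe _ (isOpen_lt hNc continuous_const))
    (fun q _ => by
      obtain ⟨g, rfl⟩ := QuotientGroup.mk_surjective q
      obtain ⟨k, hk⟩ := exists_nat_gt (N g)
      exact Set.mem_iUnion.2 ⟨k, g, hk, rfl⟩)
    (Monotone.directed_le fun k l hkl => Set.image_mono fun g (hg : N g < k) =>
      lt_of_lt_of_le hg (Nat.cast_le.2 hkl))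
  obtain ⟨j, hj⟩ := exists_pow_lt_of_lt_one (show 0 < r / (k + 1) by positivity)
    (show (1 / 4 : ℝ) < 1 by norm_num)
  obtain ⟨c, hc, hcg⟩ := hk (Set.mem_univ (QuotientGroup.mk (B ^ j)))
  obtain ⟨⟨V, hV⟩, -⟩ := QuotientGroup.eq.1 hcg
  have hz : V *ᵥ e ≠ 0 := by
    intro h0
    have hdV : V.det ≠ 0 := fun h => by
      have := det_sq_eq_one_of_intertwine (SOQgrp.det_eq_one _) hV
      rw [h] at this; norm_num at this
    exact he0 (eq_zero_of_mulVec_eq_zero hdV h0)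
  have h1 := hrz _ hz
  rw [qf_transpose_mul_self, castVec_mulVec, mulVec_mulVec, ← hV, ← mulVec_mulVec, ← hw,
    SOQgrp.val_mul, ← mulVec_mulVec, hBk, mulVec_smul, smul_dotProduct, dotProduct_smul,
    smul_eq_mul, smul_eq_mul, ← mul_assoc, ← mul_pow] at h1
  have hc : N c < k := hc
  change r ≤ _ * N c at h1
  rw [lt_div_iff₀ (by positivity)] at hj
  norm_num at h1 hj
  have h4 : (0 : ℝ) < (1 / 4) ^ j := by positivity
  nlinarith

end NonCocompact

section BlockDiagonal

variable {n m : ℕ}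

lemma congr_JQ'_iff (g : SOQgrp n m) : g.val.valᵀ * JQ' n m * g.val.val = JQ' n m ↔
    (∀ i j, g.val.val (Sum.inl i) (Sum.inr j) = 0) ∧
      ∀ i j, g.val.val (Sum.inr i) (Sum.inl j) = 0 := by
  set d : Fin (n + m) ⊕ Fin (n + m) → ℝ := Sum.elim (fun _ => √2) fun _ => -√2 with hd
  have hJd : JQ' n m = JQ n m * diagonal d := by
    rw [JQ', JQ, diagonal_mul_diagonal]
    congr 1; ext (i | i) <;> simp [hd, sgnQ, mul_comm]
  have hJg : IsUnit (g.val.valᵀ * JQ n m) := by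
    refine IsUnit.of_mul_eq_one (g.val.val * JQ n m) ?_
    rw [← Matrix.mul_assoc, SOQgrp.congr_eq, JQ_mul_self]
  have h1 : g.val.valᵀ * JQ' n m * g.val.val = JQ' n m ↔
      diagonal d * g.val.val = g.val.val * diagonal d := by
    have e1 : g.val.valᵀ * JQ' n m * g.val.val
        = g.val.valᵀ * JQ n m * (diagonal d * g.val.val) := by
      rw [hJd]; simp only [Matrix.mul_assoc]
    have e2 : JQ' n m = g.val.valᵀ * JQ n m * (g.val.val * diagonal d) := by
      rw [← Matrix.mul_assoc, SOQgrp.congr_eq, hJd]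
    rw [e1, e2]
    exact hJg.mul_right_inj
  have s2 : 0 < √2 := by positivity
  rw [h1, ← Matrix.ext_iff]
  simp only [diagonal_mul, mul_diagonal, hd]
  constructor
  · refine fun h => ⟨fun i j => ?_, fun i j => ?_⟩
    · have := h (Sum.inl i) (Sum.inr j)
      simp only [Sum.elim_inl, Sum.elim_inr] at this
      exact (mul_eq_zero.1 (by linarith : √2 * g.val.val (Sum.inl i) (Sum.inr j) = 0)).resolve_left
        s2.ne'
    · have := h (Sum.inr i) (Sum.inl j)
      simp only [Sum.elim_inl, Sum.elim_inr] at this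
      exact (mul_eq_zero.1 (by linarith : √2 * g.val.val (Sum.inr i) (Sum.inl j) = 0)).resolve_left
        s2.ne'
  · rintro ⟨h, h'⟩ (i | i) (j | j)
    · simp [mul_comm]
    · simp [h]
    · simp [h']
    · simp [mul_comm]

lemma det_toBlocks_mul_det_toBlocks {g : SOQgrp n m}
    (h : ∀ i j, g.val.val (Sum.inl i) (Sum.inr j) = 0)
    (h' : ∀ i j, g.val.val (Sum.inr i) (Sum.inl j) = 0) :
    g.val.val.toBlocks₁₁.det * g.val.val.toBlocks₂₂.det = 1 ∧ g.val.val.toBlocks₂₂.det ^ 2 = 1 := by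
  have h12 : g.val.val.toBlocks₁₂ = 0 := by ext i j; exact h i j
  have h21 : g.val.val.toBlocks₂₁ = 0 := by ext i j; exact h' i j
  have hb := fromBlocks_toBlocks g.val.val
  rw [h12, h21] at hb
  constructor
  · have := SOQgrp.det_eq_one g
    rwa [← hb, det_fromBlocks_zero₂₁] at this
  · have hJ : JQ n m = fromBlocks (diagonal fun i => sgnQ n m (Sum.inl i)) 0 0 (-1) := by
      rw [JQ, ← diagonal_one, diagonal_neg, ← diagonal_sumElim]; congr 1
    have := SOQgrp.congr_eq g
    rw [← hb, hJ, fromBlocks_transpose, fromBlocks_multiply, fromBlocks_multiply] at this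
    have := (fromBlocks_inj.1 this).2.2.2
    simp only [transpose_zero, Matrix.zero_mul, Matrix.mul_zero, add_zero, zero_add,
      Matrix.mul_neg, Matrix.mul_one, Matrix.neg_mul, neg_inj] at this
    have := congrArg Matrix.det this
    rwa [det_mul, det_transpose, det_one, ← pow_two] at this

lemma isClosed_blockDiagSubgroup : IsClosed (blockDiagSubgroup n m : Set (SOQgrp n m)) := by
  have hc := SOQgrp.continuous_val (n := n) (m := m)
  have e1 : Continuous fun g : SOQgrp n m => g.val.val.toBlocks₁₁.det :=
    (hc.matrix_submatrix Sum.inl Sum.inl).matrix_det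
  have e2 : Continuous fun g : SOQgrp n m => g.val.val.toBlocks₂₂.det :=
    (hc.matrix_submatrix Sum.inr Sum.inr).matrix_det
  have c1 : IsClosed {g : SOQgrp n m | ∀ i j, g.val.val (Sum.inl i) (Sum.inr j) = 0} := by
    simp only [Set.ofPred_forall]
    exact isClosed_iInter fun i => isClosed_iInter fun j =>
      isClosed_eq (hc.matrix_elem _ _) continuous_const
  have c2 : IsClosed {g : SOQgrp n m | ∀ i j, g.val.val (Sum.inr i) (Sum.inl j) = 0} := by
    simp only [Set.ofPred_forall]
    exact isClosed_iInter fun i => isClosed_iInter fun j =>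
      isClosed_eq (hc.matrix_elem _ _) continuous_const
  exact c1.inter (c2.inter ((isClosed_eq e1 continuous_const).inter (isClosed_eq e2 continuous_const)))

/-- Some element of `LamQ` is block-diagonal with both blocks of determinant `-1`. -/
lemma exists_mem_LamQ_det_toBlocks (i₀ : Fin (n + m)) :
    ∃ γ ∈ LamQ n m, γ * γ = 1 ∧ (∀ i j, γ.val.val (Sum.inl i) (Sum.inr j) = 0) ∧
      (∀ i j, γ.val.val (Sum.inr i) (Sum.inl j) = 0) ∧
      γ.val.val.toBlocks₁₁.det = -1 ∧ γ.val.val.toBlocks₂₂.det = -1 := by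
  set u : Fin (n + m) → ℝ := Function.update 1 i₀ (-1) with hu
  have hdu : (diagonal u).det = -1 := by
    rw [det_diagonal, hu, Finset.prod_update_of_mem (Finset.mem_univ _)]; simp
  have huu : ∀ i, u i * u i = 1 := fun i => by
    simp only [hu, Function.update_apply, Pi.one_apply]; split_ifs <;> norm_num
  set M : Matrix (Fin (n + m) ⊕ Fin (n + m)) (Fin (n + m) ⊕ Fin (n + m)) ℝ :=
    fromBlocks (diagonal u) 0 0 (diagonal u) with hM
  have hMM : M * M = 1 := by
    rw [hM, fromBlocks_multiply]
    simp [huu]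
  have hMd : M = diagonal (Sum.elim u u) := (fromBlocks_diagonal u u)
  have hMJ : Mᵀ * JQ n m * M = JQ n m := by
    have : JQ n m * M = M * JQ n m := by
      rw [hMd, JQ, diagonal_mul_diagonal, diagonal_mul_diagonal]; congr 1; ext i; exact mul_comm _ _
    rw [Matrix.mul_assoc, this, ← Matrix.mul_assoc]
    have hMt : Mᵀ = M := by rw [hMd, diagonal_transpose]
    rw [hMt, hMM, Matrix.one_mul]
  have hdM : M.det = 1 := by rw [hM, det_fromBlocks_zero₂₁, hdu]; norm_num
  set γ := SOQgrp.mk M hdM hMJ with hγ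
  have hγγ : γ * γ = 1 := SOQgrp.ext hMM
  have hγV : γ.val.val * gQ n m = gQ n m * intReal (fromBlocks
      (diagonal (Function.update 1 i₀ (-1))) 0 0 (diagonal (Function.update 1 i₀ (-1)))) := by
    change M * gQ n m = _
    have hi : (diagonal (Function.update (1 : Fin (n + m) → ℤ) i₀ (-1))).map (Int.castRingHom ℝ)
        = diagonal u := by
      rw [diagonal_map (map_zero _)]; congr 1; ext i
      simp only [hu, Function.update_apply, Pi.one_apply]; split_ifs <;> simp
    rw [intReal, fromBlocks_map, hi, Matrix.map_zero _ (map_zero _), hM, gQ, fromBlocks_multiply, fromBlocks_multiply]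
    simp only [diagonal_mul_diagonal, Matrix.zero_mul, Matrix.mul_zero, add_zero, zero_add]
    congr 2 <;> ext i <;> ring
  refine ⟨γ, ⟨⟨_, hγV⟩, _, by rw [inv_eq_of_mul_eq_one_left hγγ]; exact hγV⟩, hγγ, fun _ _ => rfl,
    fun _ _ => rfl, ?_, ?_⟩
  · change M.toBlocks₁₁.det = -1
    rw [hM, toBlocks_fromBlocks₁₁, hdu]
  · change M.toBlocks₂₂.det = -1
    rw [hM, toBlocks_fromBlocks₂₂, hdu]

lemma discreteTopology_subgroupOf {G : Type*} [Group G] [TopologicalSpace G] (Λ H : Subgroup G)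
    [DiscreteTopology Λ] : DiscreteTopology (Λ.subgroupOf H) :=
  DiscreteTopology.of_continuous_injective
    (f := fun x : Λ.subgroupOf H => (⟨x.1.1, x.2⟩ : Λ))
    ((continuous_subtype_val.comp continuous_subtype_val).subtype_mk _)
    fun _ _ h => Subtype.ext (Subtype.ext (congrArg (fun z : Λ => (z : G)) h))

lemma compactSpace_blockDiagSubgroup_quotient (hn : 1 ≤ n) :
    CompactSpace (blockDiagSubgroup n m ⧸ (LamQ n m).subgroupOf (blockDiagSubgroup n m)) := by
  obtain ⟨T, hT, hTd, R, hred⟩ := by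
    have : Nonempty (Fin (n + m) ⊕ Fin (n + m)) := ⟨Sum.inl ⟨0, by omega⟩⟩
    exact exists_finite_reduction (fun t : Bool => if t then JQ n m else JQ' n m)
      (fun t => if t then SQ n m else SQ' n m) (gQ n m) det_gQ_ne_zero
      (by rintro (_ | _) <;> simp [gQ_congr_JQ, gQ_congr_JQ']) (show (0 : ℝ) < 1 / 2 by norm_num)
  obtain ⟨γ₁, hγ₁, hγ₁₁, h12, h21, h11, h22⟩ :=
    exists_mem_LamQ_det_toBlocks (⟨0, by omega⟩ : Fin (n + m))
  have hC := isCompact_repSet (n := n) (m := m) hT hTd R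
  have hC' := hC.union ((Homeomorph.mulRight γ₁).isCompact_preimage.2 hC)
  have hK := isClosed_blockDiagSubgroup.isClosedEmbedding_subtypeVal.isCompact_preimage hC'
  have hKi := hK.image
    (QuotientGroup.continuous_mk (N := (LamQ n m).subgroupOf (blockDiagSubgroup n m)))
  refine ⟨hKi.of_isClosed_subset isClosed_univ fun q _ => ?_⟩
  obtain ⟨h, rfl⟩ := QuotientGroup.mk_surjective q
  have hJ := SOQgrp.congr_eq h.1
  have hJ' := (congr_JQ'_iff h.1).2 ⟨h.2.1, h.2.2.1⟩
  obtain ⟨U, hU, V, hVd, hVS, hUV⟩ := hred h.1.val.val (SOQgrp.det_eq_one _)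
    (by rintro (_ | _) <;> simp [hJ, hJ']) fun z hz => half_le_qf_of_preserves hJ hJ' hz
  obtain ⟨γ, hγ, hγV⟩ := exists_mem_LamQ hVd (by simpa using hVS true)
  have hγJ' := congr_eq_of_intertwine gQ_congr_JQ' (by simpa using hVS false) hγV
  obtain ⟨hγ12, hγ21⟩ := (congr_JQ'_iff γ).1 hγJ'
  obtain ⟨hdd, hd2⟩ := det_toBlocks_mul_det_toBlocks hγ12 hγ21
  have hmem : h.1 * γ ∈ repSet T R := by
    refine Set.mem_biUnion hU fun i j => ?_
    have := hUV i j
    rwa [Matrix.mul_assoc h.1.val.val, ← hγV, Matrix.mul_assoc, Matrix.mul_assoc,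
      ← Matrix.mul_assoc, ← SOQgrp.val_mul] at this
  have key : ∀ δ, (hδH : δ ∈ blockDiagSubgroup n m) → δ ∈ LamQ n m →
      h.1 * δ ∈ repSet T R ∪ Homeomorph.mulRight γ₁ ⁻¹' repSet T R →
      (QuotientGroup.mk h : _ ⧸ (LamQ n m).subgroupOf (blockDiagSubgroup n m)) ∈
        QuotientGroup.mk '' (Subtype.val ⁻¹' (repSet T R ∪ Homeomorph.mulRight γ₁ ⁻¹' repSet T R)) := by
    intro δ hδH hδ hδm
    refine ⟨h * ⟨δ, hδH⟩, hδm, QuotientGroup.eq.2 ?_⟩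
    rw [_root_.mul_inv_rev, inv_mul_cancel_right]
    exact ((LamQ n m).subgroupOf (blockDiagSubgroup n m)).inv_mem (x := ⟨δ, hδH⟩) hδ
  rcases sq_eq_one_iff.1 hd2 with hd | hd
  · rw [hd, mul_one] at hdd
    exact key γ ⟨hγ12, hγ21, hdd, hd⟩ hγ (Or.inl hmem)
  · rw [hd] at hdd
    refine key (γ * γ₁) ⟨fun i j => ?_, fun i j => ?_, ?_, ?_⟩ (mul_mem hγ hγ₁) (Or.inr ?_)
    · rw [SOQgrp.val_mul]; simp [Matrix.mul_apply, Fintype.sum_sum_type, hγ12, h12]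
    · rw [SOQgrp.val_mul]; simp [Matrix.mul_apply, Fintype.sum_sum_type, hγ21, h21]
    · rw [SOQgrp.val_mul, toBlocks11_mul _ _ hγ12, det_mul, h11]; linarith
    · rw [SOQgrp.val_mul, toBlocks22_mul _ _ hγ21, det_mul, h22, hd]; norm_num
    · change h.1 * (γ * γ₁) * γ₁ ∈ repSet T R
      rwa [mul_assoc, mul_assoc, hγ₁₁, mul_one]

end BlockDiagonal

/-- There is a non-cocompact lattice `Λ` in `SO(Q) ≅ SO(n, n+2m)` whose intersection with
the block-diagonal subgroup `H ≅ SO(n,m) × SO(n+m)` is a cocompact lattice in `H`. -/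
theorem exists_noncocompact_lattice_cocompact_on_block_diagonal
    (n m : ℕ) (hn : 1 ≤ n) (hm : 1 ≤ m)
    [MeasurableSpace ↥(SOQgrp n m)] [BorelSpace ↥(SOQgrp n m)]
    (μ : Measure ↥(SOQgrp n m)) [μ.IsHaarMeasure] :
    ∃ Λ : Subgroup ↥(SOQgrp n m),
      IsLattice μ Λ ∧
      ¬ CompactSpace (↥(SOQgrp n m) ⧸ Λ) ∧
      DiscreteTopology ↥(Λ.subgroupOf (blockDiagSubgroup n m)) ∧
      CompactSpace (↥(blockDiagSubgroup n m) ⧸ Λ.subgroupOf (blockDiagSubgroup n m)) := by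
  exact ⟨LamQ n m, isLattice_LamQ hn hm μ, not_compactSpace_quotient_LamQ hn,
    discreteTopology_subgroupOf _ _, compactSpace_blockDiagSubgroup_quotient hn⟩
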